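/- arXiv:2112.10533 — 2 statements merged into one kernel-verified Lean document; each statement's English description precedes it below -/
import Mathlib

section
/- Let f ∈ ℝ[x,y,z] be a smooth psd ternary quartic. Then the Gram spectrahedron Gram(f) has at most six faces of dimension 1: the collection of faces F of Gram(f) with dim F = 1 is finite with at most 6 elements. -/
open MvPolynomial Matrix

/-- The monomial basis `x², y², z², xy, xz, yz` of `ℝ[x,y,z]₂`. -/
noncomputable def gramBasis : Fin 6 → MvPolynomial (Fin 3) ℝ :=
  ![X 0 ^ 2, X 1 ^ 2, X 2 ^ 2, X 0 * X 1, X 0 * X 2, X 1 * X 2]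

/-- The Gram spectrahedron of `f`: all real symmetric psd `6×6` matrices `G` with
`Σᵢⱼ gᵢⱼ·mᵢ·mⱼ = f` for the monomial basis `m` of `ℝ[x,y,z]₂`. -/
noncomputable def GramSpectrahedron (f : MvPolynomial (Fin 3) ℝ) :
    Set (Matrix (Fin 6) (Fin 6) ℝ) :=
  {G | G.PosSemidef ∧
    (∑ i, ∑ j, MvPolynomial.C (G i j) * (gramBasis i * gramBasis j)) = f}

/-- `f` is smooth: no nonzero complex point at which all partial derivatives of the
complexification of `f` vanish. -/
def IsSmooth (f : MvPolynomial (Fin 3) ℝ) : Prop :=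
  ∀ a : Fin 3 → ℂ,
    (∀ i, eval a (pderiv i (map (algebraMap ℝ ℂ) f)) = 0) → a = 0

/-- `f` is positive semidefinite on `ℝ³`. -/
def IsPsd (f : MvPolynomial (Fin 3) ℝ) : Prop :=
  ∀ a : Fin 3 → ℝ, 0 ≤ eval a f

/-- A face of a convex set `S`: a convex subset `F ⊆ S` such that whenever a point
of `F` lies in the open segment between two points of `S`, both endpoints lie in `F`. -/
def IsFace {E : Type*} [AddCommGroup E] [Module ℝ E] (S F : Set E) : Prop :=
  F ⊆ S ∧ Convex ℝ F ∧ ∀ x ∈ S, ∀ y ∈ S, ∀ t : ℝ, 0 < t → t < 1 →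
    t • x + (1 - t) • y ∈ F → x ∈ F ∧ y ∈ F

/-- Perturbation: a psd matrix stays psd under small perturbations which vanish on its kernel. -/
lemma psd_perturb (M D : Matrix (Fin 6) (Fin 6) ℝ) (hM : M.PosSemidef) (hD : Dᵀ = D)
    (hk : ∀ w, M *ᵥ w = 0 → D *ᵥ w = 0) :
    ∃ ε : ℝ, 0 < ε ∧ (M + ε • D).PosSemidef ∧ (M - ε • D).PosSemidef := by
  classical
  obtain ⟨B, hB⟩ : ∃ B : Matrix (Fin 6) (Fin 6) ℝ, M = Bᵀ * B := by
    have hs := hM.1.spectral_theorem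
    set U : Matrix (Fin 6) (Fin 6) ℝ := (hM.1.eigenvectorUnitary).val with hU
    refine ⟨diagonal (fun i => Real.sqrt (hM.1.eigenvalues i)) * Uᵀ, ?_⟩
    rw [Unitary.conjStarAlgAut_apply] at hs
    conv_lhs => rw [hs]
    rw [transpose_mul, transpose_transpose, diagonal_transpose]
    simp only [Matrix.mul_assoc]
    congr 1
    rw [← Matrix.mul_assoc (diagonal _), diagonal_mul_diagonal]
    congr 2
    funext i
    simp [Real.mul_self_sqrt (hM.eigenvalues_nonneg i)]
  have hquad : ∀ x, x ⬝ᵥ M *ᵥ x = (B *ᵥ x) ⬝ᵥ (B *ᵥ x) := by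
    intro x
    rw [hB, ← mulVec_mulVec, dotProduct_mulVec, vecMul_transpose]
  have hBk : ∀ w, B *ᵥ w = 0 → M *ᵥ w = 0 := by
    intro w hw; rw [hB, ← mulVec_mulVec, hw, mulVec_zero]
  obtain ⟨g, hg⟩ : ∃ g : (Fin 6 → ℝ) →ₗ[ℝ] (Fin 6 → ℝ), ∀ x, B *ᵥ (g (B *ᵥ x)) = B *ᵥ x := by
    obtain ⟨s, hs⟩ := LinearMap.exists_rightInverse_of_surjective B.mulVecLin.rangeRestrict
      (LinearMap.range_rangeRestrict _)
    obtain ⟨g, hg⟩ := LinearMap.exists_extend s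
    refine ⟨g, fun x => ?_⟩
    have h1 := LinearMap.congr_fun hg ⟨B *ᵥ x, ⟨x, rfl⟩⟩
    have h2 := congrArg Subtype.val (LinearMap.congr_fun hs ⟨B *ᵥ x, ⟨x, rfl⟩⟩)
    simp only [LinearMap.comp_apply, Submodule.subtype_apply] at h1
    rw [h1]
    simpa using h2
  have hsymm : ∀ x y, x ⬝ᵥ D *ᵥ y = y ⬝ᵥ D *ᵥ x := by
    intro x y
    rw [dotProduct_mulVec, dotProduct_comm, ← mulVec_transpose, hD]
  set Gm := LinearMap.toMatrix' g with hGm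
  have hGg : ∀ y, Gm *ᵥ y = g y := fun y => LinearMap.toMatrix'_mulVec g y
  set Z := Gmᵀ * D * Gm with hZ
  have hDq : ∀ x, x ⬝ᵥ D *ᵥ x = (B *ᵥ x) ⬝ᵥ Z *ᵥ (B *ᵥ x) := by
    intro x
    set y := g (B *ᵥ x) with hy
    have h0 : D *ᵥ (x - y) = 0 := hk _ (hBk _ (by rw [mulVec_sub, hy, hg, sub_self]))
    have h1 : D *ᵥ x = D *ᵥ y := by rwa [mulVec_sub, sub_eq_zero] at h0
    have h2 : (B *ᵥ x) ⬝ᵥ Z *ᵥ (B *ᵥ x) = y ⬝ᵥ D *ᵥ y := by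
      rw [hZ, Matrix.mul_assoc, ← mulVec_mulVec, ← mulVec_mulVec, hGg, ← hy, mulVec_transpose,
        dotProduct_comm, ← dotProduct_mulVec, hGg, ← hy, dotProduct_comm, hsymm]
    rw [h2, h1, hsymm, h1]
  obtain ⟨C, hC0, hC⟩ : ∃ C : ℝ, 0 < C ∧ ∀ y : Fin 6 → ℝ, |y ⬝ᵥ Z *ᵥ y| ≤ C * (y ⬝ᵥ y) := by
    refine ⟨(∑ i, ∑ j, |Z i j|) + 1, by positivity, fun y => ?_⟩
    have hyy : 0 ≤ y ⬝ᵥ y := by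
      simp only [dotProduct]; exact Finset.sum_nonneg fun i _ => mul_self_nonneg _
    have hy2 : ∀ i, y i * y i ≤ y ⬝ᵥ y := by
      intro i
      simp only [dotProduct]
      exact Finset.single_le_sum (f := fun i => y i * y i) (fun i _ => mul_self_nonneg _)
        (Finset.mem_univ i)
    have : |y ⬝ᵥ Z *ᵥ y| ≤ (∑ i, ∑ j, |Z i j|) * (y ⬝ᵥ y) := by
      have e : y ⬝ᵥ Z *ᵥ y = ∑ i, ∑ j, Z i j * (y i * y j) := by
        simp only [dotProduct, mulVec, Finset.mul_sum]
        exact Finset.sum_congr rfl fun i _ => Finset.sum_congr rfl fun j _ => by ring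
      rw [e, Finset.sum_mul]
      refine (Finset.abs_sum_le_sum_abs _ _).trans (Finset.sum_le_sum fun i _ => ?_)
      rw [Finset.sum_mul]
      refine (Finset.abs_sum_le_sum_abs _ _).trans (Finset.sum_le_sum fun j _ => ?_)
      rw [abs_mul]
      refine mul_le_mul_of_nonneg_left ?_ (abs_nonneg _)
      rw [abs_le]
      constructor <;> nlinarith [hy2 i, hy2 j, sq_nonneg (y i - y j), sq_nonneg (y i + y j)]
    linarith
  have hMs : Mᵀ = M := by simpa [conjTranspose_eq_transpose_of_trivial] using hM.1.eq
  have key : ∀ x, |x ⬝ᵥ D *ᵥ x| ≤ C * (x ⬝ᵥ M *ᵥ x) := by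
    intro x; rw [hDq, hquad]; exact hC _
  refine ⟨C⁻¹, by positivity, ?_, ?_⟩
  · refine PosSemidef.of_dotProduct_mulVec_nonneg ?_ fun x => ?_
    · simp [IsHermitian, conjTranspose_eq_transpose_of_trivial, hMs, hD]
    · have h := (abs_le.1 (key x)).1
      simp only [star_trivial, add_mulVec, smul_mulVec, dotProduct_add, dotProduct_smul, smul_eq_mul]
      have h2 := mul_le_mul_of_nonneg_left h (inv_nonneg.2 hC0.le)
      have h3 : C⁻¹ * -(C * (x ⬝ᵥ M *ᵥ x)) = -(x ⬝ᵥ M *ᵥ x) := by field_simp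
      linarith
  · refine PosSemidef.of_dotProduct_mulVec_nonneg ?_ fun x => ?_
    · simp [IsHermitian, conjTranspose_eq_transpose_of_trivial, hMs, hD]
    · have h := (abs_le.1 (key x)).2
      simp only [star_trivial, sub_mulVec, smul_mulVec, dotProduct_sub, dotProduct_smul, smul_eq_mul]
      have h2 := mul_le_mul_of_nonneg_left h (inv_nonneg.2 hC0.le)
      have h3 : C⁻¹ * (C * (x ⬝ᵥ M *ᵥ x)) = (x ⬝ᵥ M *ᵥ x) := by field_simp
      linarith

/-- Symmetric product of two vectors, as a vector dual to the monomial basis. -/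
noncomputable def sp (u v : Fin 3 → ℝ) : Fin 6 → ℝ :=
  ![u 0 * v 0, u 1 * v 1, u 2 * v 2, (u 0 * v 1 + u 1 * v 0) / 2,
    (u 0 * v 2 + u 2 * v 0) / 2, (u 1 * v 2 + u 2 * v 1) / 2]

/-- The parametrisation of all symmetric matrices representing the zero quartic. -/
def DS (S : Matrix (Fin 3) (Fin 3) ℝ) : Matrix (Fin 6) (Fin 6) ℝ :=
  !![0, S 2 2, S 1 1, 0, 0, -2 * S 1 2;
     S 2 2, 0, S 0 0, 0, -2 * S 0 2, 0;
     S 1 1, S 0 0, 0, -2 * S 0 1, 0, 0;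
     0, 0, -2 * S 0 1, -2 * S 2 2, 2 * S 1 2, 2 * S 0 2;
     0, -2 * S 0 2, 0, 2 * S 1 2, -2 * S 1 1, 2 * S 0 1;
     -2 * S 1 2, 0, 0, 2 * S 0 2, 2 * S 0 1, -2 * S 0 0]

lemma eval_gramBasis (a : Fin 3 → ℝ) (i : Fin 6) : eval a (gramBasis i) = sp a a i := by
  fin_cases i <;> simp [gramBasis, sp] <;> ring

lemma gram_eval {f : MvPolynomial (Fin 3) ℝ} {G : Matrix (Fin 6) (Fin 6) ℝ}
    (hG : G ∈ GramSpectrahedron f) (a : Fin 3 → ℝ) :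
    sp a a ⬝ᵥ G *ᵥ sp a a = eval a f := by
  rw [← hG.2]
  simp only [map_sum, map_mul, eval_C, eval_gramBasis, dotProduct, mulVec, Finset.mul_sum]
  exact Finset.sum_congr rfl fun i _ => Finset.sum_congr rfl fun j _ => by ring

lemma gram_of_eval {f : MvPolynomial (Fin 3) ℝ} {G : Matrix (Fin 6) (Fin 6) ℝ}
    (hG : G.PosSemidef) (h : ∀ a, sp a a ⬝ᵥ G *ᵥ sp a a = eval a f) :
    G ∈ GramSpectrahedron f := by
  refine ⟨hG, MvPolynomial.funext fun a => ?_⟩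
  rw [← h]
  simp only [map_sum, map_mul, eval_C, eval_gramBasis, dotProduct, mulVec, Finset.mul_sum]
  exact Finset.sum_congr rfl fun i _ => Finset.sum_congr rfl fun j _ => by ring

lemma psd_symm {M : Matrix (Fin 6) (Fin 6) ℝ} (hM : M.PosSemidef) : Mᵀ = M := by
  simpa [conjTranspose_eq_transpose_of_trivial] using hM.1.eq

/-- The complex vector of monomials. -/
noncomputable def mC (a : Fin 3 → ℂ) : Fin 6 → ℂ :=
  fun i => eval a (map (algebraMap ℝ ℂ) (gramBasis i))

lemma smooth_kernel {f : MvPolynomial (Fin 3) ℝ} (hsm : IsSmooth f)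
    {G : Matrix (Fin 6) (Fin 6) ℝ} (hG : G ∈ GramSpectrahedron f) (a : Fin 3 → ℂ)
    (h : ∀ i, ∑ j, (G i j : ℂ) * mC a j = 0) : a = 0 := by
  refine hsm a fun k => ?_
  rw [← hG.2]
  simp only [map_sum, map_mul, map_C, Derivation.leibniz, pderiv_C,
    smul_eq_mul, eval_C, map_add]
  have hs : ∀ i j, G i j = G j i := fun i j => by
    conv_lhs => rw [← psd_symm hG.1]
    rfl
  set d : Fin 6 → ℂ := fun i => eval a (pderiv k (map (algebraMap ℝ ℂ) (gramBasis i))) with hd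
  have e : ∀ i j, (algebraMap ℝ ℂ) (G i j) *
      (eval a (map (algebraMap ℝ ℂ) (gramBasis i)) * eval a (pderiv k (map (algebraMap ℝ ℂ) (gramBasis j)))
        + eval a (map (algebraMap ℝ ℂ) (gramBasis j)) * eval a (pderiv k (map (algebraMap ℝ ℂ) (gramBasis i))))
      = d j * ((G j i : ℂ) * mC a i) + d i * ((G i j : ℂ) * mC a j) := by
    intro i j
    rw [hs j i]
    simp only [hd, mC, Complex.coe_algebraMap]
    ring
  simp only [e, Finset.sum_add_distrib]
  rw [Finset.sum_comm]
  simp only [← Finset.mul_sum, h, map_zero, mul_zero, Finset.sum_const_zero, add_zero]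

/-- A pencil of kernel elements produces a (complex) singular point. -/
lemma smooth_pencil {f : MvPolynomial (Fin 3) ℝ} (hsm : IsSmooth f)
    {G : Matrix (Fin 6) (Fin 6) ℝ} (hG : G ∈ GramSpectrahedron f) (u v : Fin 3 → ℝ) (σ τ : ℝ)
    (h1 : G *ᵥ (σ • sp u u + τ • sp v v) = 0) (h2 : G *ᵥ sp u v = 0) :
    ∃ α β : ℂ, α ^ 2 = σ ∧ β ^ 2 = τ ∧ ∀ i, α * u i + β * v i = 0 := by
  obtain ⟨α, hα⟩ := IsAlgClosed.exists_pow_nat_eq (σ : ℂ) (n := 2) (by norm_num)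
  obtain ⟨β, hβ⟩ := IsAlgClosed.exists_pow_nat_eq (τ : ℂ) (n := 2) (by norm_num)
  refine ⟨α, β, hα, hβ, ?_⟩
  have hm : ∀ j, mC (fun i => α * u i + β * v i) j
      = ((σ • sp u u + τ • sp v v) j : ℝ) + 2 * α * β * (sp u v j : ℝ) := by
    intro j
    fin_cases j <;> simp [mC, gramBasis, sp, ← hα, ← hβ] <;> ring
  have := smooth_kernel hsm hG (fun i => α * u i + β * v i) ?_
  · intro i; exact congrFun this i
  · intro i
    simp only [hm, mul_add, Finset.sum_add_distrib]
    have e1 : ∑ j, (G i j : ℂ) * ((σ • sp u u + τ • sp v v) j : ℝ) = 0 := by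
      have := congrFun h1 i
      simp only [mulVec, dotProduct] at this
      exact_mod_cast congrArg (fun x : ℝ => (x : ℂ)) this
    have e2 : ∑ j, (G i j : ℂ) * (sp u v j : ℝ) = 0 := by
      have := congrFun h2 i
      simp only [mulVec, dotProduct] at this
      exact_mod_cast congrArg (fun x : ℝ => (x : ℂ)) this
    rw [e1, zero_add]
    have : ∀ j, (G i j : ℂ) * (2 * α * β * (sp u v j : ℝ)) = (2 * α * β) * ((G i j : ℂ) * (sp u v j : ℝ)) :=
      fun j => by ring
    simp only [this, ← Finset.mul_sum, e2, mul_zero]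

lemma smooth_point {f : MvPolynomial (Fin 3) ℝ} (hsm : IsSmooth f)
    {G : Matrix (Fin 6) (Fin 6) ℝ} (hG : G ∈ GramSpectrahedron f) (u : Fin 3 → ℝ)
    (h1 : G *ᵥ sp u u = 0) : u = 0 := by
  have h0 : sp u 0 = 0 := by
    funext j; fin_cases j <;> simp [sp]
  obtain ⟨α, β, hα, hβ, h⟩ := smooth_pencil hsm hG u 0 1 0 (by simpa using h1) (by simp [h0])
  funext i
  have := h i
  simp only [Pi.zero_apply, Complex.ofReal_zero, mul_zero, add_zero, mul_eq_zero] at this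
  rcases this with h | h
  · simp [h] at hα
  · exact_mod_cast h

lemma DS_symm (S : Matrix (Fin 3) (Fin 3) ℝ) : (DS S)ᵀ = DS S := by
  ext i j; fin_cases i <;> fin_cases j <;> rfl

lemma DS_smul (c : ℝ) (S : Matrix (Fin 3) (Fin 3) ℝ) : DS (c • S) = c • DS S := by
  ext i j; fin_cases i <;> fin_cases j <;> simp [DS] <;> ring

lemma DS_inj {S T : Matrix (Fin 3) (Fin 3) ℝ} (hS : Sᵀ = S) (hT : Tᵀ = T) (h : DS S = DS T) :
    S = T := by
  have e : ∀ i j, S i j = S j i := fun i j => congrFun (congrFun hS j) i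
  have e' : ∀ i j, T i j = T j i := fun i j => congrFun (congrFun hT j) i
  have h0 := congrFun (congrFun h 0) 1
  have h1 := congrFun (congrFun h 0) 2
  have h2 := congrFun (congrFun h 1) 2
  have h3 := congrFun (congrFun h 3) 4
  have h4 := congrFun (congrFun h 3) 5
  have h5 := congrFun (congrFun h 4) 5
  simp [DS] at h0 h1 h2 h3 h4 h5
  have a1 := e 1 0
  have a2 := e 2 0
  have a3 := e 2 1
  have b1 := e' 1 0
  have b2 := e' 2 0
  have b3 := e' 2 1
  ext i j
  fin_cases i <;> fin_cases j <;> simp <;> linarith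

lemma DS_zero_form (S : Matrix (Fin 3) (Fin 3) ℝ) (a : Fin 3 → ℝ) :
    sp a a ⬝ᵥ DS S *ᵥ sp a a = 0 := by
  simp [dotProduct, mulVec, Fin.sum_univ_succ, DS, sp]
  ring

lemma exists_DS (D : Matrix (Fin 6) (Fin 6) ℝ) (hD : Dᵀ = D)
    (h : ∀ a, sp a a ⬝ᵥ D *ᵥ sp a a = 0) : ∃ S : Matrix (Fin 3) (Fin 3) ℝ, Sᵀ = S ∧ D = DS S := by
  have e : ∀ i j, D i j = D j i := fun i j => congrFun (congrFun hD j) i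
  refine ⟨!![D 1 2, D 4 5 / 2, D 3 5 / 2; D 4 5 / 2, D 0 2, D 3 4 / 2; D 3 5 / 2, D 3 4 / 2, D 0 1],
    ?_, ?_⟩
  · ext i j; fin_cases i <;> fin_cases j <;> rfl
  have E : ∀ x y z : ℝ, D 0 0 * x ^ 4 + D 1 1 * y ^ 4 + D 2 2 * z ^ 4
      + 2 * D 0 3 * x ^ 3 * y + 2 * D 0 4 * x ^ 3 * z + 2 * D 1 3 * y ^ 3 * x
      + 2 * D 1 5 * y ^ 3 * z + 2 * D 2 4 * z ^ 3 * x + 2 * D 2 5 * z ^ 3 * y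
      + (2 * D 0 1 + D 3 3) * x ^ 2 * y ^ 2 + (2 * D 0 2 + D 4 4) * x ^ 2 * z ^ 2
      + (2 * D 1 2 + D 5 5) * y ^ 2 * z ^ 2 + (2 * D 0 5 + 2 * D 3 4) * x ^ 2 * y * z
      + (2 * D 1 4 + 2 * D 3 5) * x * y ^ 2 * z + (2 * D 2 3 + 2 * D 4 5) * x * y * z ^ 2 = 0 := by
    intro x y z
    have := h ![x, y, z]
    simp [dotProduct, mulVec, Fin.sum_univ_succ, sp] at this
    have s1 := e 1 0
    have s2 := e 2 0
    have s3 := e 3 0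
    have s4 := e 4 0
    have s5 := e 5 0
    have s6 := e 2 1
    have s7 := e 3 1
    have s8 := e 4 1
    have s9 := e 5 1
    have s10 := e 3 2
    have s11 := e 4 2
    have s12 := e 5 2
    have s13 := e 4 3
    have s14 := e 5 3
    have s15 := e 5 4
    simp only [s1, s2, s3, s4, s5, s6, s7, s8, s9, s10, s11, s12, s13, s14, s15] at this
    linear_combination this
  have x1 := E 1 0 0
  have x2 := E 0 1 0
  have x3 := E 0 0 1
  have x4 := E 1 1 0
  have x5 := E 1 (-1) 0
  have x6 := E 1 2 0
  have x7 := E 1 0 1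
  have x8 := E 1 0 (-1)
  have x9 := E 1 0 2
  have y1 := E 0 1 1
  have y2 := E 0 1 (-1)
  have y3 := E 0 1 2
  have y4 := E 1 1 1
  have y5 := E 1 1 (-1)
  have y6 := E 1 (-1) 1
  have y7 := E (-1) 1 1
  norm_num at x1 x2 x3 x4 x5 x6 x7 x8 x9 y1 y2 y3 y4 y5 y6 y7
  ext i j
  fin_cases i <;> fin_cases j <;> simp [DS] <;>
    first
      | linarith
      | (rw [e]; done)
      | (rw [e]; linarith)

/-- The symmetric `3×3` matrix attached to a vector. -/
def Wm (w : Fin 6 → ℝ) : Matrix (Fin 3) (Fin 3) ℝ :=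
  !![w 0, w 3, w 4; w 3, w 1, w 5; w 4, w 5, w 2]

/-- The vector attached to a symmetric `3×3` matrix. -/
def Vc (X : Matrix (Fin 3) (Fin 3) ℝ) : Fin 6 → ℝ :=
  ![X 0 0, X 1 1, X 2 2, X 0 1, X 0 2, X 1 2]

lemma Vc_Wm (w : Fin 6 → ℝ) : Vc (Wm w) = w := by
  funext i; fin_cases i <;> rfl

lemma Wm_Vc (X : Matrix (Fin 3) (Fin 3) ℝ) (hX : Xᵀ = X) : Wm (Vc X) = X := by
  have e : ∀ i j, X i j = X j i := fun i j => congrFun (congrFun hX j) i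
  ext i j; fin_cases i <;> fin_cases j <;> simp [Wm, Vc] <;> exact e _ _

lemma Wm_symm (w : Fin 6 → ℝ) : (Wm w)ᵀ = Wm w := by
  ext i j; fin_cases i <;> fin_cases j <;> rfl

/-- The action of a `3×3` matrix on the vectors of length six. -/
def EA (A : Matrix (Fin 3) (Fin 3) ℝ) : (Fin 6 → ℝ) →ₗ[ℝ] (Fin 6 → ℝ) where
  toFun w := Vc (A * Wm w * Aᵀ)
  map_add' x y := by
    have : Wm (x + y) = Wm x + Wm y := by
      ext i j; fin_cases i <;> fin_cases j <;> rfl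
    rw [this, Matrix.mul_add, Matrix.add_mul]
    funext i; fin_cases i <;> rfl
  map_smul' c x := by
    have : Wm (c • x) = c • Wm x := by
      ext i j; fin_cases i <;> fin_cases j <;> rfl
    rw [this, Matrix.mul_smul, Matrix.smul_mul]
    funext i; fin_cases i <;> rfl

lemma EA_apply (A : Matrix (Fin 3) (Fin 3) ℝ) (w : Fin 6 → ℝ) : EA A w = Vc (A * Wm w * Aᵀ) := rfl

lemma Wm_EA (A : Matrix (Fin 3) (Fin 3) ℝ) (w : Fin 6 → ℝ) : Wm (EA A w) = A * Wm w * Aᵀ := by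
  rw [EA_apply, Wm_Vc]
  simp [Wm_symm, Matrix.mul_assoc]

lemma EA_EA (A B : Matrix (Fin 3) (Fin 3) ℝ) (h : A * B = 1) (w : Fin 6 → ℝ) :
    EA A (EA B w) = w := by
  have h' : Bᵀ * Aᵀ = 1 := by rw [← transpose_mul, h, transpose_one]
  rw [EA_apply, Wm_EA]
  have : A * (B * Wm w * Bᵀ) * Aᵀ = (A * B) * Wm w * (Bᵀ * Aᵀ) := by
    simp only [Matrix.mul_assoc]
  rw [this, h, h', Matrix.one_mul, Matrix.mul_one, Vc_Wm]

lemma EA_sp (A : Matrix (Fin 3) (Fin 3) ℝ) (u v : Fin 3 → ℝ) :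
    EA A (sp u v) = sp (A *ᵥ u) (A *ᵥ v) := by
  funext i
  fin_cases i <;>
    simp [EA_apply, Vc, Wm, sp, Matrix.mul_apply, mulVec, dotProduct, Fin.sum_univ_succ] <;> ring

lemma DS_trace (S : Matrix (Fin 3) (Fin 3) ℝ) (hS : Sᵀ = S) (w : Fin 6 → ℝ) :
    w ⬝ᵥ DS S *ᵥ w = 2 * trace (S * adjugate (Wm w)) := by
  have e : ∀ i j, S i j = S j i := fun i j => congrFun (congrFun hS j) i
  have a1 := e 1 0
  have a2 := e 2 0
  have a3 := e 2 1
  simp [dotProduct, mulVec, Fin.sum_univ_succ, DS, trace, Matrix.mul_apply, adjugate_fin_three, Wm,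
    a1, a2, a3]
  ring

lemma DS_bil_symm (S : Matrix (Fin 3) (Fin 3) ℝ) (x y : Fin 6 → ℝ) :
    x ⬝ᵥ DS S *ᵥ y = y ⬝ᵥ DS S *ᵥ x := by
  rw [dotProduct_mulVec, dotProduct_comm, ← mulVec_transpose, DS_symm]

lemma DS_transform (S A : Matrix (Fin 3) (Fin 3) ℝ) (hS : Sᵀ = S) (hA : Aᵀ * A = 1)
    (x y : Fin 6 → ℝ) :
    EA A x ⬝ᵥ DS (A * S * Aᵀ) *ᵥ EA A y = x ⬝ᵥ DS S *ᵥ y := by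
  have hA' : A * Aᵀ = 1 := mul_eq_one_comm.1 hA
  have hdet : A.det * A.det = 1 := by
    have := congrArg det hA
    rwa [det_mul, det_transpose, det_one] at this
  have hadj : adjugate A = A.det • Aᵀ := by
    have : adjugate A = (Aᵀ * A) * adjugate A := by rw [hA, Matrix.one_mul]
    rw [this, Matrix.mul_assoc, mul_adjugate, Matrix.mul_smul, Matrix.mul_one]
  have hSA : (A * S * Aᵀ)ᵀ = A * S * Aᵀ := by simp [hS, Matrix.mul_assoc]
  have q : ∀ x, EA A x ⬝ᵥ DS (A * S * Aᵀ) *ᵥ EA A x = x ⬝ᵥ DS S *ᵥ x := by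
    intro x
    rw [DS_trace _ hSA, DS_trace _ hS, Wm_EA, adjugate_mul_distrib, adjugate_mul_distrib,
      ← adjugate_transpose, hadj, transpose_smul, transpose_transpose]
    congr 1
    have : A * S * Aᵀ * (A.det • A * ((Wm x).adjugate * A.det • Aᵀ))
        = A.det • A.det • (A * (S * (Aᵀ * A) * (Wm x).adjugate) * Aᵀ) := by
      simp only [Matrix.mul_assoc, Matrix.mul_smul, Matrix.smul_mul]
    rw [this, hA, Matrix.mul_one, smul_smul, hdet, one_smul, trace_mul_comm, ← Matrix.mul_assoc, hA,
      Matrix.one_mul]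
  have h1 := q (x + y)
  have h2 := q x
  have h3 := q y
  have s1 := DS_bil_symm S x y
  have s2 := DS_bil_symm (A * S * Aᵀ) (EA A x) (EA A y)
  simp only [map_add, mulVec_add, dotProduct_add, add_dotProduct] at h1
  linarith

lemma DS_eqs (S : Matrix (Fin 3) (Fin 3) ℝ) (x : Fin 6 → ℝ) :
    DS S *ᵥ x = 0 ↔
      (S 2 2 * x 1 + S 1 1 * x 2 - 2 * S 1 2 * x 5 = 0 ∧
       S 2 2 * x 0 + S 0 0 * x 2 - 2 * S 0 2 * x 4 = 0 ∧
       S 1 1 * x 0 + S 0 0 * x 1 - 2 * S 0 1 * x 3 = 0 ∧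
       - S 0 1 * x 2 - S 2 2 * x 3 + S 1 2 * x 4 + S 0 2 * x 5 = 0 ∧
       - S 0 2 * x 1 + S 1 2 * x 3 - S 1 1 * x 4 + S 0 1 * x 5 = 0 ∧
       - S 1 2 * x 0 + S 0 2 * x 3 + S 0 1 * x 4 - S 0 0 * x 5 = 0) := by
  constructor
  · intro h
    have h0 := congrFun h 0
    have h1 := congrFun h 1
    have h2 := congrFun h 2
    have h3 := congrFun h 3
    have h4 := congrFun h 4
    have h5 := congrFun h 5
    simp [DS, mulVec, dotProduct, Fin.sum_univ_succ] at h0 h1 h2 h3 h4 h5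
    refine ⟨?_, ?_, ?_, ?_, ?_, ?_⟩ <;> linarith
  · rintro ⟨h0, h1, h2, h3, h4, h5⟩
    funext i
    fin_cases i <;> simp [DS, mulVec, dotProduct, Fin.sum_univ_succ] <;> linarith

lemma vec6_eq (x : Fin 6 → ℝ) : x = ![x 0, x 1, x 2, x 3, x 4, x 5] := by
  funext i; fin_cases i <;> rfl

lemma core_bot (K : Submodule ℝ (Fin 6 → ℝ)) (S : Matrix (Fin 3) (Fin 3) ℝ)
    (HT : ∀ T : Matrix (Fin 3) (Fin 3) ℝ, Tᵀ = T → (∀ x ∈ K, DS T *ᵥ x = 0) → ∃ c : ℝ, T = c • S)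
    (hK : ∀ x ∈ K, x = 0) : False := by
  obtain ⟨c, hc⟩ := HT (diagonal ![1, 0, 0]) (by simp) (fun x hx => by rw [hK x hx, mulVec_zero])
  obtain ⟨d, hd⟩ := HT (diagonal ![0, 1, 0]) (by simp) (fun x hx => by rw [hK x hx, mulVec_zero])
  have c0 := congrFun (congrFun hc 0) 0
  have c1 := congrFun (congrFun hc 1) 1
  have d0 := congrFun (congrFun hd 0) 0
  have d1 := congrFun (congrFun hd 1) 1
  simp at c0 c1 d0 d1
  rcases c1 with h | h
  · simp [h] at c0
  · simp [h] at d1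

lemma core_allne (K : Submodule ℝ (Fin 6 → ℝ)) (ν : Fin 3 → ℝ)
    (HK : ∀ x ∈ K, DS (diagonal ν) *ᵥ x = 0)
    (HT : ∀ T : Matrix (Fin 3) (Fin 3) ℝ, Tᵀ = T → (∀ x ∈ K, DS T *ᵥ x = 0) →
      ∃ c : ℝ, T = c • diagonal ν)
    (h0 : ν 0 ≠ 0) (h1 : ν 1 ≠ 0) (h2 : ν 2 ≠ 0) : False := by
  refine core_bot K _ HT fun x hx => ?_
  have e := HK x hx
  rw [DS_eqs] at e
  simp at e
  obtain ⟨e0, e1, e2, e3, e4, e5⟩ := e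
  have x5 : x 5 = 0 := by tauto
  have x4 : x 4 = 0 := by tauto
  have x3 : x 3 = 0 := by tauto
  have x0 : x 0 = 0 := by
    have : ν 1 * ν 2 * x 0 = 0 := by linear_combination (ν 1 / 2) * e1 + (ν 2 / 2) * e2 - (ν 0 / 2) * e0
    simpa [h1, h2] using this
  rw [x0] at e1 e2
  have x2 : x 2 = 0 := by simpa [h0] using e1
  have x1 : x 1 = 0 := by simpa [h0] using e2
  rw [vec6_eq x, x0, x1, x2, x3, x4, x5]
  funext i; fin_cases i <;> rfl

lemma core_twone (K : Submodule ℝ (Fin 6 → ℝ)) (ν : Fin 3 → ℝ)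
    (HK : ∀ x ∈ K, DS (diagonal ν) *ᵥ x = 0)
    (HT : ∀ T : Matrix (Fin 3) (Fin 3) ℝ, Tᵀ = T → (∀ x ∈ K, DS T *ᵥ x = 0) →
      ∃ c : ℝ, T = c • diagonal ν)
    (HS : ∀ σ τ : ℝ, σ ≠ 0 → ![σ, τ, 0, 0, 0, 0] ∈ K → ![0, 0, 0, 1, 0, 0] ∈ K → False)
    (h0 : ν 0 ≠ 0) (h1 : ν 1 ≠ 0) (h2 : ν 2 = 0) : False := by
  let φ : (ℝ × ℝ) →ₗ[ℝ] (Fin 6 → ℝ) :=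
    { toFun := fun p => ![p.1 * ν 0, - p.1 * ν 1, 0, p.2, 0, 0]
      map_add' := fun p q => by funext i; fin_cases i <;> simp <;> ring
      map_smul' := fun c p => by funext i; fin_cases i <;> simp <;> ring }
  have hφ : ∀ p, φ p = ![p.1 * ν 0, - p.1 * ν 1, 0, p.2, 0, 0] := fun _ => rfl
  have hrep : ∀ x ∈ K, x = φ (x 0 / ν 0, x 3) := by
    intro x hx
    have e := HK x hx
    rw [DS_eqs] at e
    simp [h2, h0, h1] at e
    obtain ⟨e0, e2, e4, e5⟩ := e
    rw [hφ]
    funext i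
    fin_cases i <;> simp [*]
    field_simp
    linarith
  by_cases htop : K.comap φ = ⊤
  · refine HS (ν 0) (-ν 1) h0 ?_ ?_
    · have : ((1 : ℝ), (0 : ℝ)) ∈ K.comap φ := by rw [htop]; trivial
      simpa [hφ] using this
    · have : ((0 : ℝ), (1 : ℝ)) ∈ K.comap φ := by rw [htop]; trivial
      simpa [hφ] using this
  · obtain ⟨g, hg0, hg⟩ := Submodule.exists_le_ker_of_lt_top _ (lt_top_iff_ne_top.2 htop)
    have hgl : ∀ p : ℝ × ℝ, g p = p.1 * g (1, 0) + p.2 * g (0, 1) := by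
      intro p
      have : p = p.1 • ((1 : ℝ), (0 : ℝ)) + p.2 • ((0 : ℝ), (1 : ℝ)) := by ext <;> simp
      conv_lhs => rw [this]
      rw [map_add, map_smul, map_smul, smul_eq_mul, smul_eq_mul]
    obtain ⟨c, hc⟩ := HT !![0, - g (0, 1) / 2, 0; - g (0, 1) / 2, g (1, 0) / ν 0, 0; 0, 0, 0]
      (by ext i j; fin_cases i <;> fin_cases j <;> rfl) (fun x hx => by
        have e := HK x hx
        rw [DS_eqs] at e
        simp [h2, h0, h1] at e
        obtain ⟨e0, e2, e4, e5⟩ := e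
        have hm : (x 0 / ν 0, x 3) ∈ K.comap φ := by
          rw [Submodule.mem_comap, ← hrep x hx]; exact hx
        have hz : g (x 0 / ν 0, x 3) = 0 := hg hm
        rw [hgl] at hz
        rw [DS_eqs]
        simp [e0, e4, e5]
        linear_combination hz)
    have c0 := congrFun (congrFun hc 0) 0
    have c1 := congrFun (congrFun hc 0) 1
    have c2 := congrFun (congrFun hc 1) 1
    simp [h0] at c0 c1 c2
    simp [c0, h0] at c2
    apply hg0
    ext <;> simp [c1, c2]

lemma core_one (K : Submodule ℝ (Fin 6 → ℝ)) (ν : Fin 3 → ℝ)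
    (HK : ∀ x ∈ K, DS (diagonal ν) *ᵥ x = 0)
    (HT : ∀ T : Matrix (Fin 3) (Fin 3) ℝ, Tᵀ = T → (∀ x ∈ K, DS T *ᵥ x = 0) →
      ∃ c : ℝ, T = c • diagonal ν)
    (HS : ![0, 0, 1, 0, 0, 0] ∉ K)
    (h0 : ν 0 = 0) (h1 : ν 1 = 0) (h2 : ν 2 ≠ 0) :
    ∃ α β : ℝ, ∀ x, x ∈ K ↔ x = ![0, 0, α * x 4 + β * x 5, 0, x 4, x 5] := by
  have hK : ∀ x ∈ K, x 0 = 0 ∧ x 1 = 0 ∧ x 3 = 0 := by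
    intro x hx
    have e := HK x hx
    rw [DS_eqs] at e
    simp [h2, h0, h1] at e
    tauto
  have hK2 : ∀ x ∈ K, x 4 = 0 → x 5 = 0 → x = 0 := by
    intro x hx h4 h5
    obtain ⟨a, b, c⟩ := hK x hx
    by_cases hx2 : x 2 = 0
    · funext i; fin_cases i <;> simp [*]
    · exfalso
      apply HS
      have := K.smul_mem (x 2)⁻¹ hx
      convert this using 1
      funext i; fin_cases i <;> simp [*]
  let φ : (Fin 6 → ℝ) →ₗ[ℝ] (ℝ × ℝ) := (LinearMap.proj 4).prod (LinearMap.proj 5)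
  have hφ : ∀ x, φ x = (x 4, x 5) := fun _ => rfl
  by_cases htop : K.map φ = ⊤
  · obtain ⟨y, hy, hy'⟩ : ((1 : ℝ), (0 : ℝ)) ∈ K.map φ := by rw [htop]; trivial
    obtain ⟨z, hz, hz'⟩ : ((0 : ℝ), (1 : ℝ)) ∈ K.map φ := by rw [htop]; trivial
    rw [hφ, Prod.mk.injEq] at hy' hz'
    obtain ⟨a, b, c⟩ := hK y hy
    obtain ⟨a', b', c'⟩ := hK z hz
    refine ⟨y 2, z 2, fun x => ⟨fun hx => ?_, fun hx => ?_⟩⟩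
    · have hm : x - x 4 • y - x 5 • z ∈ K :=
        K.sub_mem (K.sub_mem hx (K.smul_mem _ hy)) (K.smul_mem _ hz)
      have := hK2 _ hm (by simp [hy', hz']) (by simp [hy', hz'])
      have hx' : x = x 4 • y + x 5 • z := by
        rw [sub_sub, sub_eq_zero] at this; exact this
      obtain ⟨a1, b1, c1⟩ := hK x hx
      have h2' := congrFun hx' 2
      simp at h2'
      funext i; fin_cases i <;> simp [a1, b1, c1]
      linarith
    · have : x = x 4 • y + x 5 • z := by
        conv_lhs => rw [hx]
        funext i; fin_cases i <;> simp [a, b, c, a', b', c', hy'.1, hy'.2, hz'.1, hz'.2]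
        ring
      rw [this]
      exact K.add_mem (K.smul_mem _ hy) (K.smul_mem _ hz)
  · exfalso
    obtain ⟨g, hg0, hg⟩ := Submodule.exists_le_ker_of_lt_top _ (lt_top_iff_ne_top.2 htop)
    have hgl : ∀ p : ℝ × ℝ, g p = p.1 * g (1, 0) + p.2 * g (0, 1) := by
      intro p
      have : p = p.1 • ((1 : ℝ), (0 : ℝ)) + p.2 • ((0 : ℝ), (1 : ℝ)) := by ext <;> simp
      conv_lhs => rw [this]
      rw [map_add, map_smul, map_smul, smul_eq_mul, smul_eq_mul]
    have hgK : ∀ x ∈ K, x 4 * g (1, 0) + x 5 * g (0, 1) = 0 := by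
      intro x hx
      have : g (x 4, x 5) = 0 := hg ⟨x, hx, rfl⟩
      rwa [hgl] at this
    by_cases hbot : ∀ x ∈ K, x = 0
    · exact core_bot K _ HT hbot
    · push Not at hbot
      obtain ⟨y, hy, hy0⟩ := hbot
      obtain ⟨a, b, c⟩ := hK y hy
      have hy45 : ¬ (y 4 = 0 ∧ y 5 = 0) := fun h => hy0 (hK2 y hy h.1 h.2)
      have hpar : ∀ x ∈ K, x 4 * y 5 - x 5 * y 4 = 0 := by
        intro x hx
        have e1 := hgK x hx
        have e2 := hgK y hy
        have f1 : (x 4 * y 5 - x 5 * y 4) * g (1, 0) = 0 := by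
          linear_combination y 5 * e1 - x 5 * e2
        have f2 : (x 4 * y 5 - x 5 * y 4) * g (0, 1) = 0 := by
          linear_combination x 4 * e2 - y 4 * e1
        by_contra hne
        apply hg0
        have f1' : g (1, 0) = 0 := by simpa [hne] using f1
        have f2' : g (0, 1) = 0 := by simpa [hne] using f2
        ext <;> simp [f1', f2']
      have hspan : ∀ x ∈ K, ∃ k : ℝ, x = k • y := by
        intro x hx
        have hp := hpar x hx
        by_cases h4 : y 4 = 0
        · have h5 : y 5 ≠ 0 := fun h => hy45 ⟨h4, h⟩
          refine ⟨x 5 / y 5, ?_⟩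
          rw [← sub_eq_zero]
          refine hK2 _ (K.sub_mem hx (K.smul_mem _ hy)) ?_ ?_
          · simp [h4, h5] at hp; simp [h4, hp]
          · simp; field_simp; ring
        · refine ⟨x 4 / y 4, ?_⟩
          rw [← sub_eq_zero]
          refine hK2 _ (K.sub_mem hx (K.smul_mem _ hy)) ?_ ?_
          · simp; field_simp; ring
          · simp; field_simp; linarith
      obtain ⟨d, hd⟩ := HT !![y 4 * y 4, y 4 * y 5, y 4 * (y 2 / 2); y 4 * y 5, y 5 * y 5, y 5 * (y 2 / 2);
        y 4 * (y 2 / 2), y 5 * (y 2 / 2), 0]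
        (by ext i j; fin_cases i <;> fin_cases j <;> rfl) (fun x hx => by
          obtain ⟨k, rfl⟩ := hspan x hx
          rw [mulVec_smul]
          rw [(DS_eqs _ y).2, smul_zero]
          simp [a, b, c]
          refine ⟨?_, ?_, ?_, ?_, ?_⟩ <;> ring)
      have d0 := congrFun (congrFun hd 0) 0
      have d1 := congrFun (congrFun hd 1) 1
      simp [h0, h1] at d0 d1
      exact hy45 ⟨d0, d1⟩

lemma sym_diag (S : Matrix (Fin 3) (Fin 3) ℝ) (hS : Sᵀ = S) (h0 : S ≠ 0) :
    ∃ (A : Matrix (Fin 3) (Fin 3) ℝ) (ν : Fin 3 → ℝ), Aᵀ * A = 1 ∧ S = A * diagonal ν * Aᵀ ∧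
      ((ν 0 ≠ 0 ∧ ν 1 ≠ 0 ∧ ν 2 ≠ 0) ∨ (ν 0 ≠ 0 ∧ ν 1 ≠ 0 ∧ ν 2 = 0) ∨
        (ν 0 = 0 ∧ ν 1 = 0 ∧ ν 2 ≠ 0)) := by
  have hH : S.IsHermitian := by simpa [IsHermitian, conjTranspose_eq_transpose_of_trivial] using hS
  obtain ⟨A, ν, hA, hSA⟩ : ∃ (A : Matrix (Fin 3) (Fin 3) ℝ) (ν : Fin 3 → ℝ),
      Aᵀ * A = 1 ∧ S = A * diagonal ν * Aᵀ := by
    have hs := hH.spectral_theorem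
    rw [Unitary.conjStarAlgAut_apply] at hs
    refine ⟨(hH.eigenvectorUnitary).val, hH.eigenvalues, ?_, ?_⟩
    · have := Unitary.star_mul_self_of_mem (hH.eigenvectorUnitary).2
      simpa [star_eq_conjTranspose, conjTranspose_eq_transpose_of_trivial] using this
    · conv_lhs => rw [hs]
      simp [star_eq_conjTranspose, conjTranspose_eq_transpose_of_trivial]
  have hperm : ∀ π : Equiv.Perm (Fin 3), (A.submatrix id π)ᵀ * A.submatrix id π = 1 ∧
      S = A.submatrix id π * diagonal (ν ∘ π) * (A.submatrix id π)ᵀ := by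
    intro π
    constructor
    · have h := submatrix_mul_equiv Aᵀ A π (Equiv.refl (Fin 3)) π
      rw [hA, submatrix_one_equiv] at h
      exact h
    · have : diagonal (ν ∘ π) = (diagonal ν).submatrix π π := by
        rw [submatrix_diagonal_equiv]
      rw [this, transpose_submatrix, submatrix_mul_equiv, submatrix_mul_equiv, ← hSA]
      rfl
  have hne : ¬ (ν 0 = 0 ∧ ν 1 = 0 ∧ ν 2 = 0) := by
    rintro ⟨a, b, c⟩
    apply h0
    have : ν = 0 := by funext i; fin_cases i <;> assumption
    rw [hSA, this]
    simp
  have fin : ∀ π : Equiv.Perm (Fin 3), ((ν (π 0) ≠ 0 ∧ ν (π 1) ≠ 0 ∧ ν (π 2) ≠ 0) ∨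
      (ν (π 0) ≠ 0 ∧ ν (π 1) ≠ 0 ∧ ν (π 2) = 0) ∨
        (ν (π 0) = 0 ∧ ν (π 1) = 0 ∧ ν (π 2) ≠ 0)) → ∃ (A : Matrix (Fin 3) (Fin 3) ℝ)
        (ν : Fin 3 → ℝ), Aᵀ * A = 1 ∧ S = A * diagonal ν * Aᵀ ∧
      ((ν 0 ≠ 0 ∧ ν 1 ≠ 0 ∧ ν 2 ≠ 0) ∨ (ν 0 ≠ 0 ∧ ν 1 ≠ 0 ∧ ν 2 = 0) ∨
        (ν 0 = 0 ∧ ν 1 = 0 ∧ ν 2 ≠ 0)) := fun π hπ =>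
    ⟨_, _, (hperm π).1, (hperm π).2, hπ⟩
  have s020 : (Equiv.swap (0 : Fin 3) 2) 0 = 2 := by decide
  have s021 : (Equiv.swap (0 : Fin 3) 2) 1 = 1 := by decide
  have s022 : (Equiv.swap (0 : Fin 3) 2) 2 = 0 := by decide
  have s120 : (Equiv.swap (1 : Fin 3) 2) 0 = 0 := by decide
  have s121 : (Equiv.swap (1 : Fin 3) 2) 1 = 2 := by decide
  have s122 : (Equiv.swap (1 : Fin 3) 2) 2 = 1 := by decide
  have f1 := fin 1
  have f2 := fin (Equiv.swap 0 2)
  have f3 := fin (Equiv.swap 1 2)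
  rw [s020, s021, s022] at f2
  rw [s120, s121, s122] at f3
  simp only [Equiv.Perm.coe_one, id] at f1
  by_cases a : ν 0 = 0
  · by_cases b : ν 1 = 0
    · exact f1 (Or.inr (Or.inr ⟨a, b, fun c => hne ⟨a, b, c⟩⟩))
    · by_cases c : ν 2 = 0
      · exact f3 (Or.inr (Or.inr ⟨a, c, b⟩))
      · exact f2 (Or.inr (Or.inl ⟨c, b, a⟩))
  · by_cases b : ν 1 = 0
    · by_cases c : ν 2 = 0
      · exact f2 (Or.inr (Or.inr ⟨c, b, a⟩))
      · exact f3 (Or.inr (Or.inl ⟨a, c, b⟩))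
    · by_cases c : ν 2 = 0
      · exact f1 (Or.inr (Or.inl ⟨a, b, c⟩))
      · exact f1 (Or.inl ⟨a, b, c⟩)

lemma eq_zero_of_dot (z : Fin 6 → ℝ) (h : ∀ y : Fin 6 → ℝ, y ⬝ᵥ z = 0) : z = 0 := by
  exact dotProduct_self_eq_zero.1 (h z)

lemma kernel_data {f : MvPolynomial (Fin 3) ℝ} (hsm : IsSmooth f)
    {M : Matrix (Fin 6) (Fin 6) ℝ} (hM : M ∈ GramSpectrahedron f)
    (S : Matrix (Fin 3) (Fin 3) ℝ) (hS : Sᵀ = S) (h0 : S ≠ 0)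
    (hk : ∀ w, M *ᵥ w = 0 → DS S *ᵥ w = 0)
    (hT : ∀ T : Matrix (Fin 3) (Fin 3) ℝ, Tᵀ = T → (∀ w, M *ᵥ w = 0 → DS T *ᵥ w = 0) →
      ∃ c : ℝ, T = c • S) :
    ∃ p l : Fin 3 → ℝ, l ⬝ᵥ p = 1 ∧ (∃ k : ℝ, k ≠ 0 ∧ S = k • vecMulVec p p) ∧
      ∀ w, M *ᵥ w = 0 ↔ ∃ v, l ⬝ᵥ v = 0 ∧ w = sp p v := by
  obtain ⟨A, ν, hA, hSA, hpat⟩ := sym_diag S hS h0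
  have hA' : A * Aᵀ = 1 := mul_eq_one_comm.1 hA
  let K : Submodule ℝ (Fin 6 → ℝ) := (LinearMap.ker M.mulVecLin).comap (EA A)
  have hKm : ∀ x, x ∈ K ↔ M *ᵥ (EA A x) = 0 := fun x => Iff.rfl
  have hAA : ∀ w, EA A (EA Aᵀ w) = w := EA_EA A Aᵀ hA'
  have hdot : ∀ u v, (A *ᵥ u) ⬝ᵥ (A *ᵥ v) = u ⬝ᵥ v := by
    intro u v
    rw [dotProduct_mulVec, ← mulVec_transpose, mulVec_mulVec, hA, one_mulVec]
  have hinj : ∀ u, A *ᵥ u = 0 → u = 0 := by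
    intro u hu
    have : Aᵀ *ᵥ (A *ᵥ u) = u := by rw [mulVec_mulVec, hA, one_mulVec]
    rw [← this, hu, mulVec_zero]
  have HK : ∀ x ∈ K, DS (diagonal ν) *ᵥ x = 0 := by
    intro x hx
    refine eq_zero_of_dot _ fun y => ?_
    rw [← DS_transform (diagonal ν) A (diagonal_transpose _) hA, ← hSA, hk _ ((hKm x).1 hx),
      dotProduct_zero]
  have HT : ∀ T : Matrix (Fin 3) (Fin 3) ℝ, Tᵀ = T → (∀ x ∈ K, DS T *ᵥ x = 0) →
      ∃ c : ℝ, T = c • diagonal ν := by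
    intro T hTs hTK
    obtain ⟨c, hc⟩ := hT (A * T * Aᵀ) (by simp [hTs, Matrix.mul_assoc]) (fun w hw => by
      refine eq_zero_of_dot _ fun y => ?_
      rw [← hAA y, ← hAA w, DS_transform T A hTs hA, hTK _ ?_, dotProduct_zero]
      rw [hKm, hAA]; exact hw)
    refine ⟨c, ?_⟩
    have e : ∀ X : Matrix (Fin 3) (Fin 3) ℝ, Aᵀ * (A * X * Aᵀ) * A = X := by
      intro X
      have : Aᵀ * (A * X * Aᵀ) * A = (Aᵀ * A) * X * (Aᵀ * A) := by simp only [Matrix.mul_assoc]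
      rw [this, hA, Matrix.one_mul, Matrix.mul_one]
    rw [← e T, hc, hSA, Matrix.mul_smul, Matrix.smul_mul, e]
  have HS1 : ![0, 0, 1, 0, 0, 0] ∉ K := by
    intro h
    have e : (![0, 0, 1, 0, 0, 0] : Fin 6 → ℝ) = sp ![0, 0, 1] ![0, 0, 1] := by
      funext i; fin_cases i <;> simp [sp]
    rw [e, hKm, EA_sp] at h
    have := congrFun (hinj _ (smooth_point hsm hM _ h)) 2
    simp at this
  have HS2 : ∀ σ τ : ℝ, σ ≠ 0 → ![σ, τ, 0, 0, 0, 0] ∈ K → ![0, 0, 0, 1, 0, 0] ∈ K → False := by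
    intro σ τ hσ h1 h2
    have e1 : (![σ, τ, 0, 0, 0, 0] : Fin 6 → ℝ) = σ • sp ![1, 0, 0] ![1, 0, 0]
        + τ • sp ![0, 1, 0] ![0, 1, 0] := by
      funext i; fin_cases i <;> simp [sp]
    have e2 : (![0, 0, 0, 1, 0, 0] : Fin 6 → ℝ) = (2 : ℝ) • sp ![1, 0, 0] ![0, 1, 0] := by
      funext i; fin_cases i <;> simp [sp]
    rw [e1, hKm, map_add, map_smul, map_smul, EA_sp, EA_sp] at h1
    rw [e2, hKm, map_smul, EA_sp, mulVec_smul] at h2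
    have h2' := (smul_eq_zero.1 h2).resolve_left (by norm_num)
    obtain ⟨a, b, ha, hb, hab⟩ := smooth_pencil hsm hM _ _ σ τ h1 h2'
    set u := A *ᵥ ![1, 0, 0] with hu
    set v := A *ᵥ ![0, 1, 0] with hv
    have huu : u ⬝ᵥ u = 1 := by rw [hu, hdot]; simp
    have huv : u ⬝ᵥ v = 0 := by rw [hu, hv, hdot]; simp
    simp only [dotProduct, Fin.sum_univ_three] at huu huv
    have huu' : (u 0 : ℂ) * u 0 + u 1 * u 1 + u 2 * u 2 = 1 := by exact_mod_cast huu
    have huv' : (u 0 : ℂ) * v 0 + u 1 * v 1 + u 2 * v 2 = 0 := by exact_mod_cast huv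
    have ha0 : a = 0 := by
      linear_combination (u 0 : ℂ) * hab 0 + (u 1 : ℂ) * hab 1 + (u 2 : ℂ) * hab 2
        - a * huu' - b * huv'
    rw [ha0] at ha
    apply hσ
    have : (σ : ℂ) = 0 := by rw [← ha]; simp
    exact_mod_cast this
  rcases hpat with ⟨n0, n1, n2⟩ | ⟨n0, n1, n2⟩ | ⟨n0, n1, n2⟩
  · exact (core_allne K ν HK HT n0 n1 n2).elim
  · exact (core_twone K ν HK HT HS2 n0 n1 n2).elim
  · obtain ⟨α, β, hαβ⟩ := core_one K ν HK HT HS1 n0 n1 n2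
    have hKsp : ∀ v, ![-α / 2, -β / 2, 1] ⬝ᵥ v = 0 → sp ![0, 0, 1] v ∈ K := by
      intro v hv
      rw [hαβ]
      simp [dotProduct, Fin.sum_univ_succ] at hv
      funext i; fin_cases i <;> simp [sp]
      linarith
    refine ⟨A *ᵥ ![0, 0, 1], A *ᵥ ![-α / 2, -β / 2, 1], ?_, ⟨ν 2, n2, ?_⟩, fun w => ⟨fun hw => ?_, ?_⟩⟩
    · rw [hdot]; simp
    · rw [hSA]
      ext i j
      simp [Matrix.mul_apply, Fin.sum_univ_succ, vecMulVec_apply, mulVec, dotProduct, diagonal_apply,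
        n0, n1]
      ring
    · set x := EA Aᵀ w with hx
      have hxK : x ∈ K := by rw [hKm, hAA]; exact hw
      have hx' := (hαβ x).1 hxK
      refine ⟨A *ᵥ ![2 * x 4, 2 * x 5, α * x 4 + β * x 5], ?_, ?_⟩
      · rw [hdot]; simp; ring
      · rw [← EA_sp, ← hAA w, ← hx]
        congr 1
        conv_lhs => rw [hx']
        funext i; fin_cases i <;> simp [sp]
    · rintro ⟨v, hv, rfl⟩
      have hvA : v = A *ᵥ (Aᵀ *ᵥ v) := by rw [mulVec_mulVec, hA', one_mulVec]
      rw [hvA, hdot] at hv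
      have := hKsp _ hv
      rw [hKm, EA_sp, ← hvA] at this
      exact this


/-- The data attached to a one-dimensional face. -/
def FD (f : MvPolynomial (Fin 3) ℝ) (F : Set (Matrix (Fin 6) (Fin 6) ℝ))
    (M : Matrix (Fin 6) (Fin 6) ℝ) (p l : Fin 3 → ℝ) : Prop :=
  M ∈ GramSpectrahedron f ∧ l ⬝ᵥ p = 1 ∧
  (∀ w, M *ᵥ w = 0 ↔ ∃ v, l ⬝ᵥ v = 0 ∧ w = sp p v) ∧
  (∀ D : Matrix (Fin 6) (Fin 6) ℝ, Dᵀ = D → (∀ a, sp a a ⬝ᵥ D *ᵥ sp a a = 0) →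
    (∀ w, M *ᵥ w = 0 → D *ᵥ w = 0) → ∃ c : ℝ, D = c • DS (vecMulVec p p)) ∧
  (∀ G, G ∈ F ↔ G ∈ GramSpectrahedron f ∧ ∃ t : ℝ, G = M + t • DS (vecMulVec p p))

lemma gram_add {f : MvPolynomial (Fin 3) ℝ} {M D : Matrix (Fin 6) (Fin 6) ℝ}
    (hM : M ∈ GramSpectrahedron f) (hD : ∀ a, sp a a ⬝ᵥ D *ᵥ sp a a = 0) (t : ℝ)
    (h : (M + t • D).PosSemidef) : M + t • D ∈ GramSpectrahedron f := by
  refine gram_of_eval h fun a => ?_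
  rw [add_mulVec, smul_mulVec, dotProduct_add, dotProduct_smul, hD, gram_eval hM]
  simp

lemma face_data {f : MvPolynomial (Fin 3) ℝ} (hsm : IsSmooth f)
    (F : Set (Matrix (Fin 6) (Fin 6) ℝ)) (hF : IsFace (GramSpectrahedron f) F)
    (h1 : Module.finrank ℝ (vectorSpan ℝ F) = 1) : ∃ M p l, FD f F M p l := by
  obtain ⟨hsub, hconv, hface⟩ := hF
  have hne : ∃ G1 ∈ F, ∃ G2 ∈ F, G1 ≠ G2 := by
    by_contra hcon
    push Not at hcon
    have hs : F.Subsingleton := fun a ha b hb => hcon a ha b hb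
    have : vectorSpan ℝ F = ⊥ := by
      rw [vectorSpan_eq_bot_iff_subsingleton]; exact hs
    rw [this] at h1
    simp at h1
  obtain ⟨G1, hG1, G2, hG2, hG⟩ := hne
  set M := (1/2 : ℝ) • G1 + (1 - 1/2 : ℝ) • G2 with hMdef
  have hMF : M ∈ F := hconv hG1 hG2 (by norm_num) (by norm_num) (by norm_num)
  have hM := hsub hMF
  have hD0mem : G1 - G2 ∈ vectorSpan ℝ F := vsub_mem_vectorSpan ℝ hG1 hG2
  have hD0ne : G1 - G2 ≠ 0 := sub_ne_zero.2 hG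
  have hspan : ∀ D ∈ vectorSpan ℝ F, ∃ c : ℝ, D = c • (G1 - G2) := by
    intro D hD
    have := (finrank_eq_one_iff_of_nonzero' (⟨G1 - G2, hD0mem⟩ : vectorSpan ℝ F)
      (by intro h; exact hD0ne (congrArg Subtype.val h))).1 h1 ⟨D, hD⟩
    obtain ⟨c, hc⟩ := this
    exact ⟨c, (congrArg Subtype.val hc).symm⟩
  have hD0s : (G1 - G2)ᵀ = G1 - G2 := by
    rw [transpose_sub, psd_symm (hsub hG1).1, psd_symm (hsub hG2).1]
  have hD0z : ∀ a, sp a a ⬝ᵥ (G1 - G2) *ᵥ sp a a = 0 := by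
    intro a
    rw [sub_mulVec, dotProduct_sub, gram_eval (hsub hG1), gram_eval (hsub hG2), sub_self]
  have hker : ∀ w, M *ᵥ w = 0 → (G1 - G2) *ᵥ w = 0 := by
    intro w hw
    have q1 := (hsub hG1).1.dotProduct_mulVec_nonneg w
    have q2 := (hsub hG2).1.dotProduct_mulVec_nonneg w
    have q : star w ⬝ᵥ M *ᵥ w = 0 := by rw [hw, dotProduct_zero]
    rw [hMdef, add_mulVec, smul_mulVec, smul_mulVec, dotProduct_add, dotProduct_smul,
      dotProduct_smul, smul_eq_mul, smul_eq_mul] at q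
    have r1 := ((hsub hG1).1.dotProduct_mulVec_zero_iff w).1 (by linarith)
    have r2 := ((hsub hG2).1.dotProduct_mulVec_zero_iff w).1 (by linarith)
    rw [sub_mulVec, r1, r2, sub_zero]
  have hpert : ∀ D : Matrix (Fin 6) (Fin 6) ℝ, Dᵀ = D → (∀ a, sp a a ⬝ᵥ D *ᵥ sp a a = 0) →
      (∀ w, M *ᵥ w = 0 → D *ᵥ w = 0) → ∃ ε : ℝ, 0 < ε ∧ M + ε • D ∈ GramSpectrahedron f ∧
      M + (-ε) • D ∈ GramSpectrahedron f := by
    intro D hs hz hk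
    obtain ⟨ε, hε, a1, a2⟩ := psd_perturb M D hM.1 hs hk
    refine ⟨ε, hε, gram_add hM hz _ a1, gram_add hM hz _ ?_⟩
    rwa [neg_smul, ← sub_eq_add_neg]
  have hall : ∀ D : Matrix (Fin 6) (Fin 6) ℝ, Dᵀ = D → (∀ a, sp a a ⬝ᵥ D *ᵥ sp a a = 0) →
      (∀ w, M *ᵥ w = 0 → D *ᵥ w = 0) → ∃ c : ℝ, D = c • (G1 - G2) := by
    intro D hs hz hk
    obtain ⟨ε, hε, b1, b2⟩ := hpert D hs hz hk
    have hm := hface _ b1 _ b2 (1/2) (by norm_num) (by norm_num) (by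
      convert hMF using 1
      module)
    have := vsub_mem_vectorSpan ℝ hm.1 hMF
    rw [vsub_eq_sub, add_sub_cancel_left] at this
    obtain ⟨c, hc⟩ := hspan _ this
    refine ⟨ε⁻¹ * c, ?_⟩
    rw [mul_smul, ← hc, smul_smul, inv_mul_cancel₀ hε.ne', one_smul]
  obtain ⟨S0, hS0, hDS⟩ := exists_DS _ hD0s hD0z
  have hS0ne : S0 ≠ 0 := by
    rintro rfl
    apply hD0ne
    rw [hDS]
    simpa using DS_smul 0 0
  obtain ⟨p, l, hlp, ⟨k, hk0, hk⟩, hkerM⟩ := kernel_data hsm hM S0 hS0 hS0ne (by rwa [← hDS]) (by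
    intro T hT hTk
    obtain ⟨c, hc⟩ := hall (DS T) (DS_symm T) (DS_zero_form T) hTk
    refine ⟨c, DS_inj hT (by rw [transpose_smul, hS0]) ?_⟩
    rw [hc, hDS, DS_smul])
  have hD0 : G1 - G2 = k • DS (vecMulVec p p) := by rw [hDS, hk, DS_smul]
  have hP : DS (vecMulVec p p) = k⁻¹ • (G1 - G2) := by
    rw [hD0, smul_smul, inv_mul_cancel₀ hk0, one_smul]
  refine ⟨M, p, l, hM, hlp, hkerM, ?_, ?_⟩
  · intro D hs hz hk'
    obtain ⟨c, hc⟩ := hall D hs hz hk'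
    exact ⟨c * k, by rw [hc, hD0, smul_smul]⟩
  · intro G
    constructor
    · intro hGF
      refine ⟨hsub hGF, ?_⟩
      have := vsub_mem_vectorSpan ℝ hGF hMF
      obtain ⟨c, hc⟩ := hspan _ this
      rw [vsub_eq_sub] at hc
      exact ⟨c * k, by rw [mul_smul, ← hD0, ← hc]; abel⟩
    · rintro ⟨hGG, t, rfl⟩
      set D := DS (vecMulVec p p) with hD
      obtain ⟨ε, hε, b1, b2⟩ := hpert (t • D) (by rw [hD, ← DS_smul, DS_symm])
        (by intro a; rw [hD, ← DS_smul, DS_zero_form]) (by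
          intro w hw
          rw [smul_mulVec, hP, smul_mulVec, hker w hw]; simp)
      refine (hface _ hGG _ b2 (ε / (1 + ε)) (by positivity) ?_ ?_).1
      · rw [div_lt_one (by positivity)]; linarith
      · convert hMF using 1
        have : (1 - ε / (1 + ε)) = 1 / (1 + ε) := by field_simp; ring
        rw [this]
        have h1e : (1 + ε) ≠ 0 := by positivity
        have e1 : (ε / (1 + ε)) + 1 / (1 + ε) = 1 := by field_simp; ring
        have e2 : (ε / (1 + ε)) * t + 1 / (1 + ε) * (-ε * t) = 0 := by field_simp; ring
        calc _ = ((ε / (1 + ε)) + 1 / (1 + ε)) • M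
              + ((ε / (1 + ε)) * t + 1 / (1 + ε) * (-ε * t)) • D := by module
          _ = M := by rw [e1, e2]; simp

lemma sp_expand (p v : Fin 3 → ℝ) (s y : ℝ) :
    sp (s • p + y • v) (s • p + y • v)
      = (s ^ 2) • sp p p + (2 * s * y) • sp p v + (y ^ 2) • sp v v := by
  funext i; fin_cases i <;> simp [sp] <;> ring

/-- Pairing with the square of a linear form. -/
def pq (m : Fin 3 → ℝ) (w : Fin 6 → ℝ) : ℝ :=
  w 0 * m 0 ^ 2 + w 1 * m 1 ^ 2 + w 2 * m 2 ^ 2 + 2 * w 3 * m 0 * m 1 + 2 * w 4 * m 0 * m 2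
    + 2 * w 5 * m 1 * m 2

lemma pq_sp (m a b : Fin 3 → ℝ) : pq m (sp a b) = (m ⬝ᵥ a) * (m ⬝ᵥ b) := by
  simp [pq, sp, dotProduct, Fin.sum_univ_three]; ring

lemma pq_comb (m : Fin 3 → ℝ) (x y : ℝ) (u v : Fin 6 → ℝ) :
    pq m (x • u + y • v) = x * pq m u + y * pq m v := by
  simp [pq]; ring

lemma quartic {f : MvPolynomial (Fin 3) ℝ} (hsm : IsSmooth f)
    {F : Set (Matrix (Fin 6) (Fin 6) ℝ)} {M : Matrix (Fin 6) (Fin 6) ℝ} {p l : Fin 3 → ℝ}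
    (h : FD f F M p l) (v : Fin 3 → ℝ) (hv : l ⬝ᵥ v = 0) :
    ∃ A b c : ℝ, (∀ s y : ℝ, eval (s • p + y • v) f
      = A * s ^ 4 + 2 * b * s ^ 2 * y ^ 2 + c * y ^ 4) ∧ 0 < A ∧ (v ≠ 0 → b ^ 2 < A * c) := by
  obtain ⟨hM, hlp, hker, -, -⟩ := h
  have hp0 : p ≠ 0 := by rintro rfl; simp at hlp
  have hpv : M *ᵥ sp p v = 0 := (hker _).2 ⟨v, hv, rfl⟩
  have hs : ∀ x y : Fin 6 → ℝ, x ⬝ᵥ M *ᵥ y = y ⬝ᵥ M *ᵥ x := by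
    intro x y
    rw [dotProduct_mulVec, dotProduct_comm, ← mulVec_transpose, psd_symm hM.1]
  set A := sp p p ⬝ᵥ M *ᵥ sp p p with hA
  set b := sp p p ⬝ᵥ M *ᵥ sp v v with hb
  set c := sp v v ⬝ᵥ M *ᵥ sp v v with hc
  have hAn : 0 ≤ A := by simpa using hM.1.dotProduct_mulVec_nonneg (sp p p)
  have hApos : 0 < A := by
    refine lt_of_le_of_ne hAn fun h0 => hp0 ?_
    refine smooth_point hsm hM p ((hM.1.dotProduct_mulVec_zero_iff _).1 ?_)
    simpa using h0.symm
  have hQ : ∀ x y : ℝ, (x • sp p p + y • sp v v) ⬝ᵥ M *ᵥ (x • sp p p + y • sp v v)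
      = A * x ^ 2 + 2 * b * x * y + c * y ^ 2 := by
    intro x y
    simp only [mulVec_add, mulVec_smul, dotProduct_add, add_dotProduct, smul_dotProduct,
      dotProduct_smul, smul_eq_mul]
    rw [hs (sp v v) (sp p p), ← hA, ← hb, ← hc]
    ring
  refine ⟨A, b, c, fun s y => ?_, hApos, fun hv0 => ?_⟩
  · rw [← gram_eval hM, sp_expand]
    have e : M *ᵥ ((s ^ 2) • sp p p + (2 * s * y) • sp p v + (y ^ 2) • sp v v)
        = M *ᵥ ((s ^ 2) • sp p p + (y ^ 2) • sp v v) := by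
      simp only [mulVec_add, mulVec_smul, hpv]; simp
    rw [e, hs, e, hQ]; ring
  · by_contra hcon
    push Not at hcon
    have hn := hM.1.dotProduct_mulVec_nonneg ((-b) • sp p p + A • sp v v)
    have hq := hQ (-b) A
    have hz : M *ᵥ ((-b) • sp p p + A • sp v v) = 0 := by
      refine (hM.1.dotProduct_mulVec_zero_iff _).1 ?_
      rw [star_trivial] at hn ⊢
      rw [hq] at hn ⊢
      nlinarith
    obtain ⟨u, -, hu⟩ := (hker _).1 hz
    have hvv : 0 < v ⬝ᵥ v := by
      rcases (dotProduct_self_star_nonneg v).lt_or_eq with h | h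
      · simpa using h
      · exact absurd (dotProduct_self_eq_zero.1 (by simpa using h.symm)) hv0
    have hmp : (v - (v ⬝ᵥ p) • l) ⬝ᵥ p = 0 := by
      rw [sub_dotProduct, smul_dotProduct, hlp]; simp
    have hmv : (v - (v ⬝ᵥ p) • l) ⬝ᵥ v = v ⬝ᵥ v := by
      rw [sub_dotProduct, smul_dotProduct, hv]; simp
    have := congrArg (pq (v - (v ⬝ᵥ p) • l)) hu
    rw [pq_comb, pq_sp, pq_sp, pq_sp, hmp, hmv] at this
    have : A * (v ⬝ᵥ v * v ⬝ᵥ v) = 0 := by linarith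
    have hpos : 0 < A * (v ⬝ᵥ v * v ⬝ᵥ v) := by positivity
    linarith

/-- Uniqueness of a face with given direction. -/
lemma face_unique {f : MvPolynomial (Fin 3) ℝ} (hsm : IsSmooth f)
    {F F' : Set (Matrix (Fin 6) (Fin 6) ℝ)} {M M' : Matrix (Fin 6) (Fin 6) ℝ}
    {p l p' l' : Fin 3 → ℝ}
    (h : FD f F M p l) (h' : FD f F' M' p' l') (k : ℝ) (hk : p' = k • p) : F = F' := by
  have hp0 : l' ⬝ᵥ p' = 1 := h'.2.1
  have hk0 : k ≠ 0 := by rintro rfl; rw [hk] at hp0; simp at hp0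
  have hll : ∀ v, l' ⬝ᵥ v = 0 → l ⬝ᵥ v = 0 := by
    intro v hv
    obtain ⟨A, b, c, e, hA, -⟩ := quartic hsm h (v - (l ⬝ᵥ v) • p)
      (by rw [dotProduct_sub, dotProduct_smul, h.2.1]; simp)
    obtain ⟨A', b', c', e', -, -⟩ := quartic hsm h' v hv
    set μ := l ⬝ᵥ v
    have key : ∀ s : ℝ, A * (s * k + μ) ^ 4 + 2 * b * (s * k + μ) ^ 2 + c
        = A' * s ^ 4 + 2 * b' * s ^ 2 + c' := by
      intro s
      have a1 := e (s * k + μ) 1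
      have a2 := e' s 1
      have : (s * k + μ) • p + (1 : ℝ) • (v - μ • p) = s • p' + (1 : ℝ) • v := by
        rw [hk]; module
      rw [this, a2] at a1
      linarith
    have k1 := key 1
    have k2 := key (-1)
    have k3 := key 2
    have k4 := key (-2)
    have : A * μ * k ^ 3 = 0 := by linear_combination (-1/24) * (k1 - k2) + (1/48) * (k3 - k4)
    have : A * k ^ 3 ≠ 0 := by positivity
    have h3 : (A * k ^ 3) * μ = 0 := by linarith
    exact (mul_eq_zero.1 h3).resolve_left this
  have hll2 : ∀ v, l ⬝ᵥ v = 0 → l' ⬝ᵥ v = 0 := by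
    intro v hv
    have := hll (v - (l' ⬝ᵥ v) • p') (by rw [dotProduct_sub, dotProduct_smul, hp0]; simp)
    rw [dotProduct_sub, hv, hk, dotProduct_smul, dotProduct_smul, h.2.1] at this
    simp at this
    rcases this with h | h
    · exact h
    · exact absurd h hk0
  have hsc : ∀ v, sp p' v = sp p (k • v) := by
    intro v; rw [hk]; funext i; fin_cases i <;> simp [sp] <;> ring
  have hker : ∀ w, M *ᵥ w = 0 → M' *ᵥ w = 0 := by
    intro w hw
    obtain ⟨v, hv, rfl⟩ := (h.2.2.1 w).1 hw
    refine (h'.2.2.1 _).2 ⟨k⁻¹ • v, ?_, ?_⟩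
    · rw [dotProduct_smul, hll2 v hv]; simp
    · rw [hsc, smul_smul, mul_inv_cancel₀ hk0, one_smul]
  obtain ⟨c, hc⟩ := h.2.2.2.1 (M' - M)
    (by rw [transpose_sub, psd_symm h.1.1, psd_symm h'.1.1])
    (by intro a; rw [sub_mulVec, dotProduct_sub, gram_eval h.1, gram_eval h'.1, sub_self])
    (by intro w hw; rw [sub_mulVec, hw, hker w hw, sub_zero])
  have hM' : M' = M + c • DS (vecMulVec p p) := by rw [← hc]; abel
  have hP : DS (vecMulVec p' p') = (k * k) • DS (vecMulVec p p) := by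
    rw [← DS_smul, hk]; congr 1; ext i j; simp [vecMulVec_apply]; ring
  ext G
  rw [h.2.2.2.2, h'.2.2.2.2, hM', hP]
  refine and_congr_right fun _ => ⟨?_, ?_⟩
  · rintro ⟨t, rfl⟩
    refine ⟨(t - c) / (k * k), ?_⟩
    rw [smul_smul, div_mul_cancel₀ _ (mul_ne_zero hk0 hk0)]
    module
  · rintro ⟨t, rfl⟩
    exact ⟨c + t * (k * k), by module⟩

lemma binary_alg (A b c A' B' C' u u' w : ℝ) (hA : 0 < A) (hb : b ^ 2 < A * c)
    (hdet : u' = 1 + u * w) (hB : B' ^ 2 < A' * C')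
    (h : ∀ s y : ℝ, A * (s * u + y * u') ^ 4 + 2 * b * (s * u + y * u') ^ 2 * (s + y * w) ^ 2
      + c * (s + y * w) ^ 4 = A' * s ^ 4 + 2 * B' * s ^ 2 * y ^ 2 + C' * y ^ 4) : u = 0 := by
  by_contra hu
  have h10 := h 1 0
  have h01 := h 0 1
  have h11 := h 1 1
  have h1m := h 1 (-1)
  have h21 := h 2 1
  have h2m := h 2 (-1)
  have E1 : u' * (A * u ^ 3 + b * u) + w * (b * u ^ 2 + c) = 0 := by
    linear_combination (1/48) * (h21 - h2m) - (1/24) * (h11 - h1m)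
  have E2 : u * u' * (A * u' ^ 2 + b * w ^ 2) + w * (b * u' ^ 2 + c * w ^ 2) = 0 := by
    linear_combination (1/8) * (h11 - h1m) - E1
  have eA : A' = A * u ^ 4 + 2 * b * u ^ 2 + c := by linear_combination -h10
  have eC : C' = A * u' ^ 4 + 2 * b * u' ^ 2 * w ^ 2 + c * w ^ 4 := by linear_combination -h01
  have eB : B' = 3 * A * u ^ 2 * u' ^ 2 + b * (u ^ 2 * w ^ 2 + 4 * u * u' * w + u' ^ 2)
      + 3 * c * w ^ 2 := by
    linear_combination (-1/4) * (h11 + h1m) + (1/2) * (h10 + h01)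
  have hApos : 0 < A' := by
    rw [eA]
    have : 0 < A * (A * u ^ 4 + 2 * b * u ^ 2 + c) := by nlinarith [sq_nonneg (A * u ^ 2 + b)]
    exact (pos_iff_pos_of_mul_pos this).1 hA
  have f1 : A' * u' = b * u ^ 2 + c := by
    rw [eA]; linear_combination u * E1 + (b * u ^ 2 + c) * hdet
  have f2 : A' * w = -(u * (A * u ^ 2 + b)) := by
    rw [eA]; linear_combination E1 - (A * u ^ 3 + b * u) * hdet
  have hfac : u * ((A * c - b ^ 2) * (A' * (c - A * (u ^ 2) ^ 2))) = 0 := by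
    have E3 : u * (A' * u') * (A * (A' * u') ^ 2 + b * (A' * w) ^ 2)
        + (A' * w) * (b * (A' * u') ^ 2 + c * (A' * w) ^ 2) = 0 := by
      linear_combination A' ^ 3 * E2
    rw [f1, f2] at E3
    rw [eA]
    linear_combination E3
  have hc : c = A * (u ^ 2) ^ 2 := by
    have h1 := (mul_eq_zero.1 hfac).resolve_left hu
    have h2 := (mul_eq_zero.1 h1).resolve_left (by linarith)
    have h3 := (mul_eq_zero.1 h2).resolve_left hApos.ne'
    linarith
  have hu' : u' = -(u * w) := by
    have : A' * u' = A' * (-(u * w)) := by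
      rw [f1, hc]; linear_combination u * f2
    exact mul_left_cancel₀ hApos.ne' this
  have hM : 0 < u ^ 2 := by positivity
  set m := u ^ 2 with hm
  have eB2 : B' = w ^ 2 * (6 * A * m ^ 2 - 2 * b * m) := by
    rw [eB, hu', hc, hm]; ring
  have eC2 : C' = w ^ 4 * (2 * A * m ^ 2 + 2 * b * m) := by
    rw [eC, hu', hc, hm]; ring
  have eA2 : A' = 2 * A * m ^ 2 + 2 * b * m := by
    rw [eA, hc, hm]; ring
  have hbA : b < A * m := by
    rw [hc] at hb
    have : b ^ 2 < (A * m) ^ 2 := by linarith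
    exact lt_of_pow_lt_pow_left₀ 2 (by positivity) this
  have d : B' ^ 2 - A' * C' = w ^ 4 * m ^ 2 * ((8 * A * m) * (4 * (A * m - b))) := by
    rw [eB2, eA2, eC2]; ring
  have : 0 ≤ w ^ 4 * m ^ 2 * ((8 * A * m) * (4 * (A * m - b))) := by
    have : 0 < A * m - b := by linarith
    positivity
  linarith

lemma binary_orth {f : MvPolynomial (Fin 3) ℝ} (hsm : IsSmooth f)
    {F F' : Set (Matrix (Fin 6) (Fin 6) ℝ)} {M M' : Matrix (Fin 6) (Fin 6) ℝ}
    {p l p' l' : Fin 3 → ℝ}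
    (h : FD f F M p l) (h' : FD f F' M' p' l') (hne : F ≠ F') : l ⬝ᵥ p' = 0 := by
  have hpar : ∀ k : ℝ, p' ≠ k • p := fun k hk => hne (face_unique hsm h h' k hk)
  have hpar' : ∀ k : ℝ, p ≠ k • p' := fun k hk => hne (face_unique hsm h' h k hk).symm
  obtain ⟨A, b, c, e, hA, hb⟩ := quartic hsm h (p' - (l ⬝ᵥ p') • p)
    (by rw [dotProduct_sub, dotProduct_smul, h.2.1]; simp)
  obtain ⟨A', B', C', e', -, hB⟩ := quartic hsm h' (p - (l' ⬝ᵥ p) • p')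
    (by rw [dotProduct_sub, dotProduct_smul, h'.2.1]; simp)
  set u := l ⬝ᵥ p'
  set k := l' ⬝ᵥ p
  refine binary_alg A b c A' B' C' u (1 + u * (-k)) (-k) hA (hb (sub_ne_zero.2 (hpar _))) rfl
    (hB (sub_ne_zero.2 (hpar' _))) fun s y => ?_
  rw [← e', ← e]
  congr 1
  congr 1
  module

/-- The Gram spectrahedron of a smooth psd ternary quartic has at most six faces of
dimension 1. -/
theorem at_most_six_one_dimensional_faces
    (f : MvPolynomial (Fin 3) ℝ) (hhom : f.IsHomogeneous 4)
    (hsm : IsSmooth f) (hpsd : IsPsd f) :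
    {F : Set (Matrix (Fin 6) (Fin 6) ℝ) |
        IsFace (GramSpectrahedron f) F ∧
          Module.finrank ℝ (vectorSpan ℝ F) = 1}.Finite ∧
      {F : Set (Matrix (Fin 6) (Fin 6) ℝ) |
        IsFace (GramSpectrahedron f) F ∧
          Module.finrank ℝ (vectorSpan ℝ F) = 1}.ncard ≤ 6 := by
  set T := {F : Set (Matrix (Fin 6) (Fin 6) ℝ) |
        IsFace (GramSpectrahedron f) F ∧ Module.finrank ℝ (vectorSpan ℝ F) = 1}
  have hd : ∀ F : T, ∃ M p l, FD f F M p l := fun F => face_data hsm F F.2.1 F.2.2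
  choose M p l hfd using hd
  have hli : LinearIndependent ℝ p := by
    rw [linearIndependent_iff']
    intro s g hg i hi
    have := congrArg (fun x => l i ⬝ᵥ x) hg
    simp only [dotProduct_sum, dotProduct_smul, dotProduct_zero] at this
    rw [Finset.sum_eq_single i] at this
    · rw [(hfd i).2.1] at this
      simpa using this
    · intro j _ hji
      rw [binary_orth hsm (hfd i) (hfd j) (fun h => hji (Subtype.ext h.symm)), smul_zero]
    · intro h; exact absurd hi h
  have hfin : Finite T := hli.finite
  refine ⟨Set.toFinite T, ?_⟩
  have : Fintype T := Fintype.ofFinite T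
  have hc := hli.fintype_card_le_finrank
  rw [← Nat.card_eq_fintype_card, Nat.card_coe_set_eq] at hc
  simp at hc
  omega
end

section
/- Let f ∈ ℝ[x,y,z] be a smooth psd ternary quartic. Then the Gram spectrahedron Gram(f) has a face F of dimension 2 such that every matrix in the relative interior of F has rank 5. -/
open MvPolynomial Matrix

theorem psd_iff (G : Matrix (Fin 6) (Fin 6) ℝ) :
    G.PosSemidef ↔ G.IsSymm ∧ ∀ x : Fin 6 → ℝ, 0 ≤ x ⬝ᵥ G *ᵥ x := by
  rw [posSemidef_iff_dotProduct_mulVec]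
  simp [Matrix.IsHermitian, Matrix.IsSymm, conjTranspose_eq_transpose_of_trivial]

theorem psd_ker {G : Matrix (Fin 6) (Fin 6) ℝ} (hG : G.PosSemidef) {x : Fin 6 → ℝ}
    (hx : x ⬝ᵥ G *ᵥ x = 0) : G *ᵥ x = 0 := by
  have := hG.dotProduct_mulVec_zero_iff x
  simpa [hx] using this

theorem symm_dot {G : Matrix (Fin 6) (Fin 6) ℝ} (hG : G.IsSymm) (x y : Fin 6 → ℝ) :
    x ⬝ᵥ G *ᵥ y = y ⬝ᵥ G *ᵥ x := by
  rw [dotProduct_mulVec, ← mulVec_transpose, hG.eq, dotProduct_comm]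

/-- Perturbation lemma. -/
theorem small_pert {G D : Matrix (Fin 6) (Fin 6) ℝ} (hG : G.PosSemidef) (hD : D.IsSymm)
    (N : Submodule ℝ (Fin 6 → ℝ)) (hN : ∀ x ∈ N, G *ᵥ x = 0 ∧ D *ᵥ x = 0)
    (hpos : ∀ x, G *ᵥ x = 0 → x ∉ N → 0 < x ⬝ᵥ D *ᵥ x) :
    ∃ ε : ℝ, 0 < ε ∧ (∀ x, x ∉ N → 0 < x ⬝ᵥ (G + ε • D) *ᵥ x) ∧ (G + ε • D).PosSemidef := by
  obtain ⟨N', hN'⟩ := Submodule.exists_isCompl N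
  obtain ⟨hGs, hGp⟩ := (psd_iff G).1 hG
  have hcg : Continuous fun x : Fin 6 → ℝ => x ⬝ᵥ G *ᵥ x := by fun_prop
  have hcd : Continuous fun x : Fin 6 → ℝ => x ⬝ᵥ D *ᵥ x := by fun_prop
  set S : Set (Fin 6 → ℝ) := Metric.sphere 0 1 ∩ (N' : Set (Fin 6 → ℝ)) with hS
  have hSc : IsCompact S := (isCompact_sphere _ _).inter_right N'.closed_of_finiteDimensional
  set T := S ∩ {x | x ⬝ᵥ D *ᵥ x ≤ 0} with hT
  have hTc : IsCompact T := hSc.inter_right (isClosed_le hcd continuous_const)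
  have hnotN : ∀ x ∈ N', x ≠ 0 → x ∉ N := by
    intro x hx hx0 hxN
    exact hx0 (Submodule.disjoint_def.1 hN'.disjoint x hxN hx)
  have hTpos : ∀ x ∈ T, 0 < x ⬝ᵥ G *ᵥ x := by
    rintro x ⟨⟨hx1, hx2⟩, hx3⟩
    have hx0 : x ≠ 0 := by
      rintro rfl; simp at hx1
    rcases (hGp x).lt_or_eq with h | h
    · exact h
    · have := hpos x (psd_ker hG h.symm) (hnotN x hx2 hx0)
      exact absurd hx3 (not_le.2 this)
  -- lower bound for g on T
  have hmu : ∃ μ : ℝ, 0 < μ ∧ ∀ x ∈ T, μ ≤ x ⬝ᵥ G *ᵥ x := by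
    rcases T.eq_empty_or_nonempty with h | h
    · exact ⟨1, one_pos, by simp [h]⟩
    · obtain ⟨x, hx, hmin⟩ := hTc.exists_isMinOn h hcg.continuousOn
      exact ⟨_, hTpos x hx, fun y hy => hmin hy⟩
  have hM : ∃ M : ℝ, ∀ x ∈ S, -M ≤ x ⬝ᵥ D *ᵥ x := by
    obtain ⟨m, hm⟩ := (hSc.image hcd).bddBelow
    exact ⟨-m, fun x hx => by simpa using hm (Set.mem_image_of_mem _ hx)⟩
  obtain ⟨μ, hμ, hμT⟩ := hmu
  obtain ⟨M, hMS⟩ := hM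
  have hMp : 0 < |M| + 1 := by positivity
  set ε := μ / (|M| + 1) / 2 with hε
  have hεp : 0 < ε := by positivity
  have key : ∀ x ∈ S, 0 < x ⬝ᵥ (G + ε • D) *ᵥ x := by
    intro x hx
    rw [add_mulVec, dotProduct_add, smul_mulVec, dotProduct_smul, smul_eq_mul]
    by_cases h : x ⬝ᵥ D *ᵥ x ≤ 0
    · have h1 := hμT x ⟨hx, h⟩
      have h2 := hMS x hx
      have h3 : ε * (|M| + 1) = μ / 2 := by rw [hε]; field_simp
      nlinarith [le_abs_self M]
    · push Not at h
      have := hGp x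
      positivity
  have key2 : ∀ x, x ∉ N → 0 < x ⬝ᵥ (G + ε • D) *ᵥ x := by
    intro x hx
    obtain ⟨n, hn, v, hv, rfl⟩ := Submodule.mem_sup.1 (hN'.sup_eq_top ▸ Submodule.mem_top (x := x))
    have hv0 : v ≠ 0 := by
      rintro rfl; simp [hn] at hx
    have hsym : (G + ε • D).IsSymm := by
      unfold Matrix.IsSymm; simp [hGs.eq, hD.eq]
    have hn0 : (G + ε • D) *ᵥ n = 0 := by
      rw [add_mulVec, smul_mulVec, (hN n hn).1, (hN n hn).2]; simp
    have h1 : (n + v) ⬝ᵥ (G + ε • D) *ᵥ (n + v) = v ⬝ᵥ (G + ε • D) *ᵥ v := by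
      rw [mulVec_add, hn0, zero_add, add_dotProduct, symm_dot hsym n v, hn0]; simp
    rw [h1]
    have hnv : 0 < ‖v‖ := norm_pos_iff.2 hv0
    have h2 := key (‖v‖⁻¹ • v) ⟨by simp [norm_smul, hnv.ne'], N'.smul_mem _ hv⟩
    rw [mulVec_smul, dotProduct_smul, smul_dotProduct, smul_eq_mul, smul_eq_mul] at h2
    have h3 : 0 < ‖v‖⁻¹ := by positivity
    by_contra hneg
    push Not at hneg
    have : ‖v‖⁻¹ * (‖v‖⁻¹ * v ⬝ᵥ (G + ε • D) *ᵥ v) ≤ 0 := by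
      apply mul_nonpos_of_nonneg_of_nonpos h3.le
      exact mul_nonpos_of_nonneg_of_nonpos h3.le hneg
    linarith
  refine ⟨ε, hεp, key2, (psd_iff _).2 ⟨by unfold Matrix.IsSymm; simp [hGs.eq, hD.eq], fun x => ?_⟩⟩
  by_cases hx : x ∈ N
  · rw [add_mulVec, smul_mulVec, (hN x hx).1, (hN x hx).2]; simp
  · exact (key2 x hx).le

theorem psd_closed : IsClosed {G : Matrix (Fin 6) (Fin 6) ℝ | G.PosSemidef} := by
  have : {G : Matrix (Fin 6) (Fin 6) ℝ | G.PosSemidef}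
      = {G | Gᵀ = G} ∩ ⋂ x : Fin 6 → ℝ, {G | 0 ≤ x ⬝ᵥ G *ᵥ x} := by
    ext G; simp [psd_iff, Matrix.IsSymm]
  rw [this]
  refine IsClosed.inter (isClosed_eq (by fun_prop) (by fun_prop)) (isClosed_iInter fun x => ?_)
  exact isClosed_le continuous_const (by fun_prop)

/-- Going in direction `D` until the kernel grows. -/
theorem psd_drop {H D : Matrix (Fin 6) (Fin 6) ℝ} (hH : H.PosSemidef) (hD : D.IsSymm)
    (hker : ∀ x, H *ᵥ x = 0 → D *ᵥ x = 0) (w : Fin 6 → ℝ) (hw : w ⬝ᵥ D *ᵥ w < 0) :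
    ∃ t : ℝ, 0 < t ∧ (H + t • D).PosSemidef ∧
      LinearMap.ker H.mulVecLin < LinearMap.ker (H + t • D).mulVecLin := by
  set T : Set ℝ := {t | 0 ≤ t ∧ (H + t • D).PosSemidef} with hT
  have hTcl : IsClosed T := by
    refine IsClosed.inter (isClosed_le continuous_const continuous_id) ?_
    exact psd_closed.preimage (by fun_prop : Continuous fun t : ℝ => H + t • D)
  have hTb : BddAbove T := by
    refine ⟨(w ⬝ᵥ H *ᵥ w) / (-(w ⬝ᵥ D *ᵥ w)), ?_⟩
    rintro t ⟨ht, hp⟩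
    have := ((psd_iff _).1 hp).2 w
    rw [add_mulVec, dotProduct_add, smul_mulVec, dotProduct_smul, smul_eq_mul] at this
    rw [le_div_iff₀ (by linarith)]
    linarith
  have hT0 : (0 : ℝ) ∈ T := ⟨le_rfl, by simpa using hH⟩
  have hmem := hTcl.csSup_mem ⟨0, hT0⟩ hTb
  set t := sSup T with ht
  have hle : LinearMap.ker H.mulVecLin ≤ LinearMap.ker (H + t • D).mulVecLin := by
    intro x hx
    have hx : H *ᵥ x = 0 := by simpa using hx
    simp [add_mulVec, smul_mulVec, hx, hker x hx]
  -- generic step: if kernels coincide at `s`, can go further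
  have step : ∀ s ∈ T, (∀ x, (H + s • D) *ᵥ x = 0 → H *ᵥ x = 0) → ∃ s' ∈ T, s < s' := by
    intro s hs hk
    obtain ⟨ε, hε, -, hp⟩ := small_pert hs.2 hD (LinearMap.ker H.mulVecLin)
      (by
        intro x hx
        have hx : H *ᵥ x = 0 := by simpa using hx
        simp [add_mulVec, smul_mulVec, hx, hker x hx])
      (by
        intro x hx hx'
        exact absurd (by simpa using hk x hx) hx')
    refine ⟨s + ε, ⟨by linarith [hs.1], ?_⟩, by linarith⟩
    rwa [add_smul, ← add_assoc]
  have htpos : 0 < t := by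
    obtain ⟨s', hs', h0⟩ := step 0 hT0 (by simp)
    exact lt_of_lt_of_le h0 (le_csSup hTb hs')
  refine ⟨t, htpos, hmem.2, lt_of_le_of_ne hle ?_⟩
  intro heq
  obtain ⟨s', hs', h0⟩ := step t hmem (by
    intro x hx
    have : x ∈ LinearMap.ker (H + t • D).mulVecLin := by
      rw [LinearMap.mem_ker, mulVecLin_apply]; exact hx
    rw [← heq] at this
    simpa using this)
  exact absurd (le_csSup hTb hs') (not_le.2 h0)

/-- The vector of quadratic monomials at a point. -/
def mon {R : Type*} [CommRing R] (a : Fin 3 → R) : Fin 6 → R :=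
  ![a 0 ^ 2, a 1 ^ 2, a 2 ^ 2, a 0 * a 1, a 0 * a 2, a 1 * a 2]

/-- The general Gram matrix of the zero form. -/
def W {R : Type*} [CommRing R] (b : Fin 6 → R) : Matrix (Fin 6) (Fin 6) R :=
  !![0, b 0, b 1, 0, 0, b 3;
     b 0, 0, b 2, 0, b 4, 0;
     b 1, b 2, 0, b 5, 0, 0;
     0, 0, b 5, -2 * b 0, -b 3, -b 4;
     0, b 4, 0, -b 3, -2 * b 1, -b 5;
     b 3, 0, 0, -b 4, -b 5, -2 * b 2]

/-- The 2×2 minors of the symmetric 3×3 matrix attached to `u`. -/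
def minr {R : Type*} [CommRing R] (u : Fin 6 → R) : Fin 6 → R :=
  ![u 0 * u 1 - u 3 ^ 2, u 0 * u 2 - u 4 ^ 2, u 1 * u 2 - u 5 ^ 2,
    u 0 * u 5 - u 3 * u 4, u 1 * u 4 - u 3 * u 5, u 2 * u 3 - u 4 * u 5]

/-- The determinant of the symmetric 3×3 matrix attached to `u`. -/
def dt {R : Type*} [CommRing R] (u : Fin 6 → R) : R :=
  u 0 * u 1 * u 2 + 2 * u 3 * u 4 * u 5 - u 0 * u 5 ^ 2 - u 1 * u 4 ^ 2 - u 2 * u 3 ^ 2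

theorem W_symm {R : Type*} [CommRing R] (b : Fin 6 → R) : (W b).IsSymm := by
  ext i j; fin_cases i <;> fin_cases j <;> simp [W]

theorem W_add {R : Type*} [CommRing R] (b c : Fin 6 → R) : W (b + c) = W b + W c := by
  ext i j; fin_cases i <;> fin_cases j <;> simp [W] <;> ring

theorem W_smul {R : Type*} [CommRing R] (t : R) (b : Fin 6 → R) : W (t • b) = t • W b := by
  ext i j; fin_cases i <;> fin_cases j <;> simp [W] <;> ring

theorem W_mulVec {R : Type*} [CommRing R] (b u : Fin 6 → R) : W b *ᵥ u =
    ![b 0 * u 1 + b 1 * u 2 + b 3 * u 5, b 0 * u 0 + b 2 * u 2 + b 4 * u 4,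
      b 1 * u 0 + b 2 * u 1 + b 5 * u 3, -2 * b 0 * u 3 - b 3 * u 4 - b 4 * u 5 + b 5 * u 2,
      -2 * b 1 * u 4 - b 3 * u 3 + b 4 * u 1 - b 5 * u 5,
      -2 * b 2 * u 5 + b 3 * u 0 - b 4 * u 3 - b 5 * u 4] := by
  ext i; fin_cases i <;> simp [W, mulVec, dotProduct, Fin.sum_univ_succ] <;> ring

theorem W_quad {R : Type*} [CommRing R] (b u : Fin 6 → R) :
    u ⬝ᵥ W b *ᵥ u = 2 * (b ⬝ᵥ minr u) := by
  rw [W_mulVec]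
  simp [minr, dotProduct, Fin.sum_univ_succ]; ring

theorem minr_mon {R : Type*} [CommRing R] (a : Fin 3 → R) : minr (mon a) = 0 := by
  ext i; fin_cases i <;> simp [minr, mon] <;> ring

theorem mon_ne {R : Type*} [Field R] {a : Fin 3 → R} (ha : a ≠ 0) : mon a ≠ 0 := by
  intro h; apply ha
  have h0 := congrFun h 0
  have h1 := congrFun h 1
  have h2 := congrFun h 2
  simp [mon] at h0 h1 h2
  ext i; fin_cases i <;> simp [*]

/-- rank one lemma -/
theorem rank_one {R : Type*} [Field R] {u : Fin 6 → R} (hu : u ≠ 0) (hm : minr u = 0) :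
    ∃ p : Fin 3 → R, ∃ k : R, p ≠ 0 ∧ k ≠ 0 ∧ mon p = k • u := by
  have h0 := congrFun hm 0
  have h1 := congrFun hm 1
  have h2 := congrFun hm 2
  have h3 := congrFun hm 3
  have h4 := congrFun hm 4
  have h5 := congrFun hm 5
  simp [minr] at h0 h1 h2 h3 h4 h5
  by_cases hu0 : u 0 = 0
  · by_cases hu1 : u 1 = 0
    · by_cases hu2 : u 2 = 0
      · exfalso; apply hu
        simp [hu0, hu1, hu2] at h0 h1 h2
        ext i; fin_cases i <;> simp [*]
      · refine ⟨![u 4, u 5, u 2], u 2, fun h => hu2 (by simpa using congrFun h 2), hu2, ?_⟩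
        ext i; fin_cases i <;> simp [mon] <;> grind
    · refine ⟨![u 3, u 1, u 5], u 1, fun h => hu1 (by simpa using congrFun h 1), hu1, ?_⟩
      ext i; fin_cases i <;> simp [mon] <;> grind
  · refine ⟨![u 0, u 3, u 4], u 0, fun h => hu0 (by simpa using congrFun h 0), hu0, ?_⟩
    ext i; fin_cases i <;> simp [mon] <;> grind

theorem eval_gram (G : Matrix (Fin 6) (Fin 6) ℝ) (a : Fin 3 → ℝ) :
    eval a (∑ i, ∑ j, MvPolynomial.C (G i j) * (gramBasis i * gramBasis j))
      = mon a ⬝ᵥ G *ᵥ mon a := by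
  have h : ∀ i, eval a (gramBasis i) = mon a i := by
    intro i; fin_cases i <;> simp [gramBasis, mon]
  simp only [map_sum, map_mul, eval_C, h, dotProduct, mulVec, Finset.mul_sum]
  refine Finset.sum_congr rfl fun i _ => Finset.sum_congr rfl fun j _ => by ring

theorem gram_eq_iff (G : Matrix (Fin 6) (Fin 6) ℝ) (f : MvPolynomial (Fin 3) ℝ) :
    (∑ i, ∑ j, MvPolynomial.C (G i j) * (gramBasis i * gramBasis j)) = f ↔
      ∀ a, mon a ⬝ᵥ G *ᵥ mon a = eval a f := by
  constructor
  · rintro rfl a; rw [eval_gram]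
  · intro h; apply MvPolynomial.funext; intro a; rw [eval_gram, h]

theorem mem_gram {G : Matrix (Fin 6) (Fin 6) ℝ} {f : MvPolynomial (Fin 3) ℝ} :
    G ∈ GramSpectrahedron f ↔ G.PosSemidef ∧ ∀ a, mon a ⬝ᵥ G *ᵥ mon a = eval a f := by
  rw [← gram_eq_iff]; rfl

theorem W_mon (b : Fin 6 → ℝ) (a : Fin 3 → ℝ) : mon a ⬝ᵥ W b *ᵥ mon a = 0 := by
  rw [W_quad, minr_mon]; simp

theorem gram_zero {D : Matrix (Fin 6) (Fin 6) ℝ} (hD : D.IsSymm)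
    (h : ∀ a, mon a ⬝ᵥ D *ᵥ mon a = 0) : ∃ b, D = W b := by
  refine ⟨![D 0 1, D 0 2, D 1 2, D 0 5, D 1 4, D 2 3], ?_⟩
  have hs : ∀ i j, D i j = D j i := fun i j => congrFun (congrFun hD.eq j) i
  have H : ∀ x y z : ℝ, D 0 0 * x^4 + D 1 1 * y^4 + D 2 2 * z^4 + 2 * D 0 3 * x^3*y
     + 2 * D 0 4 * x^3*z + 2 * D 1 3 * y^3*x + 2 * D 1 5 * y^3 * z + 2 * D 2 4 * z^3*x
     + 2 * D 2 5 * z^3 * y + (2 * D 0 1 + D 3 3) * x^2*y^2 + (2 * D 0 2 + D 4 4) * x^2*z^2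
     + (2 * D 1 2 + D 5 5) * y^2*z^2 + 2 * (D 0 5 + D 3 4) * x^2*y*z
     + 2 * (D 1 4 + D 3 5) * y^2*x*z + 2 * (D 2 3 + D 4 5) * z^2*x*y = 0 := by
    intro x y z
    have := h ![x, y, z]
    simp [mon, dotProduct, mulVec, Fin.sum_univ_succ] at this
    rw [← this]
    simp only [hs 1 0, hs 2 0, hs 3 0, hs 4 0, hs 5 0, hs 2 1, hs 3 1, hs 4 1, hs 5 1, hs 3 2,
      hs 4 2, hs 5 2, hs 4 3, hs 5 3, hs 5 4]
    ring
  have a1 := H 1 0 0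
  have a2 := H 0 1 0
  have a3 := H 0 0 1
  have a4 := H 1 1 0
  have a5 := H 1 (-1) 0
  have a6 := H 1 2 0
  have a7 := H 1 0 1
  have a8 := H 1 0 (-1)
  have a9 := H 1 0 2
  have a10 := H 0 1 1
  have a11 := H 0 1 (-1)
  have a12 := H 0 1 2
  have a13 := H 1 1 1
  have a14 := H 1 1 (-1)
  have a15 := H 1 (-1) 1
  norm_num at a1 a2 a3 a4 a5 a6 a7 a8 a9 a10 a11 a12 a13 a14 a15
  ext i j
  fin_cases i <;> fin_cases j <;> simp [W] <;>
    first
    | linarith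
    | (simp only [hs 1 0, hs 2 0, hs 3 0, hs 4 0, hs 5 0, hs 2 1, hs 3 1, hs 4 1, hs 5 1, hs 3 2,
      hs 4 2, hs 5 2, hs 4 3, hs 5 3, hs 5 4]; done)
    | (simp only [hs 1 0, hs 2 0, hs 3 0, hs 4 0, hs 5 0, hs 2 1, hs 3 1, hs 4 1, hs 5 1, hs 3 2,
      hs 4 2, hs 5 2, hs 4 3, hs 5 3, hs 5 4]; linarith)

/-- existence of a symmetric Gram matrix -/
theorem exists_gram (f : MvPolynomial (Fin 3) ℝ) (hf : f.IsHomogeneous 4) :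
    ∃ G : Matrix (Fin 6) (Fin 6) ℝ, G.IsSymm ∧ ∀ a, mon a ⬝ᵥ G *ᵥ mon a = eval a f := by
  have hmon : ∀ d : Fin 3 →₀ ℕ, d.degree = 4 → ∃ i j : Fin 6, ∀ a : Fin 3 → ℝ,
      a 0 ^ d 0 * a 1 ^ d 1 * a 2 ^ d 2 = mon a i * mon a j := by
    intro d hd
    have hd' : d 0 + d 1 + d 2 = 4 := by
      rw [← hd, Finsupp.degree_eq_sum, Fin.sum_univ_three]
    generalize d 0 = p at *
    generalize d 1 = q at *
    generalize d 2 = r at *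
    by_cases h0 : 2 ≤ p
    · obtain ⟨p', rfl⟩ := Nat.exists_eq_add_of_le h0
      have : (p' = 2 ∧ q = 0 ∧ r = 0) ∨ (p' = 0 ∧ q = 2 ∧ r = 0) ∨ (p' = 0 ∧ q = 0 ∧ r = 2) ∨
        (p' = 1 ∧ q = 1 ∧ r = 0) ∨ (p' = 1 ∧ q = 0 ∧ r = 1) ∨ (p' = 0 ∧ q = 1 ∧ r = 1) := by omega
      refine ⟨0, ?_⟩
      rcases this with ⟨rfl, rfl, rfl⟩ | ⟨rfl, rfl, rfl⟩ | ⟨rfl, rfl, rfl⟩ | ⟨rfl, rfl, rfl⟩ |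
        ⟨rfl, rfl, rfl⟩ | ⟨rfl, rfl, rfl⟩
      exacts [⟨0, fun a => by simp [mon]; ring⟩, ⟨1, fun a => by simp [mon]⟩,
        ⟨2, fun a => by simp [mon]⟩, ⟨3, fun a => by simp [mon]; ring⟩,
        ⟨4, fun a => by simp [mon]; ring⟩, ⟨5, fun a => by simp [mon]; ring⟩]
    · by_cases h1 : 2 ≤ q
      · obtain ⟨q', rfl⟩ := Nat.exists_eq_add_of_le h1
        have : (p = 0 ∧ q' = 2 ∧ r = 0) ∨ (p = 0 ∧ q' = 0 ∧ r = 2) ∨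
          (p = 1 ∧ q' = 1 ∧ r = 0) ∨ (p = 1 ∧ q' = 0 ∧ r = 1) ∨ (p = 0 ∧ q' = 1 ∧ r = 1) := by omega
        refine ⟨1, ?_⟩
        rcases this with ⟨rfl, rfl, rfl⟩ | ⟨rfl, rfl, rfl⟩ | ⟨rfl, rfl, rfl⟩ | ⟨rfl, rfl, rfl⟩ |
          ⟨rfl, rfl, rfl⟩
        exacts [⟨1, fun a => by simp [mon]; ring⟩, 
          ⟨2, fun a => by simp [mon]⟩, ⟨3, fun a => by simp [mon]; ring⟩,
          ⟨4, fun a => by simp [mon]; ring⟩, ⟨5, fun a => by simp [mon]; ring⟩]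
      · have : (p = 0 ∧ q = 0 ∧ r = 4) ∨
          (p = 1 ∧ q = 1 ∧ r = 2) ∨ (p = 1 ∧ q = 0 ∧ r = 3) ∨ (p = 0 ∧ q = 1 ∧ r = 3) := by omega
        refine ⟨2, ?_⟩
        rcases this with ⟨rfl, rfl, rfl⟩ | ⟨rfl, rfl, rfl⟩ | ⟨rfl, rfl, rfl⟩ | ⟨rfl, rfl, rfl⟩
        exacts [⟨2, fun a => by simp [mon]; ring⟩, 
          ⟨3, fun a => by simp [mon]; ring⟩,
          ⟨4, fun a => by simp [mon]; ring⟩, ⟨5, fun a => by simp [mon]; ring⟩]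
  have key : ∀ d : Fin 3 →₀ ℕ, ∃ M : Matrix (Fin 6) (Fin 6) ℝ, d ∈ f.support →
      ∀ a : Fin 3 → ℝ, mon a ⬝ᵥ M *ᵥ mon a = f.coeff d * ∏ i, a i ^ d i := by
    intro d
    by_cases hd : d ∈ f.support
    · obtain ⟨i, j, h⟩ := hmon d (by
        have := hf (mem_support_iff.1 hd)
        rw [Finsupp.degree_eq_weight_one]; exact this)
      refine ⟨Matrix.single i j (f.coeff d), fun _ a => ?_⟩
      rw [Fin.prod_univ_three, h a, single_mulVec]
      simp [dotProduct, Function.update_apply]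
      ring
    · exact ⟨0, fun h => absurd h hd⟩
  choose M hM using key
  set G := ∑ d ∈ f.support, M d with hG
  have hGe : ∀ a, mon a ⬝ᵥ G *ᵥ mon a = eval a f := by
    intro a
    rw [eval_eq', hG, sum_mulVec, dotProduct_sum]
    exact Finset.sum_congr rfl fun d hd => hM d hd a
  refine ⟨(1 / 2 : ℝ) • (G + Gᵀ), ?_, fun a => ?_⟩
  · unfold Matrix.IsSymm; simp [add_comm]
  · rw [smul_mulVec, dotProduct_smul, add_mulVec, dotProduct_add, hGe, mulVec_transpose,
      dotProduct_comm, ← dotProduct_mulVec, hGe]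
    simp; ring

/-- smoothness in terms of Gram matrices -/
theorem sing {f : MvPolynomial (Fin 3) ℝ} (hf : IsSmooth f) {G : Matrix (Fin 6) (Fin 6) ℝ}
    (hs : G.IsSymm) (hG : ∀ a, mon a ⬝ᵥ G *ᵥ mon a = eval a f) (z : Fin 3 → ℂ)
    (hz : ∀ i, ∑ j, (G i j : ℂ) * mon z j = 0) : z = 0 := by
  apply hf
  intro k
  rw [← (gram_eq_iff G f).2 hG]
  have h : ∀ i, eval z (map (algebraMap ℝ ℂ) (gramBasis i)) = mon z i := by
    intro i; fin_cases i <;> simp [gramBasis, mon]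
  simp only [map_sum, map_mul, map_C, Derivation.leibniz, smul_eq_mul, map_add, h,
    pderiv_C, map_zero, mul_zero, add_zero, eval_C, Complex.coe_algebraMap]
  simp only [mul_add, Finset.sum_add_distrib]
  have hsym : ∀ i j, G i j = G j i := fun i j => congrFun (congrFun hs.eq j) i
  have e1 : ∀ D : Fin 6 → ℂ, ∑ i, ∑ j, (G i j : ℂ) * (mon z i * D j) = 0 := by
    intro D
    rw [Finset.sum_comm]
    refine Finset.sum_eq_zero fun j _ => ?_
    calc _ = D j * ∑ i, (G j i : ℂ) * mon z i := by
          rw [Finset.mul_sum]; refine Finset.sum_congr rfl fun i _ => by rw [hsym i j]; ring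
      _ = 0 := by rw [hz, mul_zero]
  have e2 : ∀ D : Fin 6 → ℂ, ∑ i, ∑ j, (G i j : ℂ) * (mon z j * D i) = 0 := by
    intro D
    refine Finset.sum_eq_zero fun j _ => ?_
    calc _ = D j * ∑ i, (G j i : ℂ) * mon z i := by
          rw [Finset.mul_sum]; refine Finset.sum_congr rfl fun i _ => by ring
      _ = 0 := by rw [hz, mul_zero]
  rw [e1, e2, add_zero]

theorem hasDeriv_line (f : MvPolynomial (Fin 3) ℝ) (a : Fin 3 → ℝ) (i : Fin 3) (t : ℝ) :
    HasDerivAt (fun t : ℝ => eval (a + t • Pi.single i 1) f)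
      (eval (a + t • Pi.single i 1) (pderiv i f)) t := by
  induction f using MvPolynomial.induction_on with
  | C c => simpa using hasDerivAt_const t c
  | add p q hp hq =>
    have := hp.add hq
    simp only [map_add]
    exact this
  | mul_X p j hp =>
    have hx : HasDerivAt (fun t : ℝ => (a + t • Pi.single i 1 : Fin 3 → ℝ) j)
        ((Pi.single i (1 : ℝ) : Fin 3 → ℝ) j) t := by
      simpa using ((hasDerivAt_id t).mul_const ((Pi.single i (1 : ℝ) : Fin 3 → ℝ) j)).const_add (a j)
    have := hp.mul hx
    have e : (fun t : ℝ => eval (a + t • Pi.single i 1) (p * X j)) =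
      (fun t : ℝ => eval (a + t • Pi.single i 1) p) *
        fun t : ℝ => (a + t • Pi.single i 1 : Fin 3 → ℝ) j := by
      ext s; simp
    rw [e]
    refine this.congr_deriv ?_
    · rw [Derivation.leibniz, pderiv_X]
      simp only [smul_eq_mul, map_add, map_mul, eval_X]
      by_cases h : i = j
      · subst h; simp; ring
      · simp [Ne.symm h]; ring

theorem f_pos {f : MvPolynomial (Fin 3) ℝ} (hf : IsSmooth f) (hp : IsPsd f) {a : Fin 3 → ℝ}
    (ha : a ≠ 0) : 0 < eval a f := by
  refine lt_of_le_of_ne (hp a) fun h0 => ha ?_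
  have hd : ∀ i, eval a (pderiv i f) = 0 := by
    intro i
    have h1 := hasDeriv_line f a i 0
    simp only [zero_smul, add_zero] at h1
    refine IsLocalMin.hasDerivAt_eq_zero (Filter.Eventually.of_forall fun t => ?_) h1
    simp only [zero_smul, add_zero, ← h0]
    exact hp _
  have := hf (fun i => (a i : ℂ)) (fun i => by
    rw [pderiv_map]
    have := hd i
    rw [eval_map]
    have e : eval₂ (algebraMap ℝ ℂ) (fun i => (a i : ℂ)) (pderiv i f)
      = algebraMap ℝ ℂ (eval a (pderiv i f)) := by
      rw [eval, coe_eval₂Hom, eval₂_comp_left]; rfl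
    rw [e, this, map_zero])
  ext i
  simpa using congrFun this i

theorem csq (w : ℂ) : ∃ a : ℂ, a ^ 2 = w := IsAlgClosed.exists_pow_nat_eq w (by norm_num)

theorem quad_zero (a b c : ℂ) : ∃ s t : ℂ, (s ≠ 0 ∨ t ≠ 0) ∧ a * s ^ 2 + b * s * t + c * t ^ 2 = 0 := by
  by_cases ha : a = 0
  · exact ⟨1, 0, Or.inl one_ne_zero, by simp [ha]⟩
  · obtain ⟨d, hd⟩ := csq (b ^ 2 - 4 * a * c)
    refine ⟨-b + d, 2 * a, Or.inr (by simpa using ha), ?_⟩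
    linear_combination a * hd

theorem cubic_zero (a b c d : ℂ) (ha : a ≠ 0) : ∃ s : ℂ, a * s ^ 3 + b * s ^ 2 + c * s + d = 0 := by
  obtain ⟨s, hs⟩ := IsAlgClosed.exists_root
    (Polynomial.C a * Polynomial.X ^ 3 + Polynomial.C b * Polynomial.X ^ 2 +
      Polynomial.C c * Polynomial.X + Polynomial.C d)
    (by rw [Polynomial.degree_cubic ha]; norm_num)
  exact ⟨s, by simpa [Polynomial.IsRoot] using hs⟩

theorem bin_lemma (l0 l1 l2 l3 : ℂ) (h : ¬ (l0 = 0 ∧ l1 = 0 ∧ l2 = 0 ∧ l3 = 0)) :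
    ∃ s t : ℂ, (s ≠ 0 ∨ t ≠ 0) ∧ ∀ a b c : ℂ, a * l0 + b * l1 + c * l2 = 0 →
      a * l1 + b * l2 + c * l3 = 0 → a * s ^ 2 + b * s * t + c * t ^ 2 = 0 := by
  by_cases hr : l1 * l3 - l2 ^ 2 = 0 ∧ l2 * l1 - l0 * l3 = 0 ∧ l0 * l2 - l1 ^ 2 = 0
  · obtain ⟨h1, h2, h3⟩ := hr
    by_cases h0 : l0 = 0
    · have e1 : l1 = 0 := by
        have : l1 ^ 2 = 0 := by rw [h0] at h3; linear_combination -h3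
        exact pow_eq_zero_iff (two_ne_zero) |>.1 this
      have e2 : l2 = 0 := by
        have : l2 ^ 2 = 0 := by rw [e1] at h1; linear_combination -h1
        exact pow_eq_zero_iff (two_ne_zero) |>.1 this
      have e3 : l3 ≠ 0 := fun h3 => h ⟨h0, e1, e2, h3⟩
      refine ⟨0, 1, Or.inr one_ne_zero, fun a b c _ hb => ?_⟩
      rw [e1, e2] at hb
      have : c * l3 = 0 := by linear_combination hb
      have : c = 0 := by simpa [e3] using this
      simp [this]
    · refine ⟨l0, l1, Or.inl h0, fun a b c ha hb => ?_⟩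
      linear_combination l0 * ha - c * h3
  · set A := l1 * l3 - l2 ^ 2 with hA
    set B := l2 * l1 - l0 * l3 with hB
    set E := l0 * l2 - l1 ^ 2 with hE
    obtain ⟨s, t, hst, hz⟩ := quad_zero A B E
    refine ⟨s, t, hst, fun a b c ha hb => ?_⟩
    have c1 : a * B - b * A = 0 := by
      rw [hA, hB]; linear_combination (-l3) * ha + l2 * hb
    have c2 : a * E - c * A = 0 := by
      rw [hA, hE]; linear_combination (l2) * ha - l1 * hb
    have c3 : b * E - c * B = 0 := by
      rw [hB, hE]; linear_combination (-l1) * ha + l0 * hb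
    by_cases hA0 : A = 0
    · by_cases hB0 : B = 0
      · have hE0 : E ≠ 0 := fun h => hr ⟨hA0, hB0, h⟩
        refine mul_left_cancel₀ hE0 ?_
        linear_combination s ^ 2 * c2 + s * t * c3 + c * hz
      · refine mul_left_cancel₀ hB0 ?_
        linear_combination s ^ 2 * c1 - t ^ 2 * c3 + b * hz
    · refine mul_left_cancel₀ hA0 ?_
      linear_combination - s * t * c1 - t ^ 2 * c2 + a * hz

theorem line_core (i j k : Fin 3) (hsum : ∀ g : Fin 3 → ℂ, ∑ a, g a = g i + g j + g k)
    (hmk : ∀ s t v : ℂ, ∃ z : Fin 3 → ℂ, z i = s ∧ z j = t ∧ z k = v)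
    (hall : ∀ P : Fin 3 → Prop, P i → P j → P k → ∀ a, P a)
    (L : Fin 3 → Fin 3 → Fin 3 → ℂ) (h1 : ∀ a b c, L a b c = L b a c)
    (h2 : ∀ a b c, L a b c = L a c b) (l : Fin 3 → ℂ) (hl : l k ≠ 0)
    (hlL : ∀ b c, ∑ a, l a * L a b c = 0) (U : Set (Fin 3 → Fin 3 → ℂ))
    (hU : ∀ Q ∈ U, ∀ c, ∑ a, ∑ b, Q a b * L a b c = 0)
    (hno : ¬ ∃ z : Fin 3 → ℂ, z ≠ 0 ∧ ∀ Q ∈ U, ∑ a, ∑ b, Q a b * (z a * z b) = 0) :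
    ∀ a b c, L a b c = 0 := by
  obtain ⟨α, hα⟩ : ∃ α, α = -l i / l k := ⟨_, rfl⟩
  obtain ⟨β, hβ⟩ : ∃ β, β = -l j / l k := ⟨_, rfl⟩
  have hk : ∀ b c, L k b c = α * L i b c + β * L j b c := by
    intro b c
    have := hlL b c
    rw [hsum] at this
    rw [hα, hβ]; field_simp; linear_combination this
  by_cases hz : L i i i = 0 ∧ L i i j = 0 ∧ L i j j = 0 ∧ L j j j = 0
  · obtain ⟨e0, e1, e2, e3⟩ := hz
    have s1 : ∀ c, L i i c = 0 := by
      refine hall _ e0 e1 ?_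
      rw [h2, h1, hk, e0, h1 j i i, h2 i j i, e1]; simp
    have s2 : ∀ c, L i j c = 0 := by
      refine hall _ (by rw [h2]; exact e1) e2 ?_
      rw [h2, h1, hk, h2 i i j, h2, e1, h1 j i j, e2]; simp
    have s3 : ∀ c, L j j c = 0 := by
      refine hall _ (by rw [h2, h1]; exact e2) e3 ?_
      rw [h2, h1, hk, e2, e3]; simp
    have s4 : ∀ b c, L i b c = 0 := by
      refine hall _ s1 s2 fun c => ?_
      rw [h1, hk, s1, h1, s2]; simp
    have s5 : ∀ b c, L j b c = 0 := by
      refine hall _ (fun c => by rw [h1]; exact s2 c) s3 fun c => ?_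
      rw [h1, hk, s2, s3]; simp
    refine hall _ s4 s5 fun b c => ?_
    rw [hk, s4, s5]; simp
  · exfalso; apply hno
    obtain ⟨s, t, hst, hq⟩ := bin_lemma _ _ _ _ hz
    obtain ⟨z, z1, z2, z3⟩ := hmk s t (α * s + β * t)
    refine ⟨z, ?_, fun Q hQ => ?_⟩
    · rintro rfl
      rcases hst with h | h
      · exact h z1.symm
      · exact h z2.symm
    · have a1 := hU Q hQ i
      have a2 := hU Q hQ j
      simp only [hsum] at a1 a2 ⊢
      rw [z1, z2, z3]
      have r1 : L j i i = L i i j := by rw [h1, h2]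
      have r2 : L j i j = L i j j := by rw [h1]
      have r3 : L i j i = L i i j := by rw [h2]
      have r4 : L j j i = L i j j := by rw [h2, h1]
      have k1 : ∀ c, L i k c = α * L i i c + β * L i j c := by
        intro c; rw [h1, hk, h1 j i c]
      have k2 : ∀ c, L j k c = α * L i j c + β * L j j c := by
        intro c; rw [h1, hk]
      have k3 : ∀ c, L k k c = α * L i k c + β * L j k c := fun c => hk k c
      simp only [k3, k1, k2, hk, r1, r2, r3, r4] at a1 a2
      have := hq (Q i i + (Q i k + Q k i) * α + Q k k * α ^ 2)
        (Q i j + Q j i + (Q i k + Q k i) * β + (Q j k + Q k j) * α + 2 * Q k k * α * β)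
        (Q j j + (Q j k + Q k j) * β + Q k k * β ^ 2)
        (by linear_combination a1) (by linear_combination a2)
      linear_combination this

theorem line_lemma
    (L : Fin 3 → Fin 3 → Fin 3 → ℂ) (h1 : ∀ a b c, L a b c = L b a c)
    (h2 : ∀ a b c, L a b c = L a c b) (l : Fin 3 → ℂ) (hl : l ≠ 0)
    (hlL : ∀ b c, ∑ a, l a * L a b c = 0) (U : Set (Fin 3 → Fin 3 → ℂ))
    (hU : ∀ Q ∈ U, ∀ c, ∑ a, ∑ b, Q a b * L a b c = 0)
    (hno : ¬ ∃ z : Fin 3 → ℂ, z ≠ 0 ∧ ∀ Q ∈ U, ∑ a, ∑ b, Q a b * (z a * z b) = 0) :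
    ∀ a b c, L a b c = 0 := by
  obtain ⟨k, hk⟩ := Function.ne_iff.1 hl
  fin_cases k
  · refine line_core 1 2 0 (fun g => by rw [Fin.sum_univ_three]; ring)
      (fun s t v => ⟨![v, s, t], rfl, rfl, rfl⟩)
      (fun P p q r a => by fin_cases a <;> assumption) L h1 h2 l hk hlL U hU hno
  · refine line_core 0 2 1 (fun g => by rw [Fin.sum_univ_three]; ring)
      (fun s t v => ⟨![s, v, t], rfl, rfl, rfl⟩)
      (fun P p q r a => by fin_cases a <;> assumption) L h1 h2 l hk hlL U hU hno
  · refine line_core 0 1 2 (fun g => by rw [Fin.sum_univ_three])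
      (fun s t v => ⟨![s, t, v], rfl, rfl, rfl⟩)
      (fun P p q r a => by fin_cases a <;> assumption) L h1 h2 l hk hlL U hU hno

/-- discriminant of a quadratic form -/
def dsc (q : Fin 6 → ℂ) : ℂ :=
  4 * q 0 * q 1 * q 2 + q 3 * q 4 * q 5 - q 0 * q 5 ^ 2 - q 1 * q 4 ^ 2 - q 2 * q 3 ^ 2

theorem factor_core (q0 q1 q2 q3 q4 q5 : ℂ) (h : 4 * q0 * q1 * q2 + q3 * q4 * q5 - q0 * q5 ^ 2
    - q1 * q4 ^ 2 - q2 * q3 ^ 2 = 0) (hq : q0 ≠ 0) :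
    ∃ l0 l1 l2 m0 m1 m2 : ℂ, q0 = l0 * m0 ∧ q1 = l1 * m1 ∧ q2 = l2 * m2 ∧
      q3 = l0 * m1 + l1 * m0 ∧ q4 = l0 * m2 + l2 * m0 ∧ q5 = l1 * m2 + l2 * m1 := by
  obtain ⟨a, e, ha, he, hae⟩ : ∃ a e : ℂ, a ^ 2 = q3 ^ 2 - 4 * q0 * q1 ∧
      e ^ 2 = q4 ^ 2 - 4 * q0 * q2 ∧ a * e = q3 * q4 - 2 * q0 * q5 := by
    have hB : (q3 * q4 - 2 * q0 * q5) ^ 2 = (q3 ^ 2 - 4 * q0 * q1) * (q4 ^ 2 - 4 * q0 * q2) := by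
      linear_combination (-4 * q0) * h
    obtain ⟨a, ha⟩ := csq (q3 ^ 2 - 4 * q0 * q1)
    by_cases ha0 : a = 0
    · obtain ⟨e, he⟩ := csq (q4 ^ 2 - 4 * q0 * q2)
      refine ⟨a, e, ha, he, ?_⟩
      rw [← ha, ha0] at hB
      have : (q3 * q4 - 2 * q0 * q5) ^ 2 = 0 := by linear_combination hB
      rw [ha0, pow_eq_zero_iff (two_ne_zero) |>.1 this]; ring
    · refine ⟨a, (q3 * q4 - 2 * q0 * q5) / a, ha, ?_, by field_simp⟩
      rw [div_pow, hB, ha]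
      rw [← ha]; field_simp
  refine ⟨1 / 2, (q3 + a) / (4 * q0), (q4 + e) / (4 * q0), 2 * q0, q3 - a, q4 - e, by ring, ?_, ?_, ?_, ?_, ?_⟩
  · field_simp; linear_combination ha
  · field_simp; linear_combination he
  · field_simp; ring
  · field_simp; ring
  · field_simp; linear_combination 2 * hae

theorem factor (q : Fin 6 → ℂ) (h : dsc q = 0) :
    ∃ l0 l1 l2 m0 m1 m2 : ℂ, q 0 = l0 * m0 ∧ q 1 = l1 * m1 ∧ q 2 = l2 * m2 ∧
      q 3 = l0 * m1 + l1 * m0 ∧ q 4 = l0 * m2 + l2 * m0 ∧ q 5 = l1 * m2 + l2 * m1 := by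
  unfold dsc at h
  by_cases h0 : q 0 = 0
  · by_cases h1 : q 1 = 0
    · by_cases h2 : q 2 = 0
      · have : q 3 * q 4 * q 5 = 0 := by rw [h0, h1, h2] at h; linear_combination h
        rcases mul_eq_zero.1 this with h' | h5
        · rcases mul_eq_zero.1 h' with h3 | h4
          · exact ⟨0, 0, 1, q 4, q 5, 0, by simp [h0], by simp [h1], by simp [h2], by simp [h3],
              by simp, by simp⟩
          · exact ⟨0, 1, 0, q 3, 0, q 5, by simp [h0], by simp [h1], by simp [h2], by simp,
              by simp [h4], by simp⟩
        · exact ⟨1, 0, 0, 0, q 3, q 4, by simp [h0], by simp [h1], by simp [h2], by simp,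
              by simp, by simp [h5]⟩
      · obtain ⟨l0, l1, l2, m0, m1, m2, e0, e1, e2, e3, e4, e5⟩ :=
          factor_core (q 2) (q 1) (q 0) (q 5) (q 4) (q 3) (by linear_combination h) h2
        exact ⟨l2, l1, l0, m2, m1, m0, e2, e1, e0, by rw [e5]; ring, by rw [e4]; ring, by rw [e3]; ring⟩
    · obtain ⟨l0, l1, l2, m0, m1, m2, e0, e1, e2, e3, e4, e5⟩ :=
        factor_core (q 1) (q 0) (q 2) (q 3) (q 5) (q 4) (by linear_combination h) h1
      exact ⟨l1, l0, l2, m1, m0, m2, e1, e0, e2, by rw [e3]; ring, by rw [e5], by rw [e4]⟩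
  · exact factor_core _ _ _ _ _ _ h h0

/-- index of the product of two variables -/
def idx : Fin 3 → Fin 3 → Fin 6 := ![![0, 3, 4], ![3, 1, 5], ![4, 5, 2]]

/-- Hankel (moment) matrices -/
def Hank {R : Type*} (H : Matrix (Fin 6) (Fin 6) R) : Prop :=
  H.IsSymm ∧ H 0 1 = H 3 3 ∧ H 0 2 = H 4 4 ∧ H 1 2 = H 5 5 ∧ H 0 5 = H 3 4 ∧ H 1 4 = H 3 5 ∧
    H 2 3 = H 4 5

/-- upper triangular coefficient matrix of a quadratic form -/
def tri (q : Fin 6 → ℂ) : Fin 3 → Fin 3 → ℂ := ![![q 0, q 3, q 4], ![0, q 1, q 5], ![0, 0, q 2]]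

theorem macaulay {H : Matrix (Fin 6) (Fin 6) ℂ} (hH : Hank H) (h0 : H ≠ 0) :
    ∃ z : Fin 3 → ℂ, z ≠ 0 ∧ ∀ q, H *ᵥ q = 0 → q ⬝ᵥ mon z = 0 := by
  have htri : ∀ q z, ∑ a, ∑ b, tri q a b * (z a * z b) = q ⬝ᵥ mon z := by
    intro q z
    simp [tri, mon, Fin.sum_univ_succ, dotProduct]; ring
  have htriH : ∀ q c d, ∑ a, ∑ b, tri q a b * H (idx a b) (idx c d) = (H *ᵥ q) (idx c d) := by
    intro q c d
    have hs : ∀ i j, H i j = H j i := fun i j => congrFun (congrFun hH.1.eq j) i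
    simp [tri, idx, Fin.sum_univ_succ, dotProduct, mulVec]
    rw [hs 0, hs 1, hs 2, hs 3, hs 4, hs 5]
    ring
  by_cases hU : ∃ q q', H *ᵥ q = 0 ∧ H *ᵥ q' = 0 ∧ q ≠ 0 ∧ ∀ s : ℂ, s • q + q' ≠ 0
  · by_contra hno
    have hno' : ¬ ∃ z : Fin 3 → ℂ, z ≠ 0 ∧
        ∀ Q ∈ tri '' {q | H *ᵥ q = 0}, ∑ a, ∑ b, Q a b * (z a * z b) = 0 := by
      rintro ⟨z, hz, hz'⟩
      refine hno ⟨z, hz, fun q hq => ?_⟩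
      rw [← htri]; exact hz' _ ⟨q, hq, rfl⟩
    -- symmetries of the tensor
    set h : Fin 3 → Fin 3 → Fin 3 → Fin 3 → ℂ := fun a b c d => H (idx a b) (idx c d) with hh
    have t1 : ∀ a b c d, h a b c d = h b a c d := by
      intro a b c d; simp only [hh]
      have : idx a b = idx b a := by fin_cases a <;> fin_cases b <;> rfl
      rw [this]
    have t2 : ∀ a b c d, h a b c d = h c d a b := by
      intro a b c d; exact congrFun (congrFun hH.1.eq (idx c d)) (idx a b)
    have t3 : ∀ a b c d, h a b c d = h a c b d := by
      obtain ⟨hsym, g1, g2, g3, g4, g5, g6⟩ := hH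
      have hs : ∀ i j, H i j = H j i := fun i j => congrFun (congrFun hsym.eq j) i
      have key : ∀ i j : Fin 6, H i j = H (max i j) (min i j) := by
        intro i j; rcases le_total i j with h | h
        · rw [max_eq_right h, min_eq_left h, hs]
        · rw [max_eq_left h, min_eq_right h]
      rw [hs] at g1 g2 g3 g4 g5 g6
      rw [hs 3 4] at g4
      rw [hs 3 5] at g5
      rw [hs 4 5] at g6
      intro a b c d
      simp only [hh]
      fin_cases a <;> fin_cases b <;> fin_cases c <;> fin_cases d <;> simp only [idx] <;>
        simp <;> first
          | done
          | simp [g1, g2, g3, g4, g5, g6, hs 0 1, hs 0 2, hs 1 2, hs 0 3, hs 0 4, hs 0 5, hs 1 3,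
              hs 1 4, hs 1 5, hs 2 3, hs 2 4, hs 2 5, hs 3 4, hs 3 5, hs 4 5]
    obtain ⟨q, q', hq, hq', hq0, hind⟩ := hU
    obtain ⟨r, hr, hr0, hrd⟩ : ∃ r, H *ᵥ r = 0 ∧ r ≠ 0 ∧ dsc r = 0 := by
      by_cases hd : dsc q = 0
      · exact ⟨q, hq, hq0, hd⟩
      · obtain ⟨s, hs⟩ := cubic_zero (dsc q)
          (4 * q 0 * q 1 * q' 2 + 4 * q 0 * q' 1 * q 2 + 4 * q' 0 * q 1 * q 2
            + q 3 * q 4 * q' 5 + q 3 * q' 4 * q 5 + q' 3 * q 4 * q 5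
            - q' 0 * q 5 ^ 2 - 2 * q 0 * q 5 * q' 5 - q' 1 * q 4 ^ 2 - 2 * q 1 * q 4 * q' 4
            - q' 2 * q 3 ^ 2 - 2 * q 2 * q 3 * q' 3)
          (4 * q' 0 * q' 1 * q 2 + 4 * q' 0 * q 1 * q' 2 + 4 * q 0 * q' 1 * q' 2
            + q' 3 * q' 4 * q 5 + q' 3 * q 4 * q' 5 + q 3 * q' 4 * q' 5
            - q 0 * q' 5 ^ 2 - 2 * q' 0 * q' 5 * q 5 - q 1 * q' 4 ^ 2 - 2 * q' 1 * q' 4 * q 4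
            - q 2 * q' 3 ^ 2 - 2 * q' 2 * q' 3 * q 3) (dsc q') hd
        refine ⟨s • q + q', by rw [mulVec_add, mulVec_smul, hq, hq']; simp, hind s, ?_⟩
        rw [← hs]; simp [dsc]; ring
    obtain ⟨l0, l1, l2, m0, m1, m2, e0, e1, e2, e3, e4, e5⟩ := factor r hrd
    have hl : (![l0, l1, l2] : Fin 3 → ℂ) ≠ 0 := by
      intro hl; apply hr0
      have a0 : l0 = 0 := congrFun hl 0
      have a1 : l1 = 0 := congrFun hl 1
      have a2 : l2 = 0 := congrFun hl 2
      subst a0 a1 a2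
      ext i; fin_cases i <;> simp [*]
    have hm : (![m0, m1, m2] : Fin 3 → ℂ) ≠ 0 := by
      intro hl; apply hr0
      have a0 : m0 = 0 := congrFun hl 0
      have a1 : m1 = 0 := congrFun hl 1
      have a2 : m2 = 0 := congrFun hl 2
      subst a0 a1 a2
      ext i; fin_cases i <;> simp [*]
    have hUh : ∀ Q ∈ tri '' {q | H *ᵥ q = 0}, ∀ c d, ∑ a, ∑ b, Q a b * h a b c d = 0 := by
      rintro _ ⟨q, hq, rfl⟩ c d
      rw [hh, htriH]
      have hq : H *ᵥ q = 0 := hq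
      rw [hq]; rfl
    have hlm : ∀ c d, ∑ b, ![m0, m1, m2] b * ∑ a, ![l0, l1, l2] a * h a b c d = 0 := by
      intro c d
      have := htriH r c d
      rw [hr] at this
      simp only [Pi.zero_apply] at this
      rw [← this]
      have t := fun x y => t1 x y c d
      simp only [hh] at t ⊢
      simp [Fin.sum_univ_succ, tri, e0, e1, e2, e3, e4, e5]
      rw [t 1 0, t 2 0, t 2 1]
      ring
    have L1 := line_lemma (fun b c d => ∑ a, ![l0, l1, l2] a * h a b c d)
      (by intro b c d; refine Finset.sum_congr rfl fun a _ => by rw [t3])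
      (by intro b c d; refine Finset.sum_congr rfl fun a _ => by
            rw [t2, t1, t2])
      ![m0, m1, m2] hm hlm _
      (by
        intro Q hQ d
        calc _ = ∑ a, ![l0, l1, l2] a * ∑ b, ∑ c, Q b c * h b c a d := by
              simp only [Finset.mul_sum]
              conv_rhs => rw [Finset.sum_comm]
              refine Finset.sum_congr rfl fun b _ => ?_
              rw [Finset.sum_comm]
              refine Finset.sum_congr rfl fun a _ => Finset.sum_congr rfl fun c _ => ?_
              rw [t1 a b, t3 b a]; ring
          _ = 0 := by simp [hUh Q hQ]) hno'
    have L2 : ∀ e a b c, h e a b c = 0 := by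
      intro e
      refine line_lemma (h e) (fun a b c => t3 e a b c) (fun a b c => by rw [t2, t1, t2])
        ![l0, l1, l2] hl ?_ _ ?_ hno'
      · intro c d
        rw [← L1 e c d]
        refine Finset.sum_congr rfl fun a _ => by rw [t1]
      · intro Q hQ d
        rw [← hUh Q hQ e d]
        refine Finset.sum_congr rfl fun a _ => Finset.sum_congr rfl fun b _ => by
          rw [t1 e a, t3 a e]
    apply h0
    have hidx : ∀ i : Fin 6, ∃ a b, idx a b = i := by decide
    ext i j
    obtain ⟨a, b, rfl⟩ := hidx i
    obtain ⟨c, d, rfl⟩ := hidx j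
    exact L2 a b c d
  · push Not at hU
    by_cases hker : ∃ q, H *ᵥ q = 0 ∧ q ≠ 0
    · obtain ⟨q, hq, hq0⟩ := hker
      obtain ⟨s, t, hst, hz⟩ := quad_zero (q 0) (q 3) (q 1)
      refine ⟨![s, t, 0], ?_, fun q' hq' => ?_⟩
      · intro h
        rcases hst with h' | h'
        · exact h' (congrFun h 0)
        · exact h' (congrFun h 1)
      · obtain ⟨c, hc⟩ := hU q q' hq hq' hq0
        have : q' = (-c) • q := by
          rw [neg_smul]; exact eq_neg_of_add_eq_zero_right hc
        rw [this]
        simp [dotProduct, mon, Fin.sum_univ_succ]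
        linear_combination (-c) * hz
    · push Not at hker
      exact ⟨![1, 0, 0], fun h => one_ne_zero (congrFun h 0), fun q hq => by simp [hker q hq]⟩

/-- Frobenius pairing. -/
def pr (H G : Matrix (Fin 6) (Fin 6) ℝ) : ℝ := ∑ i, ∑ j, H i j * G i j

theorem pr_add (H H' G : Matrix (Fin 6) (Fin 6) ℝ) : pr (H + H') G = pr H G + pr H' G := by
  simp [pr, add_mul, Finset.sum_add_distrib]

theorem pr_smul (t : ℝ) (H G : Matrix (Fin 6) (Fin 6) ℝ) : pr (t • H) G = t * pr H G := by
  simp [pr, Finset.mul_sum, mul_assoc]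

theorem dot_self_nonneg (v : Fin 6 → ℝ) : 0 ≤ v ⬝ᵥ v :=
  Finset.sum_nonneg fun i _ => mul_self_nonneg _

theorem pr_vec (v : Fin 6 → ℝ) (G : Matrix (Fin 6) (Fin 6) ℝ) :
    pr (vecMulVec v v) G = v ⬝ᵥ G *ᵥ v := by
  simp only [pr, vecMulVec_apply, dotProduct, mulVec, Finset.mul_sum]
  refine Finset.sum_congr rfl fun i _ => Finset.sum_congr rfl fun j _ => by ring

theorem macaulay_real {H : Matrix (Fin 6) (Fin 6) ℝ} (hH : Hank H) (h0 : H ≠ 0) :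
    ∃ z : Fin 3 → ℂ, z ≠ 0 ∧ ∀ q : Fin 6 → ℝ, H *ᵥ q = 0 → ∑ i, (q i : ℂ) * mon z i = 0 := by
  obtain ⟨z, hz, h⟩ := macaulay (H := H.map ((↑) : ℝ → ℂ))
    (by
      obtain ⟨hs, h1, h2, h3, h4, h5, h6⟩ := hH
      refine ⟨?_, by simp [h1], by simp [h2], by simp [h3], by simp [h4], by simp [h5],
        by simp [h6]⟩
      unfold Matrix.IsSymm
      rw [← transpose_map, hs.eq])
    (by
      intro h; apply h0
      ext i j
      have := congrFun (congrFun h i) j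
      simpa using this)
  refine ⟨z, hz, fun q hq => h (fun i => (q i : ℂ)) ?_⟩
  ext i
  have := congrFun hq i
  simp only [mulVec, dotProduct, Pi.zero_apply, map_apply] at this ⊢
  exact_mod_cast this

theorem Hank.add {H H' : Matrix (Fin 6) (Fin 6) ℝ} (h : Hank H) (h' : Hank H') (t : ℝ) :
    Hank (H + t • H') := by
  obtain ⟨a0, a1, a2, a3, a4, a5, a6⟩ := h
  obtain ⟨b0, b1, b2, b3, b4, b5, b6⟩ := h'
  refine ⟨?_, ?_, ?_, ?_, ?_, ?_, ?_⟩
  · unfold Matrix.IsSymm; simp [a0.eq, b0.eq]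
  all_goals simp [*]

theorem parallel {c d : Fin 6 → ℝ} (h : ∀ w, w ⬝ᵥ c = 0 → w ⬝ᵥ d = 0) : ∃ k : ℝ, d = k • c := by
  by_cases hc : c = 0
  · have := h d (by simp [hc])
    rw [dotProduct_self_eq_zero] at this
    exact ⟨0, by simp [this]⟩
  · have hcc : c ⬝ᵥ c ≠ 0 := fun h => hc (dotProduct_self_eq_zero.1 h)
    refine ⟨(d ⬝ᵥ c) / (c ⬝ᵥ c), ?_⟩
    have h1 : (d - ((d ⬝ᵥ c) / (c ⬝ᵥ c)) • c) ⬝ᵥ c = 0 := by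
      rw [sub_dotProduct, smul_dotProduct, smul_eq_mul]; field_simp; ring
    have h2 := h _ h1
    have h3 : (d - ((d ⬝ᵥ c) / (c ⬝ᵥ c)) • c) ⬝ᵥ (d - ((d ⬝ᵥ c) / (c ⬝ᵥ c)) • c) = 0 := by
      rw [dotProduct_sub, dotProduct_smul, h1, h2]; simp
    rw [dotProduct_self_eq_zero] at h3
    exact sub_eq_zero.1 h3

theorem minr_parallel {c : Fin 6 → ℝ} {w : Fin 6 → ℂ} (hw : minr w = 0) (k : ℂ) (hk : k ≠ 0)
    (h : ∀ i, w i = k * c i) : minr c = 0 := by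
  have key : ∀ i, ((minr c i : ℝ) : ℂ) * k ^ 2 = minr w i := by
    intro i
    fin_cases i <;> simp [minr, h] <;> ring
  ext i
  have := key i
  rw [hw] at this
  simpa [hk] using this

theorem hilbert_dual {f : MvPolynomial (Fin 3) ℝ} (hf : IsSmooth f) (hp : IsPsd f)
    {G : Matrix (Fin 6) (Fin 6) ℝ} (hG : ∀ a, mon a ⬝ᵥ G *ᵥ mon a = eval a f)
    (n : ℕ) : ∀ H : Matrix (Fin 6) (Fin 6) ℝ, H.PosSemidef → Hank H → H ≠ 0 →
      6 - Module.finrank ℝ (LinearMap.ker H.mulVecLin) = n → 0 < pr H G := by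
  induction n using Nat.strong_induction_on with
  | _ n ih =>
  intro H hH hHk h0 hn
  have IH : ∀ H' : Matrix (Fin 6) (Fin 6) ℝ, H'.PosSemidef → Hank H' →
      LinearMap.ker H.mulVecLin < LinearMap.ker H'.mulVecLin → H' = 0 ∨ 0 < pr H' G := by
    intro H' h1 h2 h3
    by_cases h4 : H' = 0
    · exact Or.inl h4
    · right
      have := Submodule.finrank_lt_finrank_of_lt h3
      have h5 : Module.finrank ℝ (LinearMap.ker H'.mulVecLin) ≤ 6 := by
        have := Submodule.finrank_le (LinearMap.ker H'.mulVecLin)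
        simpa using this
      exact ih _ (by omega) H' h1 h2 h4 rfl
  obtain ⟨z, hz, hzq⟩ := macaulay_real hHk h0
  set c : Fin 6 → ℝ := fun i => (mon z i).re with hc
  set d : Fin 6 → ℝ := fun i => (mon z i).im with hd
  have hcd : ∀ q, H *ᵥ q = 0 → q ⬝ᵥ c = 0 ∧ q ⬝ᵥ d = 0 := by
    intro q hq
    have := hzq q hq
    constructor
    · have := congrArg Complex.re this
      simpa [dotProduct, hc] using this
    · have := congrArg Complex.im this
      simpa [dotProduct, hd] using this
  have caseB : ∀ v : Fin 6 → ℝ, v ≠ 0 → minr v = 0 → (∀ q, H *ᵥ q = 0 → q ⬝ᵥ v = 0) →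
      0 < pr H G := by
    intro v hv hmv hqv
    obtain ⟨p, k, hp0, hk, hpk⟩ := rank_one hv hmv
    have hfp := f_pos hf hp hp0
    rw [← hG] at hfp
    have hDk : Hank (vecMulVec (mon p) (mon p)) := by
      refine ⟨?_, ?_, ?_, ?_, ?_, ?_, ?_⟩
      · unfold Matrix.IsSymm; rw [transpose_vecMulVec]
      all_goals simp [vecMulVec_apply, mon]; ring
    obtain ⟨t, ht, h1, h2⟩ := psd_drop (D := (-1 : ℝ) • vecMulVec (mon p) (mon p)) hH
      (by unfold Matrix.IsSymm; simp [hDk.1.eq])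
      (by
        intro x hx
        rw [smul_mulVec, vecMulVec_mulVec, hpk, dotProduct_comm, dotProduct_smul, hqv x hx]
        simp)
      (mon p)
      (by
        rw [smul_mulVec, vecMulVec_mulVec]
        have : 0 < mon p ⬝ᵥ mon p :=
          lt_of_le_of_ne (dot_self_nonneg _) (Ne.symm fun h => mon_ne hp0 (dotProduct_self_eq_zero.1 h))
        simp only [op_smul_eq_smul, dotProduct_smul, smul_eq_mul]
        nlinarith)
    have e : H = (H + t • (-1 : ℝ) • vecMulVec (mon p) (mon p)) + t • vecMulVec (mon p) (mon p) := by
      simp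
    have h3 := IH _ h1 (by rw [smul_smul]; exact hHk.add hDk _) h2
    rw [e, pr_add, pr_smul, pr_vec]
    rcases h3 with h3 | h3
    · rw [h3]
      have : pr 0 G = 0 := by simp [pr]
      rw [this]; positivity
    · positivity
  have hmz := minr_mon z
  have hmz0 := mon_ne hz
  by_cases hB1 : ∀ w, w ⬝ᵥ c = 0 → w ⬝ᵥ d = 0
  · obtain ⟨k, hk⟩ := parallel hB1
    have hw : ∀ i, mon z i = (1 + k * Complex.I) * (c i : ℂ) := by
      intro i
      have := congrFun hk i
      simp only [hc, hd, Pi.smul_apply, smul_eq_mul] at this ⊢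
      apply Complex.ext <;> simp [this]
    refine caseB c ?_ (minr_parallel hmz _ ?_ hw) fun q hq => (hcd q hq).1
    · intro h; apply hmz0; ext i; rw [hw, h]; simp
    · intro h; have := congrArg Complex.re h; simp at this
  by_cases hB2 : ∀ w, w ⬝ᵥ d = 0 → w ⬝ᵥ c = 0
  · obtain ⟨k, hk⟩ := parallel hB2
    have hw : ∀ i, mon z i = (k + Complex.I) * (d i : ℂ) := by
      intro i
      have := congrFun hk i
      simp only [hc, hd, Pi.smul_apply, smul_eq_mul] at this ⊢
      apply Complex.ext <;> simp [this]
    refine caseB d ?_ (minr_parallel hmz _ ?_ hw) fun q hq => (hcd q hq).2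
    · intro h; apply hmz0; ext i; rw [hw, h]; simp
    · intro h; have := congrArg Complex.im h; simp at this
  push Not at hB1 hB2
  obtain ⟨w, hwc, hwd⟩ := hB1
  obtain ⟨w', hwd', hwc'⟩ := hB2
  set D := vecMulVec c c - vecMulVec d d with hD
  have hDk : Hank D := by
    have hre : ∀ i j k l : Fin 6, mon z i * mon z j = mon z k * mon z l → D i j = D k l := by
      intro i j k l h
      have := congrArg Complex.re h
      simpa [hD, vecMulVec_apply, hc, hd] using this
    refine ⟨?_, ?_, ?_, ?_, ?_, ?_, ?_⟩
    · unfold Matrix.IsSymm; rw [hD, transpose_sub, transpose_vecMulVec, transpose_vecMulVec]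
    all_goals refine hre _ _ _ _ ?_; simp [mon]; ring
  have hDx : ∀ x, D *ᵥ x = (x ⬝ᵥ c) • c - (x ⬝ᵥ d) • d := by
    intro x
    rw [hD, sub_mulVec, vecMulVec_mulVec, vecMulVec_mulVec, dotProduct_comm c, dotProduct_comm d]
    simp
  have hDxx : ∀ x, x ⬝ᵥ D *ᵥ x = (x ⬝ᵥ c) ^ 2 - (x ⬝ᵥ d) ^ 2 := by
    intro x
    rw [hDx, dotProduct_sub, dotProduct_smul, dotProduct_smul]; simp; ring
  have hDker : ∀ x, H *ᵥ x = 0 → D *ᵥ x = 0 := by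
    intro x hx; rw [hDx, (hcd x hx).1, (hcd x hx).2]; simp
  obtain ⟨t, ht, h1, h2⟩ := psd_drop hH hDk.1 hDker w (by
    rw [hDxx, hwc]; have : 0 < (w ⬝ᵥ d) ^ 2 := by positivity
    linarith)
  obtain ⟨t', ht', h1', h2'⟩ := psd_drop (D := (-1 : ℝ) • D) hH
    (by unfold Matrix.IsSymm; simp [hDk.1.eq]) (fun x hx => by
      rw [smul_mulVec, hDker x hx]; simp) w' (by
    rw [smul_mulVec, dotProduct_smul, hDxx, hwd']
    have : 0 < (w' ⬝ᵥ c) ^ 2 := by positivity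
    simp; linarith)
  have k1 := IH _ h1 (hHk.add hDk t) h2
  have k2 := IH _ h1' (by rw [smul_smul]; exact hHk.add hDk _) h2'
  have e : (t + t') • H = t' • (H + t • D) + t • (H + t' • (-1 : ℝ) • D) := by
    simp only [smul_add, add_smul, smul_smul]
    have : t * (t' * -1) = - (t' * t) := by ring
    rw [this, neg_smul]; abel
  have e2 : (t + t') * pr H G = t' * pr (H + t • D) G + t * pr (H + t' • (-1 : ℝ) • D) G := by
    rw [← pr_smul, e, pr_add, pr_smul, pr_smul]
  have z0 : pr 0 G = 0 := by simp [pr]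
  have : 0 < (t + t') * pr H G := by
    rcases k1 with k1 | k1
    · rcases k2 with k2 | k2
      · exfalso; rw [k1, k2] at e
        have htt : t + t' ≠ 0 := by linarith
        simp [htt, h0] at e
      · rw [e2, k1, z0]; simp only [mul_zero, zero_add]; exact mul_pos ht k2
    · rcases k2 with k2 | k2
      · rw [e2, k2, z0]; simp; positivity
      · rw [e2]; positivity
  exact pos_of_mul_pos_right this (by positivity)

theorem isOpen_pos : IsOpen {M : Matrix (Fin 6) (Fin 6) ℝ | ∀ x ≠ 0, 0 < x ⬝ᵥ M *ᵥ x} := by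
  have e : {M : Matrix (Fin 6) (Fin 6) ℝ | ∀ x ≠ 0, 0 < x ⬝ᵥ M *ᵥ x} =
      {M | ∀ x ∈ Metric.sphere (0 : Fin 6 → ℝ) 1, 0 < x ⬝ᵥ M *ᵥ x} := by
    ext M; constructor
    · intro h x hx
      exact h x (by rintro rfl; simp at hx)
    · intro h x hx
      have hnv : 0 < ‖x‖ := norm_pos_iff.2 hx
      have h2 := h (‖x‖⁻¹ • x) (by simp [norm_smul, hnv.ne'])
      rw [mulVec_smul, dotProduct_smul, smul_dotProduct, smul_eq_mul, smul_eq_mul] at h2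
      have h3 : 0 < ‖x‖⁻¹ := by positivity
      exact pos_of_mul_pos_right (pos_of_mul_pos_right h2 h3.le) h3.le
  rw [e, isOpen_iff_mem_nhds]
  intro M hM
  refine (isCompact_sphere (0 : Fin 6 → ℝ) 1).eventually_forall_of_forall_eventually fun x hx => ?_
  have hcont : Continuous fun p : Matrix (Fin 6) (Fin 6) ℝ × (Fin 6 → ℝ) => p.2 ⬝ᵥ p.1 *ᵥ p.2 := by
    fun_prop
  exact hcont.continuousAt.eventually (lt_mem_nhds (hM x hx))

theorem gram_nonempty {f : MvPolynomial (Fin 3) ℝ} (hf : IsSmooth f) (hp : IsPsd f)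
    {G : Matrix (Fin 6) (Fin 6) ℝ} (hs : G.IsSymm)
    (hG : ∀ a, mon a ⬝ᵥ G *ᵥ mon a = eval a f) : ∃ b, (G + W b).PosSemidef := by
  by_contra hno
  set s := {M : Matrix (Fin 6) (Fin 6) ℝ | ∀ x ≠ 0, 0 < x ⬝ᵥ M *ᵥ x} with hsdef
  set t : Set (Matrix (Fin 6) (Fin 6) ℝ) := Set.range fun b => G + W b with htdef
  have hsc : Convex ℝ s := by
    intro A hA B hB α β hα hβ hαβ x hx
    rw [add_mulVec, smul_mulVec, smul_mulVec, dotProduct_add, dotProduct_smul, dotProduct_smul]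
    have h1 := hA x hx
    have h2 := hB x hx
    rcases hα.eq_or_lt with h | h
    · have : β = 1 := by linarith
      simp [← h, this, h2]
    · simp only [smul_eq_mul]; positivity
  have htc : Convex ℝ t := by
    rintro _ ⟨b, rfl⟩ _ ⟨c, rfl⟩ α β hα hβ hαβ
    refine ⟨α • b + β • c, ?_⟩
    simp only [W_add, W_smul, smul_add]
    nth_rewrite 1 [← one_smul ℝ G]
    rw [← hαβ, add_smul]; abel
  have hdis : Disjoint s t := by
    rw [Set.disjoint_left]
    rintro _ hM ⟨b, rfl⟩
    refine hno ⟨b, (psd_iff _).2 ⟨by unfold Matrix.IsSymm; simp [hs.eq, (W_symm b).eq], fun x => ?_⟩⟩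
    by_cases hx : x = 0
    · simp [hx]
    · exact (hM x hx).le
  obtain ⟨φ, u, h1, h2⟩ := geometric_hahn_banach_open hsc isOpen_pos htc hdis
  have hone : (1 : Matrix (Fin 6) (Fin 6) ℝ) ∈ s := by
    intro x hx
    rw [one_mulVec]
    exact lt_of_le_of_ne (dot_self_nonneg _) (Ne.symm fun h => hx (dotProduct_self_eq_zero.1 h))
  have hscale : ∀ M ∈ s, ∀ r : ℝ, 0 < r → r • M ∈ s := by
    intro M hM r hr x hx
    rw [smul_mulVec, dotProduct_smul, smul_eq_mul]
    exact mul_pos hr (hM x hx)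
  have hu : 0 ≤ u := by
    by_contra hu; push Not at hu
    have hφ1 := h1 1 hone
    have := h1 _ (hscale 1 hone (u / (2 * φ 1)) (div_pos_of_neg_of_neg hu (by linarith)))
    rw [map_smul, smul_eq_mul] at this
    have e : u / (2 * φ 1) * φ 1 = u / 2 := by
      have : φ 1 ≠ 0 := by linarith
      field_simp
    linarith
  have hs0 : ∀ M ∈ s, φ M ≤ 0 := by
    intro M hM
    by_contra h; push Not at h
    have := h1 _ (hscale M hM ((u + 1) / φ M) (by positivity))
    rw [map_smul, smul_eq_mul] at this
    have e : (u + 1) / φ M * φ M = u + 1 := by field_simp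
    linarith
  have hpsd : ∀ M : Matrix (Fin 6) (Fin 6) ℝ, (∀ x, 0 ≤ x ⬝ᵥ M *ᵥ x) → φ M ≤ 0 := by
    intro M hM
    have : ∀ ε : ℝ, 0 < ε → φ M + ε * φ 1 ≤ 0 := by
      intro ε hε
      have := hs0 (M + ε • 1) (by
        intro x hx
        have h1 := hM x
        have h2 := hscale 1 hone ε hε x hx
        rw [add_mulVec, dotProduct_add]; linarith)
      simpa using this
    by_contra h; push Not at h
    have h3 := this (φ M / (2 * (|φ 1| + 1))) (by positivity)
    have h4 : φ M / (2 * (|φ 1| + 1)) * (2 * (|φ 1| + 1)) = φ M := by field_simp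
    have h5 : 0 < φ M / (2 * (|φ 1| + 1)) := by positivity
    nlinarith [neg_abs_le (φ 1)]
  have hW : ∀ b, φ (W b) = 0 := by
    intro b
    have key : ∀ r : ℝ, u ≤ φ G + r * φ (W b) := by
      intro r
      have := h2 _ ⟨r • b, rfl⟩
      simpa [W_smul] using this
    by_contra h
    have := key ((u - φ G - 1) / φ (W b))
    have e : (u - φ G - 1) / φ (W b) * φ (W b) = u - φ G - 1 := by field_simp
    linarith
  have hG0 : u ≤ φ G := by
    have := h2 _ ⟨0, rfl⟩
    have e : W (0 : Fin 6 → ℝ) = 0 := by simpa using W_smul (0 : ℝ) (0 : Fin 6 → ℝ)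
    simpa [e] using this
  -- representing matrix
  set P : Matrix (Fin 6) (Fin 6) ℝ := fun i j => φ (Matrix.single i j 1) with hP
  have hφ : ∀ M, φ M = ∑ i, ∑ j, M i j * P i j := by
    intro M
    conv_lhs => rw [matrix_eq_sum_single M]
    simp only [map_sum]
    refine Finset.sum_congr rfl fun i _ => Finset.sum_congr rfl fun j _ => ?_
    have : Matrix.single i j (M i j) = M i j • Matrix.single i j (1 : ℝ) := by simp
    rw [this, map_smul, smul_eq_mul]
  set H := (-1 / 2 : ℝ) • (P + Pᵀ) with hH
  have hpr : ∀ M : Matrix (Fin 6) (Fin 6) ℝ, M.IsSymm → pr H M = - φ M := by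
    intro M hM
    have e1 : pr P M = φ M := by
      rw [hφ, pr]; refine Finset.sum_congr rfl fun i _ => Finset.sum_congr rfl fun j _ => by ring
    have e2 : pr Pᵀ M = φ M := by
      rw [hφ, pr, Finset.sum_comm]
      refine Finset.sum_congr rfl fun i _ => Finset.sum_congr rfl fun j _ => ?_
      rw [transpose_apply, hM.apply]; ring
    rw [hH, pr_smul, pr_add, e1, e2]; ring
  have hHs : H.IsSymm := by unfold Matrix.IsSymm; simp [hH, add_comm]
  have hHp : H.PosSemidef := by
    refine (psd_iff _).2 ⟨hHs, fun x => ?_⟩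
    have e : x ⬝ᵥ H *ᵥ x = pr H (vecMulVec x x) := by
      rw [← pr_vec]; simp only [pr]
      refine Finset.sum_congr rfl fun i _ => Finset.sum_congr rfl fun j _ => by ring
    rw [e, hpr _ (by unfold Matrix.IsSymm; rw [transpose_vecMulVec])]
    have := hpsd (vecMulVec x x) (fun y => by
      rw [vecMulVec_mulVec]
      rw [op_smul_eq_smul, dotProduct_smul, dotProduct_comm y x]
      exact mul_self_nonneg _)
    linarith
  have hHW : ∀ b, pr H (W b) = 0 := fun b => by rw [hpr _ (W_symm b), hW, neg_zero]
  have hHk : Hank H := by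
    have hss : ∀ i j, H i j = H j i := fun i j => congrFun (congrFun hHs.eq j) i
    have a0 := hHW ![1, 0, 0, 0, 0, 0]
    have a1 := hHW ![0, 1, 0, 0, 0, 0]
    have a2 := hHW ![0, 0, 1, 0, 0, 0]
    have a3 := hHW ![0, 0, 0, 1, 0, 0]
    have a4 := hHW ![0, 0, 0, 0, 1, 0]
    have a5 := hHW ![0, 0, 0, 0, 0, 1]
    simp only [pr, W, Fin.sum_univ_succ] at a0 a1 a2 a3 a4 a5
    simp at a0 a1 a2 a3 a4 a5
    refine ⟨hHs, ?_, ?_, ?_, ?_, ?_, ?_⟩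
    · linarith [hss 0 1]
    · linarith [hss 0 2]
    · linarith [hss 1 2]
    · linarith [hss 0 5, hss 3 4]
    · linarith [hss 1 4, hss 3 5]
    · linarith [hss 2 3, hss 4 5]
  have hH0 : H ≠ 0 := by
    intro h
    have e1 := hpr 1 (by unfold Matrix.IsSymm; simp)
    have e2 := hpr G hs
    have e3 := h1 1 hone
    rw [h] at e1 e2
    have : ∀ M, pr 0 M = 0 := fun M => by simp [pr]
    rw [this] at e1 e2
    linarith
  have := hilbert_dual hf hp hG _ H hHp hHk hH0 rfl
  rw [hpr G hs] at this
  linarith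

theorem mem_gram' {G : Matrix (Fin 6) (Fin 6) ℝ} {f : MvPolynomial (Fin 3) ℝ}
    (hG : ∀ a, mon a ⬝ᵥ G *ᵥ mon a = eval a f) (b : Fin 6 → ℝ) (h : (G + W b).PosSemidef) :
    G + W b ∈ GramSpectrahedron f := by
  refine mem_gram.2 ⟨h, fun a => ?_⟩
  rw [add_mulVec, dotProduct_add, hG, W_mon, add_zero]

theorem gram_symm {G : Matrix (Fin 6) (Fin 6) ℝ} {f : MvPolynomial (Fin 3) ℝ}
    (hG : G ∈ GramSpectrahedron f) : G.IsSymm := ((psd_iff G).1 hG.1).1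

theorem minr_ne_complex {f : MvPolynomial (Fin 3) ℝ} (hf : IsSmooth f)
    {G : Matrix (Fin 6) (Fin 6) ℝ} (hG : G ∈ GramSpectrahedron f) {u : Fin 6 → ℂ} (hu : u ≠ 0)
    (hGu : ∀ i, ∑ j, (G i j : ℂ) * u j = 0) : minr u ≠ 0 := by
  intro h
  obtain ⟨p, k, hp, hk, hpk⟩ := rank_one hu h
  refine hp (sing hf (gram_symm hG) (mem_gram.1 hG).2 p fun i => ?_)
  rw [hpk]
  simp only [Pi.smul_apply, smul_eq_mul]
  calc _ = k * ∑ j, (G i j : ℂ) * u j := by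
        rw [Finset.mul_sum]; exact Finset.sum_congr rfl fun j _ => by ring
    _ = 0 := by rw [hGu, mul_zero]

theorem minr_ne {f : MvPolynomial (Fin 3) ℝ} (hf : IsSmooth f)
    {G : Matrix (Fin 6) (Fin 6) ℝ} (hG : G ∈ GramSpectrahedron f) {u : Fin 6 → ℝ} (hu : u ≠ 0)
    (hGu : G *ᵥ u = 0) : minr u ≠ 0 := by
  intro h
  refine minr_ne_complex hf hG (u := fun i => (u i : ℂ)) ?_ ?_ ?_
  · intro h; apply hu; ext i; simpa using congrFun h i
  · intro i
    have := congrFun hGu i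
    simp only [mulVec, dotProduct, Pi.zero_apply] at this
    exact_mod_cast this
  · ext i
    have := congrFun h i
    fin_cases i <;> simp [minr] at this ⊢ <;> exact_mod_cast this

theorem psd_entry {A : Matrix (Fin 6) (Fin 6) ℝ} (hA : A.PosSemidef) (i j : Fin 6) :
    2 * |A i j| ≤ A i i + A j j := by
  obtain ⟨hs, hp⟩ := (psd_iff A).1 hA
  have h1 := hp (Pi.single i 1 + Pi.single j 1)
  have h2 := hp (Pi.single i 1 - Pi.single j 1)
  have e : A j i = A i j := congrFun (congrFun hs.eq i) j
  simp [mulVec_add, mulVec_sub] at h1 h2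
  have : |A i j| ≤ (A i i + A j j) / 2 := abs_le.2 ⟨by linarith, by linarith⟩
  linarith

theorem gram_max {f : MvPolynomial (Fin 3) ℝ} (hf : IsSmooth f) (hp : IsPsd f)
    (hhom : f.IsHomogeneous 4) : ∃ G ∈ GramSpectrahedron f,
      ∀ c : Fin 6 → ℝ, (G + W c).PosSemidef → c 0 + c 1 + c 2 ≤ 0 := by
  obtain ⟨G, hs, hG⟩ := exists_gram f hhom
  obtain ⟨b0, hb0⟩ := gram_nonempty hf hp hs hG
  set S := {b : Fin 6 → ℝ | (G + W b).PosSemidef} with hS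
  have hWc : Continuous fun b : Fin 6 → ℝ => G + W b := by
    have : Continuous fun b : Fin 6 → ℝ => W b := by
      refine continuous_matrix fun i j => ?_
      fin_cases i <;> fin_cases j <;> simp [W] <;> fun_prop
    fun_prop
  have hcl : IsClosed S := psd_closed.preimage hWc
  set g := ∑ i, ∑ j, |G i j| with hg
  have hgij : ∀ i j, |G i j| ≤ g := by
    intro i j
    calc |G i j| ≤ ∑ j, |G i j| :=
          Finset.single_le_sum (f := fun j => |G i j|) (fun _ _ => abs_nonneg _) (Finset.mem_univ j)
      _ ≤ g := Finset.single_le_sum (f := fun i => ∑ j, |G i j|)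
          (fun _ _ => Finset.sum_nonneg fun _ _ => abs_nonneg _) (Finset.mem_univ i)
  have hg0 : 0 ≤ g := (abs_nonneg _).trans (hgij 0 0)
  have hsub : S ⊆ Set.Icc (fun _ => -(10 * g)) (fun _ => 10 * g) := by
    intro b hb
    have hd := fun i j => psd_entry hb i j
    have d0 := hd 0 1
    have d1 := hd 0 2
    have d2 := hd 1 2
    have d3 := hd 0 5
    have d4 := hd 1 4
    have d5 := hd 2 3
    simp [W] at d0 d1 d2 d3 d4 d5
    have key : ∀ x y m : ℝ, |x| ≤ g → 2 * |x + y| ≤ m → 2 * |y| ≤ 2 * g + m := by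
      intro x y m hx hy
      have : |y| ≤ |x + y| + |x| := by
        have := abs_sub (x + y) x
        simpa using this
      linarith
    have e0 := key _ _ _ (hgij _ _) d0
    have e1 := key _ _ _ (hgij _ _) d1
    have e2 := key _ _ _ (hgij _ _) d2
    have e3 := key _ _ _ (hgij _ _) d3
    have e4 := key _ _ _ (hgij _ _) d4
    have e5 := key _ _ _ (hgij _ _) d5
    have q := fun i => (le_abs_self (G i i)).trans (hgij i i)
    have q0 := q 0
    have q1 := q 1
    have q2 := q 2
    have q3 := q 3
    have q4 := q 4
    have q5 := q 5
    have n0 := neg_abs_le (b 0)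
    have n1 := neg_abs_le (b 1)
    have n2 := neg_abs_le (b 2)
    have : ∀ i, |b i| ≤ 10 * g := by
      intro i; fin_cases i <;> simp <;> linarith
    exact ⟨fun i => (abs_le.1 (this i)).1, fun i => (abs_le.1 (this i)).2⟩
  have hcomp : IsCompact S := isCompact_Icc.of_isClosed_subset hcl hsub
  obtain ⟨b, hb, hmax⟩ := hcomp.exists_isMaxOn ⟨b0, hb0⟩
    (f := fun b => b 0 + b 1 + b 2) (by fun_prop)
  refine ⟨G + W b, mem_gram' hG b hb, fun c hc => ?_⟩
  have := hmax (show b + c ∈ S by rw [hS, Set.mem_setOf_eq, W_add, ← add_assoc]; exact hc)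
  simp at this
  linarith

theorem dir_exists {C : Fin 6 → ℝ} (hC : ¬ (C 0 = C 1 ∧ C 0 = C 2 ∧ C 0 ≤ 0 ∧ C 3 = 0 ∧ C 4 = 0 ∧ C 5 = 0)) :
    ∃ c : Fin 6 → ℝ, 0 < c 0 + c 1 + c 2 ∧ 0 < c ⬝ᵥ C := by
  set S := C 0 + C 1 + C 2 with hS
  by_cases hS0 : 0 < S
  · refine ⟨![1, 1, 1, 0, 0, 0], by simp; norm_num, ?_⟩
    simp [dotProduct, Fin.sum_univ_succ]; linarith
  · push Not at hS0
    set Q := 3 * (C ⬝ᵥ C) - S ^ 2 with hQ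
    have e : Q = (C 0 - C 1) ^ 2 + (C 0 - C 2) ^ 2 + (C 1 - C 2) ^ 2 + 3 * C 3 ^ 2 + 3 * C 4 ^ 2
        + 3 * C 5 ^ 2 := by
      simp [hQ, hS, dotProduct, Fin.sum_univ_succ]; ring
    have hQ0 : 0 < Q := by
      by_contra h; push Not at h
      apply hC
      have a1 : (C 0 - C 1) ^ 2 = 0 := by
        nlinarith [sq_nonneg (C 0 - C 1), sq_nonneg (C 0 - C 2), sq_nonneg (C 1 - C 2), sq_nonneg (C 3), sq_nonneg (C 4), sq_nonneg (C 5)]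
      have a2 : (C 0 - C 2) ^ 2 = 0 := by
        nlinarith [sq_nonneg (C 0 - C 1), sq_nonneg (C 0 - C 2), sq_nonneg (C 1 - C 2), sq_nonneg (C 3), sq_nonneg (C 4), sq_nonneg (C 5)]
      have a3 : C 3 ^ 2 = 0 := by
        nlinarith [sq_nonneg (C 0 - C 1), sq_nonneg (C 0 - C 2), sq_nonneg (C 1 - C 2), sq_nonneg (C 3), sq_nonneg (C 4), sq_nonneg (C 5)]
      have a4 : C 4 ^ 2 = 0 := by
        nlinarith [sq_nonneg (C 0 - C 1), sq_nonneg (C 0 - C 2), sq_nonneg (C 1 - C 2), sq_nonneg (C 3), sq_nonneg (C 4), sq_nonneg (C 5)]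
      have a5 : C 5 ^ 2 = 0 := by
        nlinarith [sq_nonneg (C 0 - C 1), sq_nonneg (C 0 - C 2), sq_nonneg (C 1 - C 2), sq_nonneg (C 3), sq_nonneg (C 4), sq_nonneg (C 5)]
      simp only [pow_eq_zero_iff (two_ne_zero), sub_eq_zero] at a1 a2 a3 a4 a5
      exact ⟨a1, a2, by linarith, a3, a4, a5⟩
    obtain ⟨δ, hδ⟩ : ∃ δ, δ = Q / (2 * (|S| + 1)) := ⟨_, rfl⟩
    have hδ0 : 0 < δ := by rw [hδ]; positivity
    have hδ1 : δ * (2 * (|S| + 1)) = Q := by rw [hδ]; field_simp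
    refine ⟨![3 * C 0 - S + δ, 3 * C 1 - S + δ, 3 * C 2 - S + δ, 3 * C 3, 3 * C 4, 3 * C 5], ?_, ?_⟩
    · simp; linarith
    · have : (![3 * C 0 - S + δ, 3 * C 1 - S + δ, 3 * C 2 - S + δ, 3 * C 3, 3 * C 4, 3 * C 5] :
          Fin 6 → ℝ) ⬝ᵥ C = Q + δ * S := by
        simp [hQ, hS, dotProduct, Fin.sum_univ_succ]; ring
      rw [this]
      nlinarith [neg_abs_le S]

theorem corank_two {f : MvPolynomial (Fin 3) ℝ} (hf : IsSmooth f) (hp : IsPsd f)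
    (hhom : f.IsHomogeneous 4) : ∃ G ∈ GramSpectrahedron f,
      2 ≤ Module.finrank ℝ (LinearMap.ker G.mulVecLin) := by
  obtain ⟨G, hG, hmax⟩ := gram_max hf hp hhom
  refine ⟨G, hG, ?_⟩
  by_contra hlt
  have hle : Module.finrank ℝ (LinearMap.ker G.mulVecLin) ≤ 1 := by omega
  rw [finrank_le_one_iff] at hle
  obtain ⟨⟨u, hu⟩, hspan⟩ := hle
  rw [LinearMap.mem_ker, mulVecLin_apply] at hu
  have hspan' : ∀ x, G *ᵥ x = 0 → ∃ k : ℝ, x = k • u := by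
    intro x hx
    obtain ⟨k, hk⟩ := hspan ⟨x, by rwa [LinearMap.mem_ker, mulVecLin_apply]⟩
    exact ⟨k, by simpa using (congrArg Subtype.val hk).symm⟩
  obtain ⟨c, hc1, hc2⟩ : ∃ c : Fin 6 → ℝ, 0 < c 0 + c 1 + c 2 ∧ (u ≠ 0 → 0 < c ⬝ᵥ minr u) := by
    by_cases hu0 : u = 0
    · exact ⟨![1, 1, 1, 0, 0, 0], by simp; norm_num, fun h => absurd hu0 h⟩
    · obtain ⟨c, h1, h2⟩ := dir_exists (C := minr u) (by
        rintro ⟨h1, h2, h3, h4, h5, h6⟩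
        refine minr_ne hf hG hu0 hu ?_
        have hid : minr u 0 * minr u 1 * minr u 2 - 2 * minr u 3 * minr u 4 * minr u 5
            - minr u 2 * minr u 3 ^ 2 - minr u 1 * minr u 4 ^ 2 - minr u 0 * minr u 5 ^ 2
            = dt u ^ 2 := by
          simp [minr, dt]; ring
        rw [← h1, ← h2, h4, h5, h6] at hid
        have h7 : 0 ≤ minr u 0 ^ 3 := by nlinarith [sq_nonneg (dt u)]
        have h8 : minr u 0 = 0 := by
          by_contra hne
          have : minr u 0 < 0 := lt_of_le_of_ne h3 hne
          have : minr u 0 ^ 3 < 0 := Odd.pow_neg (by decide) this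
          linarith
        ext i; fin_cases i <;> simp <;> linarith)
      exact ⟨c, h1, fun _ => h2⟩
  obtain ⟨ε, hε, -, hps⟩ := small_pert hG.1 (W_symm c) ⊥ (by simp) (by
    intro x hx hx0
    obtain ⟨k, rfl⟩ := hspan' x hx
    have hk : k ≠ 0 := by rintro rfl; simp at hx0
    have hu0 : u ≠ 0 := by rintro rfl; simp at hx0
    rw [mulVec_smul, dotProduct_smul, smul_dotProduct, W_quad]
    have := hc2 hu0
    simp only [smul_eq_mul]
    have : 0 < k * k := mul_self_pos.2 hk
    nlinarith)
  rw [← W_smul] at hps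
  have := hmax _ hps
  simp at this
  nlinarith

theorem loc_surj {E F : Type*} [NormedAddCommGroup E] [NormedSpace ℝ E] [FiniteDimensional ℝ E]
    [NormedAddCommGroup F] [NormedSpace ℝ F] [FiniteDimensional ℝ F]
    (A : E →ₗ[ℝ] F) (hA : Function.Surjective A) (B : E →ₗ[ℝ] E →ₗ[ℝ] F) (g : F) (U : Set E)
    (hU : U ∈ nhds (0 : E)) : ∃ ε : ℝ, 0 < ε ∧ ∃ v ∈ U, A v + B v v = ε • g := by
  haveI : CompleteSpace E := FiniteDimensional.complete ℝ E
  haveI : CompleteSpace F := FiniteDimensional.complete ℝ F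
  set A' : E →L[ℝ] F := LinearMap.toContinuousLinearMap A with hA'
  set B' : E →L[ℝ] E →L[ℝ] F :=
    LinearMap.toContinuousLinearMap (LinearMap.toContinuousLinearMap.toLinearMap ∘ₗ B) with hB'
  have hB'a : ∀ v w, B' v w = B v w := fun v w => rfl
  have h1 : HasStrictFDerivAt (fun v : E => A' v + B' v v) A' 0 := by
    have h2 : HasStrictFDerivAt (fun v : E => B' v v) (0 : E →L[ℝ] F) 0 := by
      have := B'.hasStrictFDerivAt_of_bilinear (hasStrictFDerivAt_id (0 : E)) (hasStrictFDerivAt_id (0 : E))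
      refine this.congr_fderiv ?_
      refine ContinuousLinearMap.ext fun v => ?_
      simp
    have h := (A'.hasStrictFDerivAt (x := (0 : E))).add h2
    rw [add_zero] at h
    exact h
  have h3 := h1.map_nhds_eq_of_surj (LinearMap.range_eq_top.2 hA)
  have h4 : (fun v : E => A' v + B' v v) '' U ∈ nhds (0 : F) := by
    have : (fun v : E => A' v + B' v v) '' U ∈ nhds (A' 0 + B' 0 0) := by
      rw [← h3]; exact Filter.image_mem_map hU
    simpa using this
  have h5 : Filter.Tendsto (fun ε : ℝ => ε • g) (nhds 0) (nhds 0) := by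
    have : Continuous fun ε : ℝ => ε • g := by fun_prop
    simpa using this.tendsto 0
  have h6 : ∀ᶠ ε : ℝ in nhdsWithin 0 (Set.Ioi 0), ε • g ∈ (fun v : E => A' v + B' v v) '' U :=
    (h5.eventually h4).filter_mono nhdsWithin_le_nhds
  obtain ⟨ε, hε, hε0⟩ := (h6.and self_mem_nhdsWithin).exists
  obtain ⟨v, hv, hve⟩ := hε
  exact ⟨ε, hε0, v, hv, hve⟩

theorem rank_ker (A : Matrix (Fin 6) (Fin 6) ℝ) :
    A.rank + Module.finrank ℝ (LinearMap.ker A.mulVecLin) = 6 := by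
  have := LinearMap.finrank_range_add_finrank_ker A.mulVecLin
  simpa [Matrix.rank] using this

theorem W_zero : W (0 : Fin 6 → ℝ) = 0 := by simpa using W_smul (0 : ℝ) (0 : Fin 6 → ℝ)

/-- tangent map -/
def tang (G : Matrix (Fin 6) (Fin 6) ℝ) :
    ((Fin 6 → Fin 6 → ℝ) × (Fin 6 → Fin 6 → ℝ) × (Fin 6 → ℝ)) →ₗ[ℝ] (Fin 6 → Fin 6 → ℝ) where
  toFun v := ((of v.1)ᵀ * G + G * of v.1 + (of v.2.1 - (of v.2.1)ᵀ) + W v.2.2 :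
    Matrix (Fin 6) (Fin 6) ℝ)
  map_add' v w := by
    simp only [Prod.fst_add, Prod.snd_add, W_add, ← of_add_of, transpose_add, add_mul, mul_add]
    have : ∀ a b : Matrix (Fin 6) (Fin 6) ℝ, (a + b : Fin 6 → Fin 6 → ℝ) = (a + b : Matrix (Fin 6) (Fin 6) ℝ) :=
      fun _ _ => rfl
    erw [this]
    abel
  map_smul' t v := by
    simp only [Prod.smul_fst, Prod.smul_snd, W_smul, ← smul_of, transpose_smul, Matrix.smul_mul, Matrix.mul_smul,
      RingHom.id_apply]
    erw [← smul_sub, ← smul_add, ← smul_add, ← smul_add]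
    rfl

/-- quadratic part -/
def quadm (G : Matrix (Fin 6) (Fin 6) ℝ) :
    ((Fin 6 → Fin 6 → ℝ) × (Fin 6 → Fin 6 → ℝ) × (Fin 6 → ℝ)) →ₗ[ℝ]
    ((Fin 6 → Fin 6 → ℝ) × (Fin 6 → Fin 6 → ℝ) × (Fin 6 → ℝ)) →ₗ[ℝ] (Fin 6 → Fin 6 → ℝ) :=
  LinearMap.mk₂ ℝ (fun v w => ((of v.1)ᵀ * G * of w.1 : Matrix (Fin 6) (Fin 6) ℝ))
    (by
      intro a b c
      simp only [Prod.fst_add, ← of_add_of, transpose_add, add_mul]; rfl)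
    (by
      intro t a b
      simp only [Prod.smul_fst, ← smul_of, transpose_smul, smul_mul]; rfl)
    (by
      intro a b c
      simp only [Prod.fst_add, ← of_add_of, mul_add]; rfl)
    (by
      intro t a b
      simp only [Prod.smul_fst, ← smul_of, Matrix.mul_smul]; rfl)

theorem tang_surj {f : MvPolynomial (Fin 3) ℝ} (hf : IsSmooth f)
    {G : Matrix (Fin 6) (Fin 6) ℝ} (hG : G ∈ GramSpectrahedron f) :
    Function.Surjective (tang G) := by
  rw [← LinearMap.range_eq_top]
  by_contra hne
  obtain ⟨φ, hφ0, hφ⟩ := Submodule.exists_le_ker_of_lt_top _ (lt_top_iff_ne_top.2 hne)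
  have hGs := gram_symm hG
  have hv : ∀ (M K : Matrix (Fin 6) (Fin 6) ℝ) (b : Fin 6 → ℝ),
      φ (Mᵀ * G + G * M + (K - Kᵀ) + W b : Matrix (Fin 6) (Fin 6) ℝ) = 0 := by
    intro M K b
    exact hφ ⟨(M, K, b), rfl⟩
  set P : Matrix (Fin 6) (Fin 6) ℝ := fun i j => φ (Matrix.single i j 1 : Matrix (Fin 6) (Fin 6) ℝ) with hP
  have hφe : ∀ M : Matrix (Fin 6) (Fin 6) ℝ, φ M = pr P M := by
    intro M
    conv_lhs => rw [matrix_eq_sum_single M]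
    have : ∀ i j, φ (Matrix.single i j (M i j) : Matrix (Fin 6) (Fin 6) ℝ) = P i j * M i j := by
      intro i j
      have e : Matrix.single i j (M i j) = M i j • Matrix.single i j (1 : ℝ) := by simp
      rw [e]
      exact (φ.map_smul (M i j) (Matrix.single i j (1 : ℝ) : Matrix (Fin 6) (Fin 6) ℝ)).trans
        (by simp [hP, mul_comm])
    simp only [pr, ← this]
    exact (map_sum φ _ _).trans (Finset.sum_congr rfl fun i _ => map_sum φ _ _)
  have hv' : ∀ (M K : Matrix (Fin 6) (Fin 6) ℝ) (b : Fin 6 → ℝ),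
      pr P (Mᵀ * G + G * M + (K - Kᵀ) + W b) = 0 := by
    intro M K b; rw [← hφe]; exact hv M K b
  have hPs : P.IsSymm := by
    ext i j
    have := hv' 0 (Matrix.single i j 1) 0
    simp only [transpose_zero, zero_mul, mul_zero, zero_add, W_zero, add_zero] at this
    simp [pr, mul_sub, Finset.sum_sub_distrib, Matrix.single_apply, ite_and] at this
    rw [transpose_apply]; linarith
  have hW : ∀ b, pr P (W b) = 0 := by
    intro b
    have := hv' 0 0 b
    simpa using this
  have hPk : Hank P := by
    have hss : ∀ i j, P i j = P j i := fun i j => congrFun (congrFun hPs.eq j) i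
    have a0 := hW ![1, 0, 0, 0, 0, 0]
    have a1 := hW ![0, 1, 0, 0, 0, 0]
    have a2 := hW ![0, 0, 1, 0, 0, 0]
    have a3 := hW ![0, 0, 0, 1, 0, 0]
    have a4 := hW ![0, 0, 0, 0, 1, 0]
    have a5 := hW ![0, 0, 0, 0, 0, 1]
    simp only [pr, W, Fin.sum_univ_succ] at a0 a1 a2 a3 a4 a5
    simp at a0 a1 a2 a3 a4 a5
    refine ⟨hPs, ?_, ?_, ?_, ?_, ?_, ?_⟩
    · linarith [hss 0 1]
    · linarith [hss 0 2]
    · linarith [hss 1 2]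
    · linarith [hss 0 5, hss 3 4]
    · linarith [hss 1 4, hss 3 5]
    · linarith [hss 2 3, hss 4 5]
  have hP0 : P ≠ 0 := by
    intro h
    apply hφ0
    refine LinearMap.ext fun M => ?_
    have := hφe M
    rw [h] at this
    simpa [pr] using this
  have hPG : ∀ k, P *ᵥ (G k) = 0 := by
    intro k
    ext l
    have := hv' (Matrix.single k l 1) 0 0
    simp only [transpose_zero, sub_zero, W_zero, add_zero] at this
    have e1 : pr P ((Matrix.single k l (1 : ℝ))ᵀ * G) = pr P (G * Matrix.single k l 1) := by
      have : ((Matrix.single k l (1 : ℝ))ᵀ * G) = (G * Matrix.single k l 1)ᵀ := by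
        rw [transpose_mul, hGs.eq]
      rw [this]
      simp only [pr]
      rw [Finset.sum_comm]
      refine Finset.sum_congr rfl fun i _ => Finset.sum_congr rfl fun j _ => ?_
      rw [transpose_apply, hPs.apply]
    have e2 : pr P (G * Matrix.single k l 1) = (P *ᵥ (G k)) l := by
      simp only [pr, mulVec, dotProduct, Matrix.mul_apply, Matrix.single_apply]
      simp [ite_and]
      refine Finset.sum_congr rfl fun i _ => ?_
      rw [hPs.apply, hGs.apply]
    have e3 : ∀ A B, pr P (A + B) = pr P A + pr P B := by
      intro A B; simp [pr, mul_add, Finset.sum_add_distrib]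
    rw [e3, e1, e2] at this
    simp only [Pi.zero_apply]; linarith
  obtain ⟨z, hz, hzq⟩ := macaulay_real hPk hP0
  exact hz (sing hf hGs (mem_gram.1 hG).2 z fun i => hzq (G i) (hPG i))

theorem corank_step {f : MvPolynomial (Fin 3) ℝ} (hf : IsSmooth f)
    {G : Matrix (Fin 6) (Fin 6) ℝ} (hG : G ∈ GramSpectrahedron f)
    (hk : 1 ≤ Module.finrank ℝ (LinearMap.ker G.mulVecLin)) :
    ∃ G' ∈ GramSpectrahedron f, Module.finrank ℝ (LinearMap.ker G'.mulVecLin) + 1 =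
      Module.finrank ℝ (LinearMap.ker G.mulVecLin) := by
  have hGs := gram_symm hG
  obtain ⟨g, hg, hg0⟩ : ∃ g, G *ᵥ g = 0 ∧ g ≠ 0 := by
    have hne : LinearMap.ker G.mulVecLin ≠ ⊥ := by
      intro h; rw [h] at hk; simp at hk
    obtain ⟨g, hg, hg0⟩ := Submodule.exists_mem_ne_zero_of_ne_bot hne
    exact ⟨g, by simpa using hg, hg0⟩
  set U : Set ((Fin 6 → Fin 6 → ℝ) × (Fin 6 → Fin 6 → ℝ) × (Fin 6 → ℝ)) :=
    {v | (1 + of v.1 : Matrix (Fin 6) (Fin 6) ℝ).det ≠ 0 ∧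
      g ⬝ᵥ (1 + of v.1 : Matrix (Fin 6) (Fin 6) ℝ).adjugate *ᵥ g ≠ 0} with hUdef
  have hU : U ∈ nhds 0 := by
    have hc0 : Continuous fun v : (Fin 6 → Fin 6 → ℝ) × (Fin 6 → Fin 6 → ℝ) × (Fin 6 → ℝ) =>
        (1 + of v.1 : Matrix (Fin 6) (Fin 6) ℝ) := by
      refine continuous_const.add ?_
      exact continuous_fst
    have hopen : IsOpen U := by
      refine IsOpen.inter ?_ ?_
      · exact isOpen_ne_fun hc0.matrix_det continuous_const
      · exact isOpen_ne_fun (by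
          have := hc0.matrix_adjugate
          fun_prop) continuous_const
    refine hopen.mem_nhds ⟨?_, ?_⟩
    · have : (1 + of (0 : Fin 6 → Fin 6 → ℝ) : Matrix (Fin 6) (Fin 6) ℝ) = 1 := by
        rw [of_zero, add_zero]
      simp only [Prod.fst_zero, this]; simp
    · have : (1 + of (0 : Fin 6 → Fin 6 → ℝ) : Matrix (Fin 6) (Fin 6) ℝ) = 1 := by
        rw [of_zero, add_zero]
      simp only [Prod.fst_zero, this, adjugate_one, one_mulVec]
      exact fun h => hg0 (dotProduct_self_eq_zero.1 h)
  obtain ⟨ε, hε, ⟨M, K, b⟩, hvU, hve⟩ := loc_surj (tang G) (tang_surj hf hG) (quadm G)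
    (-(vecMulVec g g) : Matrix (Fin 6) (Fin 6) ℝ) U hU
  obtain ⟨hdet, hadj⟩ := hvU
  have hve' : ((of M)ᵀ * G + G * of M + (of K - (of K)ᵀ) + W b) + (of M)ᵀ * G * of M
      = ε • (-(vecMulVec g g)) := hve
  set X : Matrix (Fin 6) (Fin 6) ℝ := 1 + of M with hX
  have hXe : Xᵀ * G * X + ε • vecMulVec g g = G + W (-b) - (of K - (of K)ᵀ) := by
    have : Xᵀ * G * X = G + (of M)ᵀ * G + G * of M + (of M)ᵀ * G * of M := by
      rw [hX, transpose_add, transpose_one]; noncomm_ring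
    have hWn : W (-b) = - W b := by simpa using W_smul (-1 : ℝ) b
    rw [this, hWn]
    rw [smul_neg] at hve'
    have h' : ε • vecMulVec g g = -(((of M)ᵀ * G + G * of M + (of K - (of K)ᵀ) + W b)
      + (of M)ᵀ * G * of M) := by rw [hve', neg_neg]
    rw [h']; abel
  have hSs : (Xᵀ * G * X + ε • vecMulVec g g)ᵀ = Xᵀ * G * X + ε • vecMulVec g g := by
    simp [transpose_mul, hGs.eq, transpose_vecMulVec, Matrix.mul_assoc]
  have hK : of K - (of K)ᵀ = 0 := by
    have h1 := hSs
    rw [hXe] at h1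
    simp only [transpose_sub, transpose_add, hGs.eq, (W_symm (-b)).eq, transpose_transpose] at h1
    have h2 := sub_right_injective h1
    ext i j
    have h3 := congrFun (congrFun h2 i) j
    simp at h3 ⊢
    linarith
  rw [hK, sub_zero] at hXe
  have hquad : ∀ x, x ⬝ᵥ (G + W (-b)) *ᵥ x = (X *ᵥ x) ⬝ᵥ G *ᵥ (X *ᵥ x) + ε * (g ⬝ᵥ x) ^ 2 := by
    intro x
    rw [← hXe, add_mulVec, dotProduct_add, smul_mulVec, vecMulVec_mulVec, dotProduct_smul,
      op_smul_eq_smul, dotProduct_smul, dotProduct_comm x g, Matrix.mul_assoc, ← mulVec_mulVec,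
      mulVec_transpose, dotProduct_comm, ← dotProduct_mulVec, ← mulVec_mulVec, dotProduct_comm]
    simp only [smul_eq_mul]; ring
  have hGp := ((psd_iff G).1 hG.1).2
  have hps : (G + W (-b)).PosSemidef := by
    refine (psd_iff _).2 ⟨by unfold Matrix.IsSymm; simp [hGs.eq, (W_symm (-b)).eq], fun x => ?_⟩
    rw [hquad]
    have := hGp (X *ᵥ x)
    positivity
  refine ⟨_, mem_gram' (mem_gram.1 hG).2 _ hps, ?_⟩
  set φ : (Fin 6 → ℝ) →ₗ[ℝ] ℝ := dotProductBilin ℝ ℝ g with hφ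
  have hker : LinearMap.ker (G + W (-b)).mulVecLin = LinearMap.ker (G * X).mulVecLin ⊓ LinearMap.ker φ := by
    ext x
    simp only [LinearMap.mem_ker, Submodule.mem_inf, mulVecLin_apply]
    have hφx : φ x = g ⬝ᵥ x := rfl
    rw [hφx]
    constructor
    · intro h
      have h1 := hquad x
      rw [h, dotProduct_zero] at h1
      have h2 := hGp (X *ᵥ x)
      have h3 : 0 ≤ ε * (g ⬝ᵥ x) ^ 2 := by positivity
      refine ⟨?_, ?_⟩
      · rw [← mulVec_mulVec]
        exact psd_ker hG.1 (by linarith)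
      · have : ε * (g ⬝ᵥ x) ^ 2 = 0 := by linarith
        simpa [hε.ne'] using this
    · rintro ⟨h1, h2⟩
      rw [← mulVec_mulVec] at h1
      refine psd_ker hps ?_
      rw [hquad, h1, h2]; simp
  have hP : Module.finrank ℝ (LinearMap.ker (G * X).mulVecLin)
      = Module.finrank ℝ (LinearMap.ker G.mulVecLin) := by
    have h1 := rank_ker (G * X)
    have h2 := rank_ker G
    have h3 : (G * X).rank = G.rank := rank_mul_eq_left_of_isUnit_det X G (isUnit_iff_ne_zero.2 hdet)
    omega
  rw [← hP, hker]
  set P := LinearMap.ker (G * X).mulVecLin with hPdef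
  have hlt : P ⊓ LinearMap.ker φ < P := by
    refine lt_of_le_of_ne inf_le_left fun h => ?_
    have hx : X.adjugate *ᵥ g ∈ P := by
      rw [hPdef, LinearMap.mem_ker, mulVecLin_apply, mulVec_mulVec, Matrix.mul_assoc,
        mul_adjugate, ← mulVec_mulVec, smul_mulVec, one_mulVec, mulVec_smul, hg, smul_zero]
    rw [← h] at hx
    exact hadj hx.2
  have hlt' := Submodule.finrank_lt_finrank_of_lt hlt
  have hsum := Submodule.finrank_sup_add_finrank_inf_eq P (LinearMap.ker φ)
  have h6 : Module.finrank ℝ (P ⊔ LinearMap.ker φ : Submodule ℝ (Fin 6 → ℝ)) ≤ 6 := by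
    simpa using Submodule.finrank_le (P ⊔ LinearMap.ker φ)
  have h7 : 5 ≤ Module.finrank ℝ (LinearMap.ker φ) := by
    have h := LinearMap.finrank_range_add_finrank_ker φ
    have h' : Module.finrank ℝ (LinearMap.range φ) ≤ 1 := by
      simpa using Submodule.finrank_le (LinearMap.range φ)
    simp at h
    omega
  omega

theorem corank_eq_two {f : MvPolynomial (Fin 3) ℝ} (hf : IsSmooth f) (hp : IsPsd f)
    (hhom : f.IsHomogeneous 4) : ∃ G ∈ GramSpectrahedron f,
      Module.finrank ℝ (LinearMap.ker G.mulVecLin) = 2 := by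
  obtain ⟨G, hG, h2⟩ := corank_two hf hp hhom
  obtain ⟨n, hn⟩ := Nat.exists_eq_add_of_le h2
  clear h2
  induction n generalizing G with
  | zero => exact ⟨G, hG, hn⟩
  | succ n ih =>
    obtain ⟨G', hG', h⟩ := corank_step hf hG (by omega)
    exact ih G' hG' (by omega)

/-- The space of `b` with `W b *ᵥ u = 0`. -/
def Nu (u : Fin 6 → ℝ) : Submodule ℝ (Fin 6 → ℝ) where
  carrier := {b | W b *ᵥ u = 0}
  zero_mem' := by simp [W_zero]
  add_mem' := by
    intro a b ha hb
    simp only [Set.mem_setOf_eq] at *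
    rw [W_add, add_mulVec, ha, hb, add_zero]
  smul_mem' := by
    intro t a ha
    simp only [Set.mem_setOf_eq] at *
    rw [W_smul, smul_mulVec, ha, smul_zero]

theorem mem_Nu {u b : Fin 6 → ℝ} : b ∈ Nu u ↔ W b *ᵥ u = 0 := Iff.rfl

/-- Parametrization. -/
def par (r q : ℝ) : (Fin 3 → ℝ) →ₗ[ℝ] (Fin 6 → ℝ) where
  toFun s := ![r ^ 2 * s 0 + 2 * r * q * s 2 + q ^ 2 * s 1, s 1, s 0,
    -2 * (r * s 2 + q * s 1), -2 * (r * s 0 + q * s 2), -2 * s 2]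
  map_add' s t := by ext i; fin_cases i <;> simp <;> ring
  map_smul' c s := by ext i; fin_cases i <;> simp <;> ring

theorem par_inj (r q : ℝ) : Function.Injective (par r q) := by
  rw [injective_iff_map_eq_zero]
  intro s hs
  have h1 := congrFun hs 1
  have h2 := congrFun hs 2
  have h5 := congrFun hs 5
  simp [par] at h1 h2 h5
  ext i; fin_cases i <;> simp [*]

/-- The constraint functional. -/
def con (u : Fin 6 → ℝ) : (Fin 3 → ℝ) →ₗ[ℝ] ℝ where
  toFun s := u 1 * s 0 + u 0 * s 1 - 2 * u 3 * s 2
  map_add' s t := by simp; ring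
  map_smul' c s := by simp; ring

theorem exists_par {u : Fin 6 → ℝ} (hd : dt u = 0) (hm : u 0 * u 1 - u 3 ^ 2 ≠ 0) :
    ∃ r q : ℝ, u 4 = r * u 0 + q * u 3 ∧ u 5 = r * u 3 + q * u 1 ∧
      u 2 = r ^ 2 * u 0 + 2 * r * q * u 3 + q ^ 2 * u 1 := by
  set d := u 0 * u 1 - u 3 ^ 2 with hdd
  refine ⟨(u 1 * u 4 - u 3 * u 5) / d, (u 0 * u 5 - u 3 * u 4) / d, ?_, ?_, ?_⟩
  · field_simp; rw [hdd]; ring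
  · field_simp; rw [hdd]; ring
  · unfold dt at hd
    field_simp; rw [hdd]
    linear_combination (u 0 * u 1 - u 3 ^ 2) * hd

theorem Nu_eq {u : Fin 6 → ℝ} (hm : u 0 * u 1 - u 3 ^ 2 ≠ 0) {r q : ℝ}
    (h4 : u 4 = r * u 0 + q * u 3) (h5 : u 5 = r * u 3 + q * u 1)
    (h2 : u 2 = r ^ 2 * u 0 + 2 * r * q * u 3 + q ^ 2 * u 1) :
    Nu u = (LinearMap.ker (con u)).map (par r q) := by
  ext b
  rw [mem_Nu, Submodule.mem_map]
  constructor
  · intro h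
    rw [W_mulVec] at h
    have e0 := congrFun h 0
    have e1 := congrFun h 1
    have e2 := congrFun h 2
    have e3 := congrFun h 3
    have e4 := congrFun h 4
    have e5 := congrFun h 5
    simp at e0 e1 e2 e3 e4 e5
    rw [h2, h4, h5] at *
    clear h h2 h4 h5
    refine ⟨![b 2, b 1, -b 5 / 2], ?_, ?_⟩
    · simp [con]; linear_combination e2
    · have k13 : -b 4 / 2 - r * b 2 - q * (-b 5 / 2) = 0 := by
        apply mul_left_cancel₀ hm
        linear_combination (-1/2 : ℝ) * u 0 * (e4 + 2 * r * e2) - 1/2 * u 3 * (e5 + 2 * q * e2)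
      have k23 : -b 3 / 2 - r * (-b 5 / 2) - q * b 1 = 0 := by
        apply mul_left_cancel₀ hm
        linear_combination (-1/2 : ℝ) * u 3 * (e4 + 2 * r * e2) - 1/2 * u 1 * (e5 + 2 * q * e2)
      have k33 : b 0 + r * b 4 + q * b 3 + r ^ 2 * b 2 + q ^ 2 * b 1 - r * q * b 5 = 0 := by
        apply mul_left_cancel₀ hm
        linear_combination u 0 * (e0 + r * e4 + r ^ 2 * e2) +
          1/2 * u 3 * (e3 + r * e5 + q * e4 + 2 * r * q * e2)
      ext i
      fin_cases i <;> simp [par]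
      · linear_combination -k33 - 2 * r * k13 - 2 * q * k23
      · linear_combination 2 * k23
      · linear_combination 2 * k13
      · ring
  · rintro ⟨s, hs, rfl⟩
    simp [con] at hs
    rw [W_mulVec]
    ext i
    fin_cases i <;> simp [par, h2, h4, h5]
    · linear_combination (r ^ 2) * hs
    · linear_combination (q ^ 2) * hs
    · linear_combination hs
    · linear_combination (2 * r * q) * hs
    · linear_combination (-2 * r) * hs
    · linear_combination (-2 * q) * hs

theorem core {u v : Fin 6 → ℝ} (hd : dt u = 0) (hm : u 0 * u 1 - u 3 ^ 2 ≠ 0)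
    (H : ∀ α β : ℂ, minr (fun i => α * (u i : ℂ) + β * (v i : ℂ)) = 0 → α = 0 ∧ β = 0) :
    Module.finrank ℝ (Nu u) = 2 ∧ ∃ b ∈ Nu u, b ⬝ᵥ minr v ≠ 0 := by
  obtain ⟨r, q, h4, h5, h2⟩ := exists_par hd hm
  have hN := Nu_eq hm h4 h5 h2
  have hcon : con u ≠ 0 := by
    intro h
    have a0 := LinearMap.congr_fun h ![1, 0, 0]
    have a1 := LinearMap.congr_fun h ![0, 1, 0]
    have a2 := LinearMap.congr_fun h ![0, 0, 1]
    simp [con] at a0 a1 a2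
    exact hm (by rw [a0, a1, a2]; ring)
  constructor
  · rw [hN, ((LinearMap.ker (con u)).equivMapOfInjective _ (par_inj r q)).symm.finrank_eq]
    have := Module.Dual.finrank_ker_add_one_of_ne_zero (f := con u) hcon
    simp at this
    exact this
  · by_contra hcc
    push Not at hcc
    rw [hN] at hcc
    have hc : ∀ s : Fin 3 → ℝ, con u s = 0 → par r q s ⬝ᵥ minr v = 0 := fun s hs =>
      hcc _ ⟨s, hs, rfl⟩
    set a := v 4 - r * v 0 - q * v 3 with ha
    set b := v 5 - r * v 3 - q * v 1 with hb
    set c := v 2 - 2 * r * v 4 - 2 * q * v 5 + r ^ 2 * v 0 + 2 * r * q * v 3 + q ^ 2 * v 1 with hc'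
    have hc2 : ∀ s : Fin 3 → ℝ, con u s = 0 →
        s 0 * (v 1 * c - b ^ 2) + s 1 * (v 0 * c - a ^ 2) - 2 * s 2 * (v 3 * c - a * b) = 0 := by
      intro s hs
      have := hc s hs
      simp [par, minr, dotProduct, Fin.sum_univ_succ] at this
      rw [ha, hb, hc']
      linear_combination this
    have e1 := hc2 ![u 0, -u 1, 0] (by simp [con]; ring)
    have e2 := hc2 ![2 * u 3, 0, u 1] (by simp [con]; ring)
    have e3 := hc2 ![0, 2 * u 3, u 0] (by simp [con]; ring)
    simp at e1 e2 e3
    obtain ⟨κ, k1, k0, k3⟩ : ∃ κ, v 1 * c - b ^ 2 = κ * u 1 ∧ v 0 * c - a ^ 2 = κ * u 0 ∧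
        v 3 * c - a * b = κ * u 3 := by
      set X := v 1 * c - b ^ 2
      set Y := v 0 * c - a ^ 2
      set Z := v 3 * c - a * b
      -- κ = (u0 X + u1 Y - 2 u3 Z)/ (2 δ)
      refine ⟨(u 0 * X + u 1 * Y - 2 * u 3 * Z) / (2 * (u 0 * u 1 - u 3 ^ 2)), ?_, ?_, ?_⟩
      · field_simp; linear_combination u 1 * e1 - u 3 * e2
      · field_simp; linear_combination -u 0 * e1 - u 3 * e3
      · field_simp; linear_combination -u 0 / 2 * e2 - u 1 / 2 * e3
    by_cases hc0 : c = 0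
    · rw [hc0] at k0 k1 k3
      have hκ : κ = 0 := by
        have : κ ^ 2 * (u 0 * u 1 - u 3 ^ 2) = 0 := by
          linear_combination (-κ * u 1) * k0 + a ^ 2 * k1 + (κ * u 3 - a * b) * k3
        simpa [hm] using this
      rw [hκ] at k0 k1
      have ha0 : a = 0 := by
        have : a ^ 2 = 0 := by linarith
        simpa using this
      have hb0 : b = 0 := by
        have : b ^ 2 = 0 := by linarith
        simpa using this
      rw [ha0] at ha
      rw [hb0] at hb
      rw [hc0] at hc'
      have g4 : v 4 = r * v 0 + q * v 3 := by linarith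
      have g5 : v 5 = r * v 3 + q * v 1 := by linarith
      have g2 : v 2 = r ^ 2 * v 0 + 2 * r * q * v 3 + q ^ 2 * v 1 := by
        rw [g4, g5] at hc'; linarith
      obtain ⟨s, t, hst, hq⟩ := quad_zero (u 0 * u 1 - u 3 ^ 2) (u 0 * v 1 + u 1 * v 0 - 2 * u 3 * v 3)
        (v 0 * v 1 - v 3 ^ 2)
      have := H s t ?_
      · rcases hst with h | h
        · exact h this.1
        · exact h this.2
      · ext i
        fin_cases i <;> simp [minr, h2, h4, h5, g2, g4, g5]
        · linear_combination hq
        · linear_combination q ^ 2 * hq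
        · linear_combination r ^ 2 * hq
        · linear_combination q * hq
        · linear_combination r * hq
        · linear_combination (-r * q : ℂ) * hq
    · have := (H (-κ) c ?_).2
      · exact hc0 (by exact_mod_cast this)
      · have : (fun i => (-κ : ℂ) * (u i : ℂ) + (c : ℂ) * (v i : ℂ)) =
            mon ![(a : ℂ), (b : ℂ), (c : ℂ) + r * a + q * b] := by
          have t : (fun i => -κ * u i + c * v i) = mon ![a, b, c + r * a + q * b] := by
            ext i
            fin_cases i <;> simp [mon]
            · linear_combination k0
            · linear_combination k1
            · rw [h2]; linear_combination r ^ 2 * k0 + 2 * r * q * k3 + q ^ 2 * k1 - c * hc' - 2 * r * c * ha - 2 * q * c * hb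
            · linear_combination k3
            · rw [h4]; linear_combination r * k0 + q * k3 - c * ha
            · rw [h5]; linear_combination r * k3 + q * k1 - c * hb
          ext i
          have := congrArg (fun x : ℝ => (x : ℂ)) (congrFun t i)
          fin_cases i <;> simpa [mon] using this
        rw [this, minr_mon]

theorem core_perm {σ τ : Equiv.Perm (Fin 6)} (hW : ∀ b u : Fin 6 → ℝ, W (b ∘ τ) *ᵥ (u ∘ σ) = (W b *ᵥ u) ∘ σ)
    (hmi : ∀ u : Fin 6 → ℝ, minr (u ∘ σ) = minr u ∘ τ)
    {u v : Fin 6 → ℝ}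
    (h : Module.finrank ℝ (Nu (u ∘ σ)) = 2 ∧ ∃ b ∈ Nu (u ∘ σ), b ⬝ᵥ minr (v ∘ σ) ≠ 0) :
    Module.finrank ℝ (Nu u) = 2 ∧ ∃ b ∈ Nu u, b ⬝ᵥ minr v ≠ 0 := by
  have hmem : ∀ b, b ∈ Nu u ↔ b ∘ τ ∈ Nu (u ∘ σ) := by
    intro b
    rw [mem_Nu, mem_Nu, hW]
    constructor
    · intro h; rw [h]; rfl
    · intro h
      ext i
      simpa using congrFun h (σ.symm i)
  obtain ⟨h1, b, hb, hbv⟩ := h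
  constructor
  · rw [← h1]
    let e : (Fin 6 → ℝ) ≃ₗ[ℝ] (Fin 6 → ℝ) := LinearEquiv.funCongrLeft ℝ ℝ τ
    have he : (Nu u).map (e : (Fin 6 → ℝ) →ₗ[ℝ] (Fin 6 → ℝ)) = Nu (u ∘ σ) := by
      ext b
      rw [Submodule.mem_map]
      constructor
      · rintro ⟨c, hc, rfl⟩
        exact (hmem c).1 hc
      · intro hb
        refine ⟨b ∘ τ.symm, (hmem _).2 ?_, ?_⟩
        · have : (b ∘ τ.symm) ∘ τ = b := by ext; simp
          rw [this]; exact hb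
        · ext i
          show (b ∘ τ.symm) (τ i) = b i
          simp
    rw [← he]
    exact (e.submoduleMap (Nu u)).finrank_eq
  · refine ⟨b ∘ τ.symm, (hmem _).2 ?_, ?_⟩
    · have : (b ∘ τ.symm) ∘ τ = b := by ext; simp
      rw [this]; exact hb
    · rw [hmi] at hbv
      rwa [comp_equiv_symm_dotProduct]

theorem core_all {u v : Fin 6 → ℝ} (hd : dt u = 0)
    (H : ∀ α β : ℂ, minr (fun i => α * (u i : ℂ) + β * (v i : ℂ)) = 0 → α = 0 ∧ β = 0) :
    Module.finrank ℝ (Nu u) = 2 ∧ ∃ b ∈ Nu u, b ⬝ᵥ minr v ≠ 0 := by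
  have hu : minr u ≠ 0 := by
    intro h
    have := (H 1 0 ?_).1
    · exact one_ne_zero this
    · ext i
      have := congrArg (fun x : ℝ => (x : ℂ)) (congrFun h i)
      fin_cases i <;> simpa [minr] using this
  by_cases h0 : u 0 * u 1 - u 3 ^ 2 = 0
  swap
  · exact core hd h0 H
  by_cases h1 : u 0 * u 2 - u 4 ^ 2 = 0
  swap
  · let σ : Equiv.Perm (Fin 6) := Equiv.swap 1 2 * Equiv.swap 3 4
    let τ : Equiv.Perm (Fin 6) := Equiv.swap 0 1 * Equiv.swap 4 5
    have s0 : σ 0 = 0 := by decide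
    have s1 : σ 1 = 2 := by decide
    have s2 : σ 2 = 1 := by decide
    have s3 : σ 3 = 4 := by decide
    have s4 : σ 4 = 3 := by decide
    have s5 : σ 5 = 5 := by decide
    have t0 : τ 0 = 1 := by decide
    have t1 : τ 1 = 0 := by decide
    have t2 : τ 2 = 2 := by decide
    have t3 : τ 3 = 3 := by decide
    have t4 : τ 4 = 5 := by decide
    have t5 : τ 5 = 4 := by decide
    clear_value σ τ
    refine core_perm (σ := σ) (τ := τ) ?_ ?_ (core ?_ ?_ ?_)
    · intro b w
      rw [W_mulVec, W_mulVec]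
      ext i; fin_cases i <;> simp [s0, s1, s2, s3, s4, s5, t0, t1, t2, t3, t4, t5] <;> ring
    · intro w
      ext i; fin_cases i <;> simp [minr, s0, s1, s2, s3, s4, s5, t0, t1, t2, t3, t4, t5] <;> ring
    · rw [← hd]; simp [dt, s0, s1, s2, s3, s4, s5]; ring
    · simpa [s0, s1, s3] using h1
    · intro α β h
      refine H α β ?_
      ext i
      have e0 := congrFun h 0
      have e1 := congrFun h 1
      have e2 := congrFun h 2
      have e3 := congrFun h 3
      have e4 := congrFun h 4
      have e5 := congrFun h 5
      simp [minr, s0, s1, s2, s3, s4, s5] at e0 e1 e2 e3 e4 e5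
      fin_cases i <;> simp [minr]
      · linear_combination e1
      · linear_combination e0
      · linear_combination e2
      · linear_combination e3
      · linear_combination e5
      · linear_combination e4
  by_cases h2 : u 1 * u 2 - u 5 ^ 2 = 0
  swap
  · let σ : Equiv.Perm (Fin 6) := Equiv.swap 0 2 * Equiv.swap 3 5
    have s0 : σ 0 = 2 := by decide
    have s1 : σ 1 = 1 := by decide
    have s2 : σ 2 = 0 := by decide
    have s3 : σ 3 = 5 := by decide
    have s4 : σ 4 = 4 := by decide
    have s5 : σ 5 = 3 := by decide
    clear_value σ
    refine core_perm (σ := σ) (τ := σ) ?_ ?_ (core ?_ ?_ ?_)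
    · intro b w
      rw [W_mulVec, W_mulVec]
      ext i; fin_cases i <;> simp [s0, s1, s2, s3, s4, s5] <;> ring
    · intro w
      ext i; fin_cases i <;> simp [minr, s0, s1, s2, s3, s4, s5] <;> ring
    · rw [← hd]; simp [dt, s0, s1, s2, s3, s4, s5]; ring
    · simpa [s0, s1, s3, mul_comm] using h2
    · intro α β h
      refine H α β ?_
      ext i
      have e0 := congrFun h 0
      have e1 := congrFun h 1
      have e2 := congrFun h 2
      have e3 := congrFun h 3
      have e4 := congrFun h 4
      have e5 := congrFun h 5
      simp [minr, s0, s1, s2, s3, s4, s5] at e0 e1 e2 e3 e4 e5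
      fin_cases i <;> simp [minr]
      · linear_combination e2
      · linear_combination e1
      · linear_combination e0
      · linear_combination e5
      · linear_combination e4
      · linear_combination e3
  exfalso
  apply hu
  unfold dt at hd
  have m3 : u 0 * u 5 - u 3 * u 4 = 0 := by
    have : (u 0 * u 5 - u 3 * u 4) ^ 2 = 0 := by
      linear_combination (u 0 * u 2 - u 4 ^ 2) * h0 - u 0 * hd
    simpa using this
  have m4 : u 1 * u 4 - u 3 * u 5 = 0 := by
    have : (u 1 * u 4 - u 3 * u 5) ^ 2 = 0 := by
      linear_combination (u 1 * u 2 - u 5 ^ 2) * h0 - u 1 * hd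
    simpa using this
  have m5 : u 2 * u 3 - u 4 * u 5 = 0 := by
    have : (u 2 * u 3 - u 4 * u 5) ^ 2 = 0 := by
      linear_combination (u 1 * u 2 - u 5 ^ 2) * h1 - u 2 * hd
    simpa using this
  ext i
  fin_cases i <;> simp [minr, h0, h1, h2, m3, m4, m5]

/-- A pencil-free kernel basis with a singular member. -/
theorem kernel_basis {f : MvPolynomial (Fin 3) ℝ} (hf : IsSmooth f)
    {G : Matrix (Fin 6) (Fin 6) ℝ} (hG : G ∈ GramSpectrahedron f)
    (h2 : Module.finrank ℝ (LinearMap.ker G.mulVecLin) = 2) :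
    ∃ u v : Fin 6 → ℝ, u ≠ 0 ∧ G *ᵥ u = 0 ∧ G *ᵥ v = 0 ∧ dt u = 0 ∧
      (∀ x, G *ᵥ x = 0 → ∃ a b : ℝ, x = a • u + b • v) ∧
      (∀ α β : ℂ, minr (fun i => α * (u i : ℂ) + β * (v i : ℂ)) = 0 → α = 0 ∧ β = 0) := by
  let B := Module.finBasisOfFinrankEq ℝ (LinearMap.ker G.mulVecLin) h2
  set e : Fin 6 → ℝ := (B 0).1 with he
  set g : Fin 6 → ℝ := (B 1).1 with hg
  have hGe : G *ᵥ e = 0 := (B 0).2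
  have hGg : G *ᵥ g = 0 := (B 1).2
  have hspan : ∀ x, G *ᵥ x = 0 → ∃ a b : ℝ, x = a • e + b • g := by
    intro x hx
    have := B.sum_repr ⟨x, hx⟩
    rw [Fin.sum_univ_two] at this
    exact ⟨_, _, (congrArg Subtype.val this).symm⟩
  have hind : ∀ a b : ℝ, a • e + b • g = 0 → a = 0 ∧ b = 0 := by
    intro a b h
    have := LinearIndependent.pair_iff.1 (by
      have := B.linearIndependent
      have e : (B : Fin 2 → _) = ![B 0, B 1] := by ext i; fin_cases i <;> rfl
      rw [e] at this; exact this) a b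
    exact this (Subtype.ext h)
  obtain ⟨θ, hθ⟩ : (0 : ℝ) ∈ Set.range fun θ : ℝ => dt (Real.cos θ • e + Real.sin θ • g) := by
    have hc : Continuous fun θ : ℝ => dt (Real.cos θ • e + Real.sin θ • g) := by
      simp only [dt, Pi.add_apply, Pi.smul_apply, smul_eq_mul]
      fun_prop
    have h0 : dt (Real.cos 0 • e + Real.sin 0 • g) = dt e := by simp
    have hπ : dt (Real.cos Real.pi • e + Real.sin Real.pi • g) = -dt e := by
      simp [dt]; ring
    rcases le_total (dt e) 0 with h | h
    · exact mem_range_of_exists_le_of_exists_ge hc ⟨0, by rw [h0]; exact h⟩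
        ⟨Real.pi, by rw [hπ]; linarith⟩
    · exact mem_range_of_exists_le_of_exists_ge hc ⟨Real.pi, by rw [hπ]; linarith⟩
        ⟨0, by rw [h0]; exact h⟩
  set c := Real.cos θ
  set s := Real.sin θ
  have hcs : c ^ 2 + s ^ 2 = 1 := by have := Real.sin_sq_add_cos_sq θ; linarith
  have hu0 : c • e + s • g ≠ 0 := by
    intro h
    obtain ⟨h1, h2⟩ := hind _ _ h
    rw [h1, h2] at hcs; norm_num at hcs
  refine ⟨c • e + s • g, (-s) • e + c • g, hu0, ?_, ?_, hθ, ?_, ?_⟩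
  · rw [mulVec_add, mulVec_smul, mulVec_smul, hGe, hGg]; simp
  · rw [mulVec_add, mulVec_smul, mulVec_smul, hGe, hGg]; simp
  · intro x hx
    obtain ⟨a, b, rfl⟩ := hspan x hx
    refine ⟨a * c + b * s, b * c - a * s, ?_⟩
    ext i
    simp only [Pi.add_apply, Pi.smul_apply, smul_eq_mul]
    linear_combination (-(a * e i + b * g i)) * hcs
  · intro α β hm
    by_contra hne
    refine minr_ne_complex hf hG ?_ ?_ hm
    · intro h
      apply hne
      have hr : ∀ p q : ℝ, p • (c • e + s • g) + q • ((-s) • e + c • g) = 0 → p = 0 ∧ q = 0 := by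
        intro p q hpq
        have := hind (p * c - q * s) (p * s + q * c) (by rw [← hpq]; module)
        constructor
        · linear_combination c * this.1 + s * this.2 - p * hcs
        · linear_combination -s * this.1 + c * this.2 - q * hcs
      have h1 := hr α.re β.re (by
        ext i
        have := congrArg Complex.re (congrFun h i)
        simpa only [Pi.add_apply, Pi.smul_apply, smul_eq_mul, Complex.add_re, Complex.re_mul_ofReal,
          Pi.zero_apply, Complex.zero_re] using this)
      have h2 := hr α.im β.im (by
        ext i
        have := congrArg Complex.im (congrFun h i)
        simpa only [Pi.add_apply, Pi.smul_apply, smul_eq_mul, Complex.add_im, Complex.im_mul_ofReal,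
          Pi.zero_apply, Complex.zero_im] using this)
      exact ⟨Complex.ext h1.1 h2.1, Complex.ext h1.2 h2.2⟩
    · intro i
      have k1 : ∑ j, (G i j : ℂ) * ((c • e + s • g) j : ℝ) = 0 := by
        have : (G *ᵥ (c • e + s • g)) i = 0 := by
          rw [mulVec_add, mulVec_smul, mulVec_smul, hGe, hGg]; simp
        have := congrArg (fun x : ℝ => (x : ℂ)) this
        simp only [mulVec, dotProduct, Complex.ofReal_sum, Complex.ofReal_mul, Complex.ofReal_zero] at this
        exact this
      have k2 : ∑ j, (G i j : ℂ) * (((-s) • e + c • g) j : ℝ) = 0 := by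
        have : (G *ᵥ ((-s) • e + c • g)) i = 0 := by
          rw [mulVec_add, mulVec_smul, mulVec_smul, hGe, hGg]; simp
        have := congrArg (fun x : ℝ => (x : ℂ)) this
        simp only [mulVec, dotProduct, Complex.ofReal_sum, Complex.ofReal_mul, Complex.ofReal_zero] at this
        exact this
      have : ∀ j, (G i j : ℂ) * (α * ((c • e + s • g) j : ℝ) + β * (((-s) • e + c • g) j : ℝ))
        = α * ((G i j : ℂ) * ((c • e + s • g) j : ℝ)) + β * ((G i j : ℂ) * (((-s) • e + c • g) j : ℝ)) :=
        fun j => by ring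
      simp only [this, Finset.sum_add_distrib, ← Finset.mul_sum]
      rw [k1, k2]; simp

/-- `W` as a linear map. -/
def Wl : (Fin 6 → ℝ) →ₗ[ℝ] Matrix (Fin 6) (Fin 6) ℝ where
  toFun b := W b
  map_add' := W_add
  map_smul' := W_smul

theorem Wl_inj : Function.Injective Wl := by
  rw [injective_iff_map_eq_zero]
  intro b hb
  have e0 := congrFun (congrFun hb 0) 1
  have e1 := congrFun (congrFun hb 0) 2
  have e2 := congrFun (congrFun hb 1) 2
  have e3 := congrFun (congrFun hb 0) 5
  have e4 := congrFun (congrFun hb 1) 4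
  have e5 := congrFun (congrFun hb 2) 3
  simp [Wl, W] at e0 e1 e2 e3 e4 e5
  ext i; fin_cases i <;> simp [*]

theorem exists_good {f : MvPolynomial (Fin 3) ℝ} (hf : IsSmooth f) (hp : IsPsd f)
    (hhom : f.IsHomogeneous 4) : ∃ u : Fin 6 → ℝ, u ≠ 0 ∧ Module.finrank ℝ (Nu u) = 2 ∧
      ∃ G ∈ GramSpectrahedron f, G *ᵥ u = 0 ∧
        ∀ x, x ∉ Submodule.span ℝ {u} → 0 < x ⬝ᵥ G *ᵥ x := by
  obtain ⟨G, hG, h2⟩ := corank_eq_two hf hp hhom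
  obtain ⟨u, v, hu, hGu, hGv, hd, hspan, H⟩ := kernel_basis hf hG h2
  obtain ⟨hN, b, hb, hbv⟩ := core_all hd H
  refine ⟨u, hu, hN, ?_⟩
  obtain ⟨b, hb, hbv⟩ : ∃ b ∈ Nu u, 0 < b ⬝ᵥ minr v := by
    rcases lt_or_gt_of_ne hbv with h | h
    · exact ⟨-b, (Nu u).neg_mem hb, by rw [neg_dotProduct]; linarith⟩
    · exact ⟨b, hb, h⟩
  have hb' : W b *ᵥ u = 0 := hb
  obtain ⟨ε, hε, hpos, hps⟩ := small_pert (G := G) (D := W b) hG.1 (W_symm b) (Submodule.span ℝ {u}) (by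
    intro x hx
    obtain ⟨t, rfl⟩ := Submodule.mem_span_singleton.1 hx
    rw [mulVec_smul, mulVec_smul, hGu, hb']; simp) (by
    intro x hx hxN
    obtain ⟨a, c, rfl⟩ := hspan x hx
    have hc : c ≠ 0 := by
      rintro rfl
      exact hxN (Submodule.mem_span_singleton.2 ⟨a, by simp⟩)
    have huv : u ⬝ᵥ W b *ᵥ v = 0 := by rw [symm_dot (W_symm b), hb', dotProduct_zero]
    rw [mulVec_add, mulVec_smul, mulVec_smul, hb', smul_zero, zero_add, dotProduct_smul,
      add_dotProduct, smul_dotProduct, smul_dotProduct, huv, smul_zero, zero_add, W_quad,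
      smul_eq_mul, smul_eq_mul]
    have : 0 < c ^ 2 := by positivity
    nlinarith [mul_pos this hbv])
  refine ⟨G + ε • W b, ?_, ?_, hpos⟩
  · rw [← W_smul] at hps ⊢
    exact mem_gram' (mem_gram.1 hG).2 _ hps
  · rw [add_mulVec, smul_mulVec, hGu, hb']; simp

theorem main_face (f : MvPolynomial (Fin 3) ℝ) (hhom : f.IsHomogeneous 4)
    (hsm : IsSmooth f) (hpsd : IsPsd f) :
    ∃ F : Set (Matrix (Fin 6) (Fin 6) ℝ),
      IsFace (GramSpectrahedron f) F ∧
      Module.finrank ℝ (vectorSpan ℝ F) = 2 ∧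
      ∀ G ∈ intrinsicInterior ℝ F, G.rank = 5 := by
  obtain ⟨u, hu, hN, G₁, hG₁, hG₁u, hpos⟩ := exists_good hsm hpsd hhom
  set F : Set (Matrix (Fin 6) (Fin 6) ℝ) := {A | A ∈ GramSpectrahedron f ∧ A *ᵥ u = 0} with hF
  have hG₁F : G₁ ∈ F := ⟨hG₁, hG₁u⟩
  refine ⟨F, ⟨fun A hA => hA.1, ?_, ?_⟩, ?_, ?_⟩
  · intro A hA B hB s t hs ht hst
    have hA' := mem_gram.1 hA.1
    have hB' := mem_gram.1 hB.1
    refine ⟨mem_gram.2 ⟨(hA'.1.smul hs).add (hB'.1.smul ht), fun a => ?_⟩, ?_⟩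
    · rw [add_mulVec, smul_mulVec, smul_mulVec, dotProduct_add, dotProduct_smul, dotProduct_smul,
        hA'.2, hB'.2, ← add_smul, hst, one_smul]
    · rw [add_mulVec, smul_mulVec, smul_mulVec, hA.2, hB.2]; simp
  · intro A hA B hB t ht ht1 h
    have hu0 := h.2
    have hA0 := ((psd_iff A).1 hA.1).2 u
    have hB0 := ((psd_iff B).1 hB.1).2 u
    have e := congrArg (fun w => u ⬝ᵥ w) hu0
    simp only [add_mulVec, smul_mulVec, dotProduct_add, dotProduct_smul, smul_eq_mul, dotProduct_zero] at e
    have k1 : 0 ≤ t * (u ⬝ᵥ A *ᵥ u) := mul_nonneg ht.le hA0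
    have k2 : 0 ≤ (1 - t) * (u ⬝ᵥ B *ᵥ u) := mul_nonneg (by linarith) hB0
    have k3 : t * (u ⬝ᵥ A *ᵥ u) = 0 := by linarith
    have k4 : (1 - t) * (u ⬝ᵥ B *ᵥ u) = 0 := by linarith
    refine ⟨⟨hA, psd_ker hA.1 ?_⟩, ⟨hB, psd_ker hB.1 ?_⟩⟩
    · exact (mul_eq_zero.1 k3).resolve_left ht.ne'
    · exact (mul_eq_zero.1 k4).resolve_left (by linarith)
  · have hV : vectorSpan ℝ F = (Nu u).map Wl := by
      apply le_antisymm
      · rw [vectorSpan_def, Submodule.span_le]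
        rintro _ ⟨A, hA, B, hB, rfl⟩
        obtain ⟨b, hb⟩ := gram_zero (D := A - B) (by
          unfold Matrix.IsSymm
          rw [transpose_sub, (gram_symm hA.1).eq, (gram_symm hB.1).eq]) (fun a => by
          rw [sub_mulVec, dotProduct_sub, (mem_gram.1 hA.1).2, (mem_gram.1 hB.1).2, sub_self])
        refine ⟨b, ?_, hb.symm⟩
        show W b *ᵥ u = 0
        rw [← hb, sub_mulVec, hA.2, hB.2, sub_zero]
      · rintro _ ⟨b, hb, rfl⟩
        have hb' : W b *ᵥ u = 0 := hb
        obtain ⟨ε, hε, -, hps⟩ := small_pert (G := G₁) (D := W b) hG₁.1 (W_symm b)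
          (Submodule.span ℝ {u}) (by
            intro x hx
            obtain ⟨t, rfl⟩ := Submodule.mem_span_singleton.1 hx
            rw [mulVec_smul, mulVec_smul, hG₁u, hb']; simp) (by
            intro x hx hxN
            have := hpos x hxN
            rw [hx, dotProduct_zero] at this
            exact absurd this (lt_irrefl _))
        have hmem : G₁ + ε • W b ∈ F := by
          refine ⟨?_, ?_⟩
          · rw [← W_smul] at hps ⊢
            exact mem_gram' (mem_gram.1 hG₁).2 _ hps
          · rw [add_mulVec, smul_mulVec, hG₁u, hb']; simp
        have h1 := vsub_mem_vectorSpan ℝ hmem hG₁F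
        have h2 : (G₁ + ε • W b) -ᵥ G₁ = ε • W b := by
          rw [vsub_eq_sub, add_sub_cancel_left]
        rw [h2] at h1
        have h3 := (vectorSpan ℝ F).smul_mem ε⁻¹ h1
        rw [smul_smul, inv_mul_cancel₀ hε.ne', one_smul] at h3
        exact h3
    rw [hV, ((Nu u).equivMapOfInjective Wl Wl_inj).symm.finrank_eq, hN]
  · intro A hA
    have hAF : A ∈ F := intrinsicInterior_subset hA
    obtain ⟨y, hy, hyA⟩ := mem_intrinsicInterior.1 hA
    have hAs : A ∈ affineSpan ℝ F := subset_affineSpan ℝ F hAF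
    have hGs : G₁ ∈ affineSpan ℝ F := subset_affineSpan ℝ F hG₁F
    let γ : ℝ → affineSpan ℝ F := fun t =>
      ⟨AffineMap.lineMap G₁ A t, AffineMap.lineMap_mem t hGs hAs⟩
    have hγ : Continuous γ := by
      refine Continuous.subtype_mk ?_ _
      have : (fun t : ℝ => AffineMap.lineMap G₁ A t) = fun t : ℝ => (1 - t) • G₁ + t • A := by
        funext t; rw [AffineMap.lineMap_apply_module]
      show Continuous (fun t : ℝ => AffineMap.lineMap G₁ A t)
      rw [this]
      fun_prop
    have hγ1 : γ 1 = y := by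
      apply Subtype.ext
      simp [γ, hyA]
    have hev : ∀ᶠ t in nhds (1 : ℝ), γ t ∈ interior ((↑) ⁻¹' F : Set (affineSpan ℝ F)) :=
      hγ.continuousAt.eventually (by
        rw [hγ1]; exact isOpen_interior.mem_nhds hy)
    have hev2 : ∀ᶠ t in nhdsWithin (1 : ℝ) (Set.Ioi 1),
        γ t ∈ interior ((↑) ⁻¹' F : Set (affineSpan ℝ F)) := hev.filter_mono nhdsWithin_le_nhds
    obtain ⟨t, ht, ht1⟩ := (hev2.and self_mem_nhdsWithin).exists
    have ht1' : 1 < t := ht1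
    have htF : AffineMap.lineMap G₁ A t ∈ F := by
      have h : γ t ∈ ((↑) ⁻¹' F : Set (affineSpan ℝ F)) := interior_subset ht
      exact h
    have hker : LinearMap.ker A.mulVecLin = Submodule.span ℝ {u} := by
      apply le_antisymm
      · intro x hx
        by_contra hxN
        have hAx : A *ᵥ x = 0 := hx
        have h1 := hpos x hxN
        have h2 := ((psd_iff _).1 htF.1.1).2 x
        rw [AffineMap.lineMap_apply_module, add_mulVec, smul_mulVec, smul_mulVec, hAx, smul_zero,
          add_zero, dotProduct_smul, smul_eq_mul] at h2
        nlinarith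
      · rw [Submodule.span_singleton_le_iff_mem]
        exact hAF.2
    have := rank_ker A
    rw [hker, finrank_span_singleton hu] at this
    omega

/-- The Gram spectrahedron of a smooth psd ternary quartic has a face of rank 5 and
dimension 2: a face of dimension 2 all of whose relative interior points have
rank 5. -/
theorem exists_two_dimensional_rank_five_face
    (f : MvPolynomial (Fin 3) ℝ) (hhom : f.IsHomogeneous 4)
    (hsm : IsSmooth f) (hpsd : IsPsd f) :
    ∃ F : Set (Matrix (Fin 6) (Fin 6) ℝ),
      IsFace (GramSpectrahedron f) F ∧
      Module.finrank ℝ (vectorSpan ℝ F) = 2 ∧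
      ∀ G ∈ intrinsicInterior ℝ F, G.rank = 5 := by
  exact main_face f hhom hsm hpsd
end
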